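/- Let Ω ⊆ ℝ² be a C² domain and let u ∈ C²(cl Ω) be non-constant with M[u] + H₀ = 0 in Ω for some constant H₀ ∈ ℝ, such that u and ⟨∇u, η⟩ are constant on each connected component of ∂Ω, and inf_Ω u > −∞. Assume ∂Ω is disconnected, and that ∂⋆Ω is nonempty, connected, and mildly v-transverse for some unit vector v ∈ ℝ² (i.e. ⟨η, v⟩ does not change sign on ∂⋆Ω). Then H₀ ≠ 0 and there exist a unit vector e ∈ ℝ², real numbers s₁ < s₂, t₀, z₀ ∈ ℝ, and a strictly monotone function u₀ : (s₁, s₂) → ℝ such that Ω = {x ∈ ℝ² : s₁ < ⟨x, e⟩ < s₂}, u(x) = u₀(⟨x, e⟩) for all x ∈ Ω, and (t − t₀)² + (u₀(t) − z₀)² = 1/H₀² for all t ∈ (s₁, s₂); that is, Ω is a slab (0,T) × ℝ and the graph of u is a monotone piece of a circular cylinder of radius 1/|H₀|. -/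

import Mathlib

open MeasureTheory Set Metric Filter
open scoped RealInnerProductSpace Topology ENNReal

noncomputable section

variable {n : ℕ}

/-- The quasilinear operator matrix `A(p)` applied to a vector `v`:
`A(p)v = a(|p|) v + (a'(|p|)/|p|) ⟨p,v⟩ p` (with the second term vanishing at `p = 0`). -/
def Aop (a : ℝ → ℝ) (p v : EuclideanSpace ℝ (Fin n)) : EuclideanSpace ℝ (Fin n) :=
  a ‖p‖ • v + ((deriv a ‖p‖ / ‖p‖) * ⟪p, v⟫) • p

/-- `λ₁(t) = a(t) + t·a'(t) = (t a(t))'`. -/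
def lam1 (a : ℝ → ℝ) (t : ℝ) : ℝ := a t + t * deriv a t

/-- `λ₂(t) = a(t)`. -/
def lam2 (a : ℝ → ℝ) (t : ℝ) : ℝ := a t

/-- `λmax(t) = max{λ₁(t), λ₂(t)}`. -/
def lamMax (a : ℝ → ℝ) (t : ℝ) : ℝ := max (lam1 a t) (lam2 a t)

/-- A Lipschitz test function with compact support contained in `Ω`. -/
def IsTestOn (Ω : Set (EuclideanSpace ℝ (Fin n))) (φ : EuclideanSpace ℝ (Fin n) → ℝ) : Prop :=
  (∃ K, LipschitzWith K φ) ∧ HasCompactSupport φ ∧ tsupport φ ⊆ Ω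

/-- `u` is a weak solution of `div(a(|∇u|)∇u) + f(u) = 0` in `Ω`. -/
def IsWeakSolution (a f : ℝ → ℝ) (Ω : Set (EuclideanSpace ℝ (Fin n)))
    (u : EuclideanSpace ℝ (Fin n) → ℝ) : Prop :=
  ∀ φ : EuclideanSpace ℝ (Fin n) → ℝ, IsTestOn Ω φ →
    ∫ x in Ω, a ‖gradient u x‖ * ⟪gradient u x, gradient φ x⟫
      = ∫ x in Ω, f (u x) * φ x

/-- The stability inequality for a solution `u`. -/
def IsStable (a f : ℝ → ℝ) (Ω : Set (EuclideanSpace ℝ (Fin n)))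
    (u : EuclideanSpace ℝ (Fin n) → ℝ) : Prop :=
  ∀ φ : EuclideanSpace ℝ (Fin n) → ℝ, IsTestOn Ω φ →
    ∫ x in Ω, deriv f (u x) * φ x ^ 2
      ≤ ∫ x in Ω, ⟪Aop a (gradient u x) (gradient φ x), gradient φ x⟫

/-- `u` has moderate energy growth in `Ω₀`. -/
def ModerateEnergyGrowth (a : ℝ → ℝ) (u : EuclideanSpace ℝ (Fin n) → ℝ)
    (Ω₀ : Set (EuclideanSpace ℝ (Fin n))) : Prop :=
  ∃ φ : ℕ → EuclideanSpace ℝ (Fin n) → ℝ,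
    (∀ j, ∃ K, LipschitzWith K (φ j)) ∧
    (∀ j, HasCompactSupport (φ j)) ∧
    (∀ j x, 0 ≤ φ j x) ∧
    (∀ K : Set (EuclideanSpace ℝ (Fin n)), IsCompact K → K ⊆ closure Ω₀ →
      TendstoUniformlyOn (fun j => φ j) (fun _ => (1 : ℝ)) atTop K) ∧
    Tendsto (fun j => ∫ x in Ω₀, ‖gradient u x‖ ^ 2 *
        ⟪Aop a (gradient u x) (gradient (φ j) x), gradient (φ j) x⟫)
      atTop (nhds 0)

/-- A `C^k` domain: nonempty, open, connected, with boundary locally given by a regular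
`C^k` defining function. -/
def IsCkDomain (k : ℕ∞) (Ω : Set (EuclideanSpace ℝ (Fin n))) : Prop :=
  Ω.Nonempty ∧ IsOpen Ω ∧ IsConnected Ω ∧
    ∀ p ∈ frontier Ω, ∃ V : Set (EuclideanSpace ℝ (Fin n)),
      ∃ g : EuclideanSpace ℝ (Fin n) → ℝ,
        IsOpen V ∧ p ∈ V ∧ ContDiffOn ℝ k g V ∧ (∀ x ∈ V, gradient g x ≠ 0) ∧
        Ω ∩ V = {x ∈ V | g x < 0}

/-- A `C^k` domain together with its interior unit normal field `η`. -/
def IsCkDomainWithNormal (k : ℕ∞) (Ω : Set (EuclideanSpace ℝ (Fin n)))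
    (η : EuclideanSpace ℝ (Fin n) → EuclideanSpace ℝ (Fin n)) : Prop :=
  Ω.Nonempty ∧ IsOpen Ω ∧ IsConnected Ω ∧
    ∀ p ∈ frontier Ω, ∃ V : Set (EuclideanSpace ℝ (Fin n)),
      ∃ g : EuclideanSpace ℝ (Fin n) → ℝ,
        IsOpen V ∧ p ∈ V ∧ ContDiffOn ℝ k g V ∧ (∀ x ∈ V, gradient g x ≠ 0) ∧
        Ω ∩ V = {x ∈ V | g x < 0} ∧
        η p = -(‖gradient g p‖⁻¹ • gradient g p)

/-- `a ∈ C^{1,1}_loc([0,∞))`: `C¹` on `[0,∞)` with locally Lipschitz derivative. -/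
def C11Loc (a : ℝ → ℝ) : Prop :=
  ContDiffOn ℝ 1 a (Ici 0) ∧
    ∀ t ∈ Ici (0 : ℝ), ∃ V ∈ 𝓝[Ici (0 : ℝ)] t, ∃ K, LipschitzOnWith K (deriv a) V

/-- The mean curvature operator `M[u] = div(∇u/√(1+|∇u|²))`, written as the trace of the
derivative of the vector field `x ↦ (1+|∇u|²)^{-1/2} ∇u`. -/
def meanCurv (u : EuclideanSpace ℝ (Fin n) → ℝ) (x : EuclideanSpace ℝ (Fin n)) : ℝ :=
  ∑ i : Fin n,
    ⟪(fderiv ℝ (fun y => (Real.sqrt (1 + ‖gradient u y‖ ^ 2))⁻¹ • gradient u y) x)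
        (EuclideanSpace.single i (1 : ℝ)),
      EuclideanSpace.single i (1 : ℝ)⟫


/-! ### Coordinate calculus in the plane -/

/-- The Euclidean plane. -/
abbrev Pl := EuclideanSpace ℝ (Fin 2)

/-- The linear form with coefficients `a`, `b`. -/
def lf (a b : ℝ) : Pl →L[ℝ] ℝ :=
  a • (EuclideanSpace.proj (0 : Fin 2) : Pl →L[ℝ] ℝ) + b • (EuclideanSpace.proj (1 : Fin 2) : Pl →L[ℝ] ℝ)

lemma lf_apply (a b : ℝ) (x : Pl) : lf a b x = a * x 0 + b * x 1 := by
  simp [lf]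

/-- First coordinate vector. -/
def e0 : Pl := EuclideanSpace.single 0 1
/-- Second coordinate vector. -/
def e1 : Pl := EuclideanSpace.single 1 1

@[simp] lemma e0_0 : e0 0 = 1 := by simp [e0]
@[simp] lemma e0_1 : e0 1 = 0 := by simp [e0]
@[simp] lemma e1_0 : e1 0 = 0 := by simp [e1]
@[simp] lemma e1_1 : e1 1 = 1 := by simp [e1]

lemma pl_eq (x : Pl) : x = x 0 • e0 + x 1 • e1 := by
  ext i; fin_cases i <;> simp

lemma clm_eq_lf (φ : Pl →L[ℝ] ℝ) : φ = lf (φ e0) (φ e1) := by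
  ext x
  conv_lhs => rw [pl_eq x]
  rw [lf_apply]; simp; ring

lemma continuous_coord (i : Fin 2) : Continuous (fun x : Pl => x i) :=
  (EuclideanSpace.proj i : Pl →L[ℝ] ℝ).continuous

lemma abs_coord_le (x : Pl) (i : Fin 2) : |x i| ≤ ‖x‖ := by
  simpa using PiLp.norm_apply_le x i

lemma normsq_eq (x : Pl) : ‖x‖ ^ 2 = x 0 ^ 2 + x 1 ^ 2 := by
  rw [EuclideanSpace.norm_sq_eq]; simp [Fin.sum_univ_two]

lemma inner_eq (x y : Pl) : ⟪x, y⟫ = x 0 * y 0 + x 1 * y 1 := by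
  simp [PiLp.inner_apply, Fin.sum_univ_two]; ring

/-- `h` is continuously differentiable on `Ω` with partial derivatives `h1`, `h2`. -/
structure C1 (Ω : Set Pl) (h h1 h2 : Pl → ℝ) : Prop where
  der : ∀ x ∈ Ω, HasFDerivAt h (lf (h1 x) (h2 x)) x
  c1 : ContinuousOn h1 Ω
  c2 : ContinuousOn h2 Ω

namespace C1
variable {Ω : Set Pl} {f f1 f2 g g1 g2 : Pl → ℝ}

lemma cont (hf : C1 Ω f f1 f2) : ContinuousOn f Ω := fun x hx =>
  (hf.der x hx).continuousAt.continuousWithinAt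

lemma congr_der (hf : C1 Ω f f1 f2) (h1 : ∀ x ∈ Ω, f1 x = g1 x) (h2 : ∀ x ∈ Ω, f2 x = g2 x) :
    C1 Ω f g1 g2 where
  der x hx := by rw [← h1 x hx, ← h2 x hx]; exact hf.der x hx
  c1 := hf.c1.congr fun x hx => (h1 x hx).symm
  c2 := hf.c2.congr fun x hx => (h2 x hx).symm

lemma mono {Ω' : Set Pl} (hf : C1 Ω f f1 f2) (h : Ω' ⊆ Ω) : C1 Ω' f f1 f2 :=
  ⟨fun x hx => hf.der x (h hx), hf.c1.mono h, hf.c2.mono h⟩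

lemma const (c : ℝ) : C1 Ω (fun _ => c) (fun _ => 0) (fun _ => 0) where
  der x _ := by
    have : lf 0 0 = 0 := by simp [lf]
    simpa [this] using hasFDerivAt_const c x
  c1 := continuousOn_const
  c2 := continuousOn_const

lemma x0 : C1 Ω (fun x => x 0) (fun _ => 1) (fun _ => 0) where
  der x _ := by
    have : lf 1 0 = (EuclideanSpace.proj (0 : Fin 2) : Pl →L[ℝ] ℝ) := by simp [lf]
    rw [this]; exact (EuclideanSpace.proj (0 : Fin 2) : Pl →L[ℝ] ℝ).hasFDerivAt
  c1 := continuousOn_const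
  c2 := continuousOn_const

lemma x1 : C1 Ω (fun x => x 1) (fun _ => 0) (fun _ => 1) where
  der x _ := by
    have : lf 0 1 = (EuclideanSpace.proj (1 : Fin 2) : Pl →L[ℝ] ℝ) := by simp [lf]
    rw [this]; exact (EuclideanSpace.proj (1 : Fin 2) : Pl →L[ℝ] ℝ).hasFDerivAt
  c1 := continuousOn_const
  c2 := continuousOn_const

lemma add (hf : C1 Ω f f1 f2) (hg : C1 Ω g g1 g2) :
    C1 Ω (fun x => f x + g x) (fun x => f1 x + g1 x) (fun x => f2 x + g2 x) where
  der x hx := by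
    refine HasFDerivAt.congr_fderiv ((hf.der x hx).add (hg.der x hx)) (ContinuousLinearMap.ext fun y => ?_)
    simp [lf_apply]; ring
  c1 := hf.c1.add hg.c1
  c2 := hf.c2.add hg.c2

lemma sub (hf : C1 Ω f f1 f2) (hg : C1 Ω g g1 g2) :
    C1 Ω (fun x => f x - g x) (fun x => f1 x - g1 x) (fun x => f2 x - g2 x) where
  der x hx := by
    refine HasFDerivAt.congr_fderiv ((hf.der x hx).sub (hg.der x hx)) (ContinuousLinearMap.ext fun y => ?_)
    simp [lf_apply]; ring
  c1 := hf.c1.sub hg.c1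
  c2 := hf.c2.sub hg.c2

lemma neg (hf : C1 Ω f f1 f2) :
    C1 Ω (fun x => - f x) (fun x => - f1 x) (fun x => - f2 x) where
  der x hx := by
    refine HasFDerivAt.congr_fderiv ((hf.der x hx).neg) (ContinuousLinearMap.ext fun y => ?_)
    simp [lf_apply]; ring
  c1 := hf.c1.neg
  c2 := hf.c2.neg

lemma mul (hf : C1 Ω f f1 f2) (hg : C1 Ω g g1 g2) :
    C1 Ω (fun x => f x * g x) (fun x => f1 x * g x + f x * g1 x)
      (fun x => f2 x * g x + f x * g2 x) where
  der x hx := by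
    refine HasFDerivAt.congr_fderiv ((hf.der x hx).mul (hg.der x hx)) (ContinuousLinearMap.ext fun y => ?_)
    simp [lf_apply]; ring
  c1 := (hf.c1.mul hg.cont).add (hf.cont.mul hg.c1)
  c2 := (hf.c2.mul hg.cont).add (hf.cont.mul hg.c2)

lemma const_mul (c : ℝ) (hf : C1 Ω f f1 f2) :
    C1 Ω (fun x => c * f x) (fun x => c * f1 x) (fun x => c * f2 x) :=
  ((C1.const c).mul hf).congr_der (fun x _ => by simp) (fun x _ => by simp)

/-- Chain rule with an outer real function. -/
lemma comp {s : Set ℝ} {φ φ' : ℝ → ℝ} (hf : C1 Ω f f1 f2) (hφ : ∀ y ∈ s, HasDerivAt φ (φ' y) y)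
    (hφ' : ContinuousOn φ' s) (hs : ∀ x ∈ Ω, f x ∈ s) :
    C1 Ω (fun x => φ (f x)) (fun x => φ' (f x) * f1 x) (fun x => φ' (f x) * f2 x) where
  der x hx := by
    refine HasFDerivAt.congr_fderiv ((hφ (f x) (hs x hx)).comp_hasFDerivAt x (hf.der x hx)) (ContinuousLinearMap.ext fun y => ?_)
    simp [lf_apply]; ring
  c1 := (hφ'.comp hf.cont hs).mul hf.c1
  c2 := (hφ'.comp hf.cont hs).mul hf.c2

lemma inv (hf : C1 Ω f f1 f2) (h0 : ∀ x ∈ Ω, f x ≠ 0) :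
    C1 Ω (fun x => (f x)⁻¹) (fun x => -((f x) ^ 2)⁻¹ * f1 x) (fun x => -((f x) ^ 2)⁻¹ * f2 x) :=
  hf.comp (s := {y | y ≠ 0}) (φ := fun y => y⁻¹) (φ' := fun y => -(y ^ 2)⁻¹)
    (fun _ hy => hasDerivAt_inv hy)
    (((continuousOn_id.pow 2).inv₀ (fun _ hy => pow_ne_zero 2 hy)).neg) h0

lemma fderiv_e0 (hf : C1 Ω f f1 f2) {x : Pl} (hx : x ∈ Ω) : fderiv ℝ f x e0 = f1 x := by
  rw [(hf.der x hx).fderiv, lf_apply]; simp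

lemma fderiv_e1 (hf : C1 Ω f f1 f2) {x : Pl} (hx : x ∈ Ω) : fderiv ℝ f x e1 = f2 x := by
  rw [(hf.der x hx).fderiv, lf_apply]; simp

lemma contDiffOn (hΩ : IsOpen Ω) (hf : C1 Ω f f1 f2) : ContDiffOn ℝ 1 f Ω := by
  rw [show (1 : WithTop ℕ∞) = 0 + 1 by simp, contDiffOn_succ_iff_fderiv_of_isOpen hΩ]
  refine ⟨fun x hx => (hf.der x hx).differentiableAt.differentiableWithinAt, by simp, ?_⟩
  rw [contDiffOn_zero]
  have : ContinuousOn (fun x => lf (f1 x) (f2 x)) Ω := by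
    unfold lf
    exact (hf.c1.smul continuousOn_const).add (hf.c2.smul continuousOn_const)
  exact this.congr fun x hx => (hf.der x hx).fderiv

lemma of_contDiffOn (hΩ : IsOpen Ω) (hf : ContDiffOn ℝ 1 f Ω) :
    C1 Ω f (fun x => fderiv ℝ f x e0) (fun x => fderiv ℝ f x e1) where
  der x hx := by
    rw [← clm_eq_lf]
    exact ((hf.differentiableOn one_ne_zero).differentiableAt (hΩ.mem_nhds hx)).hasFDerivAt
  c1 := (hf.continuousOn_fderiv_of_isOpen hΩ le_rfl).clm_apply continuousOn_const
  c2 := (hf.continuousOn_fderiv_of_isOpen hΩ le_rfl).clm_apply continuousOn_const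

end C1

/-- Continuously differentiable test functions with compact support in `Ω`. -/
structure Tst (Ω : Set Pl) (ψ ψ1 ψ2 : Pl → ℝ) : Prop where
  c : C1 univ ψ ψ1 ψ2
  k : HasCompactSupport ψ
  s : tsupport ψ ⊆ Ω

namespace Tst
variable {Ω : Set Pl} {f f1 f2 ψ ψ1 ψ2 : Pl → ℝ}

lemma cψ (h : Tst Ω ψ ψ1 ψ2) : Continuous ψ := continuousOn_univ.mp h.c.cont
lemma cψ1 (h : Tst Ω ψ ψ1 ψ2) : Continuous ψ1 := continuousOn_univ.mp h.c.c1
lemma cψ2 (h : Tst Ω ψ ψ1 ψ2) : Continuous ψ2 := continuousOn_univ.mp h.c.c2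

lemma zero0 (_h : Tst Ω ψ ψ1 ψ2) {x : Pl} (hx : x ∉ tsupport ψ) : ψ x = 0 :=
  image_eq_zero_of_notMem_tsupport hx

lemma fderiv_zero (_h : Tst Ω ψ ψ1 ψ2) {x : Pl} (hx : x ∉ tsupport ψ) : fderiv ℝ ψ x = 0 := by
  by_contra h0
  exact hx (support_fderiv_subset ℝ h0)

lemma zero1 (h : Tst Ω ψ ψ1 ψ2) {x : Pl} (hx : x ∉ tsupport ψ) : ψ1 x = 0 := by
  rw [← h.c.fderiv_e0 (mem_univ x), h.fderiv_zero hx]; simp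

lemma zero2 (h : Tst Ω ψ ψ1 ψ2) {x : Pl} (hx : x ∉ tsupport ψ) : ψ2 x = 0 := by
  rw [← h.c.fderiv_e1 (mem_univ x), h.fderiv_zero hx]; simp

/-- A function vanishing off a compact subset of the open set `Ω` and continuous on `Ω` is
continuous. -/
lemma cont_of {Ω K : Set Pl} (hΩ : IsOpen Ω) (hK : IsClosed K) (hKΩ : K ⊆ Ω) {F : Pl → ℝ}
    (hF : ContinuousOn F Ω) (h0 : ∀ x, x ∉ K → F x = 0) : Continuous F := by
  rw [continuous_iff_continuousAt]
  intro x
  by_cases hx : x ∈ Ω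
  · exact hF.continuousAt (hΩ.mem_nhds hx)
  · have : F =ᶠ[𝓝 x] fun _ => 0 := by
      filter_upwards [hK.isOpen_compl.mem_nhds (fun h => hx (hKΩ h))] with y hy using h0 y hy
    exact continuousAt_const.congr this.symm

lemma integrable_of {Ω K : Set Pl} (hΩ : IsOpen Ω) (hK : IsCompact K) (hKΩ : K ⊆ Ω) {F : Pl → ℝ}
    (hF : ContinuousOn F Ω) (h0 : ∀ x, x ∉ K → F x = 0) : Integrable F := by
  refine (cont_of hΩ hK.isClosed hKΩ hF h0).integrable_of_hasCompactSupport ?_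
  exact HasCompactSupport.intro hK h0

/-- Building a test function from a function on `Ω` vanishing off a compact set. -/
lemma of_C1 {K : Set Pl} (hΩ : IsOpen Ω) (hK : IsCompact K) (hKΩ : K ⊆ Ω) (hf : C1 Ω f f1 f2)
    (h0 : ∀ x, x ∉ K → f x = 0) (h1 : ∀ x, x ∉ K → f1 x = 0) (h2 : ∀ x, x ∉ K → f2 x = 0) :
    Tst Ω f f1 f2 where
  c := by
    refine ⟨fun x _ => ?_, (cont_of hΩ hK.isClosed hKΩ hf.c1 h1).continuousOn,
      (cont_of hΩ hK.isClosed hKΩ hf.c2 h2).continuousOn⟩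
    by_cases hx : x ∈ Ω
    · exact hf.der x hx
    · have hx' : x ∉ K := fun h => hx (hKΩ h)
      rw [h1 x hx', h2 x hx']
      have e : lf 0 0 = 0 := by simp [lf]
      rw [e]
      refine (hasFDerivAt_const (0 : ℝ) x).congr_of_eventuallyEq ?_
      filter_upwards [hK.isClosed.isOpen_compl.mem_nhds hx'] with y hy using h0 y hy
  k := HasCompactSupport.intro hK h0
  s := (closure_minimal (fun x hx => by by_contra h; exact hx (h0 x h)) hK.isClosed).trans hKΩ

lemma mul (hΩ : IsOpen Ω) (h : Tst Ω ψ ψ1 ψ2) (hf : C1 Ω f f1 f2) :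
    Tst Ω (fun x => f x * ψ x) (fun x => f1 x * ψ x + f x * ψ1 x)
      (fun x => f2 x * ψ x + f x * ψ2 x) :=
  of_C1 hΩ h.k h.s (hf.mul (h.c.mono (subset_univ _)))
    (fun x hx => by simp [h.zero0 hx]) (fun x hx => by simp [h.zero0 hx, h.zero1 hx])
    (fun x hx => by simp [h.zero0 hx, h.zero2 hx])

lemma integral_d0 (h : Tst Ω ψ ψ1 ψ2) : ∫ x, ψ1 x = 0 := by
  have hi1 : Integrable ψ1 := h.cψ1.integrable_of_hasCompactSupport
    (HasCompactSupport.intro h.k fun x hx => h.zero1 hx)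
  have := integral_mul_fderiv_eq_neg_fderiv_mul_of_integrable (μ := (volume : Measure Pl))
    (f := fun _ => (1:ℝ)) (g := ψ) (v := e0) (by simp)
    (by simpa [h.c.fderiv_e0 (mem_univ _)] using hi1)
    (by simpa using h.cψ.integrable_of_hasCompactSupport h.k)
    (fun x _ => differentiableAt_const _) (fun x _ => (h.c.der x (mem_univ x)).differentiableAt)
  simpa [h.c.fderiv_e0 (mem_univ _)] using this

lemma integral_d1 (h : Tst Ω ψ ψ1 ψ2) : ∫ x, ψ2 x = 0 := by
  have hi1 : Integrable ψ2 := h.cψ2.integrable_of_hasCompactSupport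
    (HasCompactSupport.intro h.k fun x hx => h.zero2 hx)
  have := integral_mul_fderiv_eq_neg_fderiv_mul_of_integrable (μ := (volume : Measure Pl))
    (f := fun _ => (1:ℝ)) (g := ψ) (v := e1) (by simp)
    (by simpa [h.c.fderiv_e1 (mem_univ _)] using hi1)
    (by simpa using h.cψ.integrable_of_hasCompactSupport h.k)
    (fun x _ => differentiableAt_const _) (fun x _ => (h.c.der x (mem_univ x)).differentiableAt)
  simpa [h.c.fderiv_e1 (mem_univ _)] using this

end Tst

/-- `div (Y1, Y2) = f` weakly in `Ω`. -/
structure WD (Ω : Set Pl) (Y1 Y2 f : Pl → ℝ) : Prop where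
  c1 : ContinuousOn Y1 Ω
  c2 : ContinuousOn Y2 Ω
  cf : ContinuousOn f Ω
  eq : ∀ ψ ψ1 ψ2, Tst Ω ψ ψ1 ψ2 → ∫ x, (Y1 x * ψ1 x + Y2 x * ψ2 x + f x * ψ x) = 0

namespace WD
variable {Ω : Set Pl} {Y1 Y2 f Z1 Z2 g h h1 h2 : Pl → ℝ}

lemma congr (hY : WD Ω Y1 Y2 f) (H1 : ∀ x ∈ Ω, Y1 x = Z1 x) (H2 : ∀ x ∈ Ω, Y2 x = Z2 x)
    (Hf : ∀ x ∈ Ω, f x = g x) : WD Ω Z1 Z2 g where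
  c1 := hY.c1.congr fun x hx => (H1 x hx).symm
  c2 := hY.c2.congr fun x hx => (H2 x hx).symm
  cf := hY.cf.congr fun x hx => (Hf x hx).symm
  eq ψ ψ1 ψ2 hψ := by
    rw [← hY.eq ψ ψ1 ψ2 hψ]
    congr 1; funext x
    by_cases hx : x ∈ Ω
    · rw [H1 x hx, H2 x hx, Hf x hx]
    · have : x ∉ tsupport ψ := fun h => hx (hψ.s h)
      simp [hψ.zero0 this, hψ.zero1 this, hψ.zero2 this]

lemma integrable (hΩ : IsOpen Ω) (hY : WD Ω Y1 Y2 f) {ψ ψ1 ψ2 : Pl → ℝ} (hψ : Tst Ω ψ ψ1 ψ2) :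
    Integrable (fun x => Y1 x * ψ1 x + Y2 x * ψ2 x + f x * ψ x) := by
  refine Tst.integrable_of hΩ hψ.k hψ.s ?_ ?_
  · exact ((hY.c1.mul hψ.cψ1.continuousOn).add (hY.c2.mul hψ.cψ2.continuousOn)).add
      (hY.cf.mul hψ.cψ.continuousOn)
  · intro x hx; simp [hψ.zero0 hx, hψ.zero1 hx, hψ.zero2 hx]

lemma add (hΩ : IsOpen Ω) (hY : WD Ω Y1 Y2 f) (hZ : WD Ω Z1 Z2 g) :
    WD Ω (fun x => Y1 x + Z1 x) (fun x => Y2 x + Z2 x) (fun x => f x + g x) where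
  c1 := hY.c1.add hZ.c1
  c2 := hY.c2.add hZ.c2
  cf := hY.cf.add hZ.cf
  eq ψ ψ1 ψ2 hψ := by
    have := integral_add (hY.integrable hΩ hψ) (hZ.integrable hΩ hψ)
    rw [hY.eq _ _ _ hψ, hZ.eq _ _ _ hψ, add_zero] at this
    rw [← this]; congr 1; funext x; ring

lemma smul (hΩ : IsOpen Ω) (hY : WD Ω Y1 Y2 f) (hh : C1 Ω h h1 h2) :
    WD Ω (fun x => h x * Y1 x) (fun x => h x * Y2 x)
      (fun x => h x * f x + (Y1 x * h1 x + Y2 x * h2 x)) where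
  c1 := hh.cont.mul hY.c1
  c2 := hh.cont.mul hY.c2
  cf := (hh.cont.mul hY.cf).add ((hY.c1.mul hh.c1).add (hY.c2.mul hh.c2))
  eq ψ ψ1 ψ2 hψ := by
    have := hY.eq _ _ _ (hψ.mul hΩ hh)
    rw [← this]; congr 1; funext x; ring

lemma of_C1 (hΩ : IsOpen Ω) {Y11 Y12 Y21 Y22 : Pl → ℝ} (h1 : C1 Ω Y1 Y11 Y12)
    (h2 : C1 Ω Y2 Y21 Y22) : WD Ω Y1 Y2 (fun x => Y11 x + Y22 x) where
  c1 := h1.cont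
  c2 := h2.cont
  cf := h1.c1.add h2.c2
  eq ψ ψ1 ψ2 hψ := by
    have t1 := hψ.mul hΩ h1
    have t2 := hψ.mul hΩ h2
    have i1 := t1.cψ1.integrable_of_hasCompactSupport (μ := volume)
      (HasCompactSupport.intro t1.k fun x hx => t1.zero1 hx)
    have i2 := t2.cψ2.integrable_of_hasCompactSupport (μ := volume)
      (HasCompactSupport.intro t2.k fun x hx => t2.zero2 hx)
    have := integral_add i1 i2
    rw [t1.integral_d0, t2.integral_d1, add_zero] at this
    rw [← this]; congr 1; funext x; ring

end WD


/-! ### Cutoffs and difference quotients -/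

lemma C1.translate {f f1 f2 : Pl → ℝ} (hf : C1 univ f f1 f2) (a : Pl) :
    C1 univ (fun x => f (x - a)) (fun x => f1 (x - a)) (fun x => f2 (x - a)) where
  der x _ := by
    refine HasFDerivAt.congr_fderiv ((hf.der (x - a) (mem_univ _)).comp x
      ((hasFDerivAt_id x).sub_const a)) (ContinuousLinearMap.ext fun y => ?_)
    simp
  c1 := (hf.c1.comp (continuous_id.sub continuous_const).continuousOn (fun _ _ => mem_univ _))
  c2 := (hf.c2.comp (continuous_id.sub continuous_const).continuousOn (fun _ _ => mem_univ _))

/-- Cutoff function equal to one near a compact set. -/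
lemma exists_cutoff {Ω K : Set Pl} (hΩ : IsOpen Ω) (hK : IsCompact K) (hKΩ : K ⊆ Ω) :
    ∃ κ κ1 κ2 : Pl → ℝ, Tst Ω κ κ1 κ2 ∧ (∀ x, 0 ≤ κ x) ∧ (∀ x, κ x ≤ 1) ∧
      ∃ U, IsOpen U ∧ K ⊆ U ∧ ∀ x ∈ U, κ x = 1 ∧ κ1 x = 0 ∧ κ2 x = 0 := by
  obtain ⟨K', hK', hKK', hK'Ω⟩ := exists_compact_between hK hΩ hKΩ
  obtain ⟨f, hf1, hf0, hf01⟩ := exists_contMDiffMap_one_nhds_of_subset_interior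
    (n := (⊤ : ℕ∞)) (modelWithCornersSelf ℝ Pl) hK.isClosed hKK'
  have hfd : ContDiff ℝ 1 f := (f.contMDiff.contDiff).of_le (by exact_mod_cast le_top)
  have hc := C1.of_contDiffOn isOpen_univ hfd.contDiffOn
  have hz : ∀ x, x ∉ K' → f x = 0 := hf0
  have hts : tsupport f ⊆ K' :=
    closure_minimal (fun x hx => by by_contra h; exact hx (hz x h)) hK'.isClosed
  have hT : Tst Ω f (fun x => fderiv ℝ f x e0) (fun x => fderiv ℝ f x e1) :=
    ⟨hc, HasCompactSupport.intro hK' hz, hts.trans hK'Ω⟩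
  refine ⟨f, _, _, hT, fun x => (hf01 x).1, fun x => (hf01 x).2, ?_⟩
  rw [eventually_nhdsSet_iff_exists] at hf1
  obtain ⟨U, hU, hKU, hU1⟩ := hf1
  refine ⟨U, hU, hKU, fun x hx => ⟨hU1 x hx, ?_⟩⟩
  have : fderiv ℝ f x = 0 := by
    have h1 : (f : Pl → ℝ) =ᶠ[𝓝 x] fun _ => 1 := by
      filter_upwards [hU.mem_nhds hx] with y hy using hU1 y hy
    rw [h1.fderiv_eq]; simp
  simp [this]

lemma hasDerivAt_shift {F F1 F2 ψ : Pl → ℝ} {Ω : Set Pl} (hF : Tst Ω F F1 F2) (hψ : Continuous ψ)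
    (hψk : HasCompactSupport ψ) (d : Pl) :
    HasDerivAt (fun h : ℝ => ∫ x, F (x + h • d) * ψ x)
      (∫ x, (F1 x * d 0 + F2 x * d 1) * ψ x) 0 := by
  have hk1 : HasCompactSupport F1 := HasCompactSupport.intro hF.k fun x hx => hF.zero1 hx
  have hk2 : HasCompactSupport F2 := HasCompactSupport.intro hF.k fun x hx => hF.zero2 hx
  obtain ⟨C1', hC1⟩ := hk1.exists_bound_of_continuous hF.cψ1
  obtain ⟨C2', hC2⟩ := hk2.exists_bound_of_continuous hF.cψ2
  have cF := hF.cψ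
  have cF1 := hF.cψ1
  have cF2 := hF.cψ2
  have hi : ∀ h : ℝ, Continuous fun x => F (x + h • d) * ψ x := fun h => by fun_prop
  have key := hasDerivAt_integral_of_dominated_loc_of_deriv_le (μ := (volume : Measure Pl))
    (F := fun (h : ℝ) x => F (x + h • d) * ψ x)
    (F' := fun (h : ℝ) x => (F1 (x + h • d) * d 0 + F2 (x + h • d) * d 1) * ψ x)
    (x₀ := 0) (s := univ) (bound := fun x => (C1' * |d 0| + C2' * |d 1|) * |ψ x|)
    univ_mem (Eventually.of_forall fun h => (hi h).aestronglyMeasurable)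
    ((hi 0).integrable_of_hasCompactSupport hψk.mul_left)
    (by
      have : Continuous fun x => (F1 (x + (0:ℝ) • d) * d 0 + F2 (x + (0:ℝ) • d) * d 1) * ψ x := by
        fun_prop
      exact this.aestronglyMeasurable)
    (by
      refine Eventually.of_forall fun x h _ => ?_
      rw [norm_mul, Real.norm_eq_abs, Real.norm_eq_abs]
      gcongr
      refine (abs_add_le _ _).trans ?_
      rw [abs_mul, abs_mul]
      have := hC1 (x + h • d)
      have := hC2 (x + h • d)
      simp only [Real.norm_eq_abs] at *
      gcongr)
    (by
      refine (hψ.abs.integrable_of_hasCompactSupport ?_).const_mul _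
      exact hψk.comp_left (g := fun t : ℝ => |t|) abs_zero)
    (by
      refine Eventually.of_forall fun x h _ => ?_
      have h1 : HasDerivAt (fun h : ℝ => x + h • d) d h := by
        simpa using ((hasDerivAt_id h).smul_const d).const_add x
      have h2 := (hF.c.der (x + h • d) (mem_univ _)).comp_hasDerivAt h h1
      rw [lf_apply] at h2
      exact h2.mul_const _)
  simpa using key.2

/-- Derivatives of a field with constant divergence are weakly divergence free. -/
lemma WD.deriv_field {Ω : Set Pl} (hΩ : IsOpen Ω) {V1 V2 V11 V12 V21 V22 : Pl → ℝ}
    (h1 : C1 Ω V1 V11 V12) (h2 : C1 Ω V2 V21 V22) (c : ℝ)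
    (hc : ∀ x ∈ Ω, V11 x + V22 x = c) (d : Pl) :
    WD Ω (fun x => V11 x * d 0 + V12 x * d 1) (fun x => V21 x * d 0 + V22 x * d 1)
      (fun _ => 0) where
  c1 := (h1.c1.mul continuousOn_const).add (h1.c2.mul continuousOn_const)
  c2 := (h2.c1.mul continuousOn_const).add (h2.c2.mul continuousOn_const)
  cf := continuousOn_const
  eq ψ ψ1 ψ2 hψ := by
    obtain ⟨δ, hδ, hsub⟩ := IsCompact.exists_cthickening_subset_open hψ.k hΩ hψ.s
    set K := cthickening δ (tsupport ψ) with hKdef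
    have hψk : IsCompact (tsupport ψ) := hψ.k
    have hK : IsCompact K := hψk.cthickening
    obtain ⟨κ, κ1, κ2, hκ, -, -, U, -, hKU, hU⟩ := exists_cutoff hΩ hK hsub
    have T1 := hκ.mul hΩ h1
    have T2 := hκ.mul hΩ h2
    have hk1 : HasCompactSupport ψ1 := HasCompactSupport.intro hψ.k fun x hx => hψ.zero1 hx
    have hk2 : HasCompactSupport ψ2 := HasCompactSupport.intro hψ.k fun x hx => hψ.zero2 hx
    have D1 := hasDerivAt_shift T1 hψ.cψ1 hk1 d
    have D2 := hasDerivAt_shift T2 hψ.cψ2 hk2 d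
    have D := D1.add D2
    have W := WD.of_C1 hΩ h1 h2
    have hconst : (fun h : ℝ => (∫ x, V1 (x + h • d) * κ (x + h • d) * ψ1 x) +
        ∫ x, V2 (x + h • d) * κ (x + h • d) * ψ2 x) =ᶠ[𝓝 0] fun _ => - (c * ∫ x, ψ x) := by
      have hsm : ∀ᶠ h : ℝ in 𝓝 0, ‖h • d‖ < δ := by
        have : Continuous fun h : ℝ => ‖h • d‖ := by fun_prop
        refine this.continuousAt.eventually_lt continuousAt_const ?_
        simpa using hδ
      filter_upwards [hsm] with h hh
      have hnot : ∀ x, x ∉ K → x - h • d ∉ tsupport ψ := fun x hx hm => hx <|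
        mem_cthickening_of_dist_le x _ δ _ hm (by simpa [dist_eq_norm] using hh.le)
      have Tψ : Tst Ω (fun x => ψ (x - h • d)) (fun x => ψ1 (x - h • d)) (fun x => ψ2 (x - h • d)) :=
        Tst.of_C1 hΩ hK hsub ((hψ.c.translate (h • d)).mono (subset_univ _))
          (fun x hx => hψ.zero0 (hnot x hx)) (fun x hx => hψ.zero1 (hnot x hx))
          (fun x hx => hψ.zero2 (hnot x hx))
      have e1 : ∫ x, V1 (x + h • d) * κ (x + h • d) * ψ1 x
          = ∫ x, V1 x * ψ1 (x - h • d) := by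
        rw [← integral_sub_right_eq_self (fun x => V1 (x + h • d) * κ (x + h • d) * ψ1 x) (h • d)]
        congr 1; funext x
        simp only [sub_add_cancel]
        by_cases hx : x ∈ K
        · rw [(hU x (hKU hx)).1, mul_one]
        · rw [hψ.zero1 (hnot x hx)]; simp
      have e2 : ∫ x, V2 (x + h • d) * κ (x + h • d) * ψ2 x
          = ∫ x, V2 x * ψ2 (x - h • d) := by
        rw [← integral_sub_right_eq_self (fun x => V2 (x + h • d) * κ (x + h • d) * ψ2 x) (h • d)]
        congr 1; funext x
        simp only [sub_add_cancel]
        by_cases hx : x ∈ K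
        · rw [(hU x (hKU hx)).1, mul_one]
        · rw [hψ.zero2 (hnot x hx)]; simp
      have i1 : Integrable fun x => V1 x * ψ1 (x - h • d) :=
        Tst.integrable_of hΩ hK hsub (h1.cont.mul Tψ.cψ1.continuousOn)
          (fun x hx => by simp [hψ.zero1 (hnot x hx)])
      have i2 : Integrable fun x => V2 x * ψ2 (x - h • d) :=
        Tst.integrable_of hΩ hK hsub (h2.cont.mul Tψ.cψ2.continuousOn)
          (fun x hx => by simp [hψ.zero2 (hnot x hx)])
      have i3 : Integrable fun x => c * ψ (x - h • d) :=
        Tst.integrable_of hΩ hK hsub (continuousOn_const.mul Tψ.cψ.continuousOn)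
          (fun x hx => by simp [hψ.zero0 (hnot x hx)])
      have e3 := (W.congr (fun _ _ => rfl) (fun _ _ => rfl) hc).eq _ _ _ Tψ
      have e4 : ∫ x, c * ψ (x - h • d) = c * ∫ x, ψ x := by
        rw [integral_const_mul, integral_sub_right_eq_self ψ]
      have i12 : Integrable fun x => V1 x * ψ1 (x - h • d) + V2 x * ψ2 (x - h • d) := i1.add i2
      rw [integral_add i12 i3, integral_add i1 i2, e4] at e3
      rw [e1, e2]; linarith
    have D0 := (hasDerivAt_const (0:ℝ) (- (c * ∫ x, ψ x))).congr_of_eventuallyEq hconst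
    refine Eq.trans ?_ (D.unique D0)
    have j1 : Integrable fun x => ((V11 x * κ x + V1 x * κ1 x) * d 0
        + (V12 x * κ x + V1 x * κ2 x) * d 1) * ψ1 x :=
      (((T1.cψ1.mul continuous_const).add (T1.cψ2.mul continuous_const)).mul
        hψ.cψ1).integrable_of_hasCompactSupport hk1.mul_left
    have j2 : Integrable fun x => ((V21 x * κ x + V2 x * κ1 x) * d 0
        + (V22 x * κ x + V2 x * κ2 x) * d 1) * ψ2 x :=
      (((T2.cψ1.mul continuous_const).add (T2.cψ2.mul continuous_const)).mul
        hψ.cψ2).integrable_of_hasCompactSupport hk2.mul_left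
    rw [← integral_add j1 j2]
    congr 1; funext x
    by_cases hx : x ∈ tsupport ψ
    · have hxK : x ∈ K := self_subset_cthickening _ hx
      obtain ⟨a, b, c'⟩ := hU x (hKU hxK)
      rw [a, b, c']; ring
    · simp [hψ.zero1 hx, hψ.zero2 hx]


/-! ### Gauss-Green with vanishing normal flux -/

lemma Tst.mono {Ω Ω' : Set Pl} {ψ ψ1 ψ2 : Pl → ℝ} (h : Tst Ω ψ ψ1 ψ2) (hs : Ω ⊆ Ω') :
    Tst Ω' ψ ψ1 ψ2 := ⟨h.c, h.k, h.s.trans hs⟩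

/-- The smooth step: zero on `(-∞,1]`, one on `[2,∞)`. -/
def stp (t : ℝ) : ℝ := Real.smoothTransition (t - 1)

lemma stp_contDiff : ContDiff ℝ 2 stp :=
  Real.smoothTransition.contDiff.comp (contDiff_id.sub contDiff_const)
lemma stp_zero {t : ℝ} (h : t ≤ 1) : stp t = 0 :=
  Real.smoothTransition.zero_of_nonpos (by linarith)
lemma stp_one {t : ℝ} (h : 2 ≤ t) : stp t = 1 :=
  Real.smoothTransition.one_of_one_le (by linarith)
lemma stp_nonneg (t : ℝ) : 0 ≤ stp t := Real.smoothTransition.nonneg _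
lemma stp_le_one (t : ℝ) : stp t ≤ 1 := Real.smoothTransition.le_one _
lemma stp_mono : Monotone stp := fun a b h => Real.smoothTransition.monotone (by linarith)
lemma stp_deriv (t : ℝ) : HasDerivAt stp (deriv stp t) t :=
  (stp_contDiff.differentiable two_ne_zero t).hasDerivAt
lemma stp_deriv_cont : Continuous (deriv stp) := stp_contDiff.continuous_deriv (by norm_num)
lemma stp_deriv_nonneg (t : ℝ) : 0 ≤ deriv stp t := stp_mono.deriv_nonneg
lemma stp_deriv_zero {t : ℝ} (h : t ≤ 1) : deriv stp t = 0 := by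
  have : IsLocalMin stp t := Eventually.of_forall fun s => by rw [stp_zero h]; exact stp_nonneg s
  exact this.deriv_eq_zero
lemma stp_deriv_zero' {t : ℝ} (h : 2 ≤ t) : deriv stp t = 0 := by
  have : IsLocalMax stp t := Eventually.of_forall fun s => by rw [stp_one h]; exact stp_le_one s
  exact this.deriv_eq_zero

/-- Data for the Gauss-Green inequality. -/
structure GGd (Ω : Set Pl) (η : Pl → Pl) (K : Set Pl) (Y1 Y2 f q : Pl → ℝ) : Prop where
  wd : WD Ω Y1 Y2 f
  y1 : ContinuousOn Y1 (closure Ω)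
  y2 : ContinuousOn Y2 (closure Ω)
  z1 : ∀ x ∈ closure Ω, x ∉ K → Y1 x = 0
  z2 : ∀ x ∈ closure Ω, x ∉ K → Y2 x = 0
  yn : ∀ x ∈ frontier Ω, Y1 x * η x 0 + Y2 x * η x 1 = 0
  qc : ContinuousOn q Ω
  qb : ∃ M, ∀ x ∈ Ω, |q x| ≤ M
  qz : ∀ x ∈ Ω, x ∉ K → q x = 0
  qf : ∀ x ∈ Ω, q x ≤ f x

lemma integrableOn_of_bdd {Ω K : Set Pl} (hΩ : IsOpen Ω) (hK : IsCompact K) {q : Pl → ℝ}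
    (qc : ContinuousOn q Ω) (qb : ∃ M, ∀ x ∈ Ω, |q x| ≤ M) (qz : ∀ x ∈ Ω, x ∉ K → q x = 0) :
    IntegrableOn q Ω := by
  obtain ⟨M, hM⟩ := qb
  have h1 : IntegrableOn q (Ω ∩ K) := by
    have hfin : volume (Ω ∩ K) < ⊤ := (measure_mono inter_subset_right).trans_lt hK.measure_lt_top
    refine IntegrableOn.of_bound hfin
      ((qc.mono inter_subset_left).aestronglyMeasurable (hΩ.measurableSet.inter hK.measurableSet)) M ?_
    filter_upwards [ae_restrict_mem (hΩ.measurableSet.inter hK.measurableSet)] with x hx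
      using hM x hx.1
  have h2 : IntegrableOn q (Ω \ K) := by
    refine (integrableOn_zero).congr_fun (fun x hx => (qz x hx.1 hx.2).symm)
      (hΩ.measurableSet.diff hK.measurableSet)
  have := h1.union h2
  rwa [inter_union_sdiff] at this

/-- An open set over which the Gauss-Green inequality holds. -/
def Good (Ω : Set Pl) (η : Pl → Pl) (U : Set Pl) : Prop :=
  IsOpen U ∧ ∀ K, IsCompact K → K ⊆ U → ∀ Y1 Y2 f q, GGd Ω η K Y1 Y2 f q → ∫ x in Ω, q x ≤ 0

lemma Good.union {Ω : Set Pl} {η : Pl → Pl} (hΩ : IsOpen Ω) {U1 U2 : Set Pl}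
    (h1 : Good Ω η U1) (h2 : Good Ω η U2) : Good Ω η (U1 ∪ U2) := by
  refine ⟨h1.1.union h2.1, fun K hK hKU Y1 Y2 f q h => ?_⟩
  obtain ⟨K1, K2, hK1, hK2, hK1U, hK2U, hKK⟩ := hK.binary_compact_cover h1.1 h2.1 hKU
  obtain ⟨ζ, ζ1, ζ2, hζ, hζ0, hζ1, U, hU, hK1U', hU1⟩ := exists_cutoff h1.1 hK1 hK1U
  obtain ⟨M, hM⟩ := h.qb
  have hKc : IsCompact (K ∩ closure Ω) := hK.inter_right isClosed_closure
  have bd : ∀ Y : Pl → ℝ, ContinuousOn Y (closure Ω) → (∀ x ∈ closure Ω, x ∉ K → Y x = 0) →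
      ∃ C, 0 ≤ C ∧ ∀ x ∈ closure Ω, |Y x| ≤ C := by
    intro Y hY hz
    obtain ⟨C, hC⟩ := hKc.exists_bound_of_continuousOn (hY.mono inter_subset_right)
    refine ⟨max C 0, le_max_right _ _, fun x hx => ?_⟩
    by_cases hxK : x ∈ K
    · exact (hC x ⟨hxK, hx⟩).trans (le_max_left _ _)
    · rw [hz x hx hxK]; simp
  obtain ⟨B1, hB10, hB1⟩ := bd Y1 h.y1 h.z1
  obtain ⟨B2, hB20, hB2⟩ := bd Y2 h.y2 h.z2
  obtain ⟨D1, hD1⟩ := (HasCompactSupport.intro hζ.k fun x hx => hζ.zero1 hx :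
    HasCompactSupport ζ1).exists_bound_of_continuous hζ.cψ1
  obtain ⟨D2, hD2⟩ := (HasCompactSupport.intro hζ.k fun x hx => hζ.zero2 hx :
    HasCompactSupport ζ2).exists_bound_of_continuous hζ.cψ2
  simp only [Real.norm_eq_abs] at hD1 hD2
  have hD10 : 0 ≤ D1 := (abs_nonneg _).trans (hD1 0)
  have hD20 : 0 ≤ D2 := (abs_nonneg _).trans (hD2 0)
  have bterm : ∀ x ∈ Ω, |Y1 x * ζ1 x + Y2 x * ζ2 x| ≤ B1 * D1 + B2 * D2 := fun x hx => by
    refine (abs_add_le _ _).trans ?_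
    rw [abs_mul, abs_mul]
    have := hB1 x (subset_closure hx)
    have := hB2 x (subset_closure hx)
    have := hD1 x
    have := hD2 x
    gcongr
  have hM0 : ∀ x ∈ Ω, 0 ≤ M := fun x hx => (abs_nonneg _).trans (hM x hx)
  have cζ := hζ.cψ.continuousOn (s := closure Ω)
  have cζΩ := hζ.cψ.continuousOn (s := Ω)
  have cterm : ContinuousOn (fun x => Y1 x * ζ1 x + Y2 x * ζ2 x) Ω :=
    (h.wd.c1.mul hζ.cψ1.continuousOn).add (h.wd.c2.mul hζ.cψ2.continuousOn)
  have g1 : GGd Ω η (K ∩ tsupport ζ) (fun x => ζ x * Y1 x) (fun x => ζ x * Y2 x)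
      (fun x => ζ x * f x + (Y1 x * ζ1 x + Y2 x * ζ2 x))
      (fun x => ζ x * q x + (Y1 x * ζ1 x + Y2 x * ζ2 x)) := by
    refine ⟨h.wd.smul hΩ (hζ.c.mono (subset_univ _)), cζ.mul h.y1, cζ.mul h.y2, ?_, ?_, ?_,
      (cζΩ.mul h.qc).add cterm, ⟨M + (B1 * D1 + B2 * D2), fun x hx => ?_⟩, ?_, ?_⟩
    · intro x hx hxK
      by_cases h' : x ∈ K
      · rw [hζ.zero0 fun h'' => hxK ⟨h', h''⟩, zero_mul]
      · rw [h.z1 x hx h', mul_zero]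
    · intro x hx hxK
      by_cases h' : x ∈ K
      · rw [hζ.zero0 fun h'' => hxK ⟨h', h''⟩, zero_mul]
      · rw [h.z2 x hx h', mul_zero]
    · intro x hx
      rw [mul_assoc, mul_assoc, ← mul_add, h.yn x hx, mul_zero]
    · refine (abs_add_le _ _).trans (add_le_add ?_ (bterm x hx))
      rw [abs_mul, abs_of_nonneg (hζ0 x)]
      exact (mul_le_mul (hζ1 x) (hM x hx) (abs_nonneg _) zero_le_one).trans (by rw [one_mul])
    · intro x hx hxK
      by_cases h' : x ∈ K
      · have h'' : x ∉ tsupport ζ := fun h'' => hxK ⟨h', h''⟩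
        simp [hζ.zero0 h'', hζ.zero1 h'', hζ.zero2 h'']
      · simp [h.z1 x (subset_closure hx) h', h.z2 x (subset_closure hx) h', h.qz x hx h']
    · intro x hx
      have := mul_le_mul_of_nonneg_left (h.qf x hx) (hζ0 x)
      simpa using this
  have hc : C1 Ω (fun x => 1 - ζ x) (fun x => 0 - ζ1 x) (fun x => 0 - ζ2 x) :=
    (C1.const 1).sub (hζ.c.mono (subset_univ _))
  have g2 : GGd Ω η (K \ U) (fun x => (1 - ζ x) * Y1 x) (fun x => (1 - ζ x) * Y2 x)
      (fun x => (1 - ζ x) * f x + (Y1 x * (0 - ζ1 x) + Y2 x * (0 - ζ2 x)))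
      (fun x => (1 - ζ x) * q x - (Y1 x * ζ1 x + Y2 x * ζ2 x)) := by
    refine ⟨h.wd.smul hΩ hc, (continuousOn_const.sub cζ).mul h.y1,
      (continuousOn_const.sub cζ).mul h.y2, ?_, ?_, ?_,
      ((continuousOn_const.sub cζΩ).mul h.qc).sub cterm,
      ⟨M + (B1 * D1 + B2 * D2), fun x hx => ?_⟩, ?_, ?_⟩
    · intro x hx hxK
      by_cases h' : x ∈ K
      · have : x ∈ U := by by_contra h''; exact hxK ⟨h', h''⟩
        simp [(hU1 x this).1]
      · rw [h.z1 x hx h', mul_zero]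
    · intro x hx hxK
      by_cases h' : x ∈ K
      · have : x ∈ U := by by_contra h''; exact hxK ⟨h', h''⟩
        simp [(hU1 x this).1]
      · rw [h.z2 x hx h', mul_zero]
    · intro x hx
      rw [mul_assoc, mul_assoc, ← mul_add, h.yn x hx, mul_zero]
    · refine (abs_sub _ _).trans (add_le_add ?_ (bterm x hx))
      rw [abs_mul, abs_of_nonneg (by linarith [hζ1 x])]
      exact (mul_le_mul (by linarith [hζ0 x]) (hM x hx) (abs_nonneg _) zero_le_one).trans
        (by rw [one_mul])
    · intro x hx hxK
      by_cases h' : x ∈ K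
      · have : x ∈ U := by by_contra h''; exact hxK ⟨h', h''⟩
        obtain ⟨a, b, c⟩ := hU1 x this
        simp [a, b, c]
      · simp [h.z1 x (subset_closure hx) h', h.z2 x (subset_closure hx) h', h.qz x hx h']
    · intro x hx
      have := mul_le_mul_of_nonneg_left (h.qf x hx) (by linarith [hζ1 x] : 0 ≤ 1 - ζ x)
      linarith
  have k1 : IsCompact (K ∩ tsupport ζ) := hK.inter_right (isClosed_tsupport ζ)
  have k2 : IsCompact (K \ U) := hK.diff hU
  have r1 := h1.2 _ k1 (inter_subset_right.trans hζ.s) _ _ _ _ g1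
  have r2 := h2.2 _ k2 (by
    intro x hx
    have : x ∈ K1 ∪ K2 := hKK ▸ hx.1
    rcases this with h' | h'
    · exact absurd (hK1U' h') hx.2
    · exact hK2U h') _ _ _ _ g2
  have i1 := integrableOn_of_bdd hΩ k1 g1.qc g1.qb g1.qz
  have i2 := integrableOn_of_bdd hΩ k2 g2.qc g2.qb g2.qz
  have : ∫ x in Ω, q x = (∫ x in Ω, (ζ x * q x + (Y1 x * ζ1 x + Y2 x * ζ2 x))) +
      ∫ x in Ω, ((1 - ζ x) * q x - (Y1 x * ζ1 x + Y2 x * ζ2 x)) := by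
    rw [← integral_add i1 i2]; congr 1; funext x; ring
  linarith

lemma Good.compl {Ω : Set Pl} {η : Pl → Pl} (hΩ : IsOpen Ω) : Good Ω η (closure Ω)ᶜ := by
  refine ⟨isClosed_closure.isOpen_compl, fun K hK hKU Y1 Y2 f q h => ?_⟩
  rw [setIntegral_congr_fun hΩ.measurableSet (g := fun _ => (0:ℝ))]
  · simp
  · intro x hx
    exact h.qz x hx fun h' => hKU h' (subset_closure hx)

lemma Good.inside {Ω : Set Pl} {η : Pl → Pl} (hΩ : IsOpen Ω) : Good Ω η Ω := by
  refine ⟨hΩ, fun K hK hKU Y1 Y2 f q h => ?_⟩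
  obtain ⟨κ, κ1, κ2, hκ, hκ0, hκ1, U, hU, hKU', hU1⟩ := exists_cutoff hΩ hK hKU
  have e := h.wd.eq _ _ _ hκ
  have hfκ : Integrable fun x => f x * κ x := Tst.integrable_of hΩ hκ.k hκ.s
    (h.wd.cf.mul hκ.cψ.continuousOn) (fun x hx => by simp [hκ.zero0 hx])
  have hqκ : Integrable fun x => q x * κ x := Tst.integrable_of hΩ hκ.k hκ.s
    (h.qc.mul hκ.cψ.continuousOn) (fun x hx => by simp [hκ.zero0 hx])
  have e2 : ∫ x, f x * κ x = 0 := by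
    rw [← e]; congr 1; funext x
    by_cases hx : x ∈ K
    · obtain ⟨a, b, c⟩ := hU1 x (hKU' hx)
      simp [b, c]
    · by_cases hxΩ : x ∈ Ω
      · simp [h.z1 x (subset_closure hxΩ) hx, h.z2 x (subset_closure hxΩ) hx]
      · have : x ∉ tsupport κ := fun h' => hxΩ (hκ.s h')
        simp [hκ.zero0 this, hκ.zero1 this, hκ.zero2 this]
  have e3 : ∫ x in Ω, q x = ∫ x, q x * κ x := by
    rw [← integral_indicator hΩ.measurableSet]
    congr 1; funext x
    by_cases hxΩ : x ∈ Ω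
    · rw [indicator_of_mem hxΩ]
      by_cases hx : x ∈ K
      · rw [(hU1 x (hKU' hx)).1, mul_one]
      · simp [h.qz x hxΩ hx]
    · rw [indicator_of_notMem hxΩ, hκ.zero0 fun h' => hxΩ (hκ.s h'), mul_zero]
  rw [e3, ← e2]
  refine integral_mono hqκ hfκ fun x => ?_
  by_cases hxΩ : x ∈ Ω
  · exact mul_le_mul_of_nonneg_right (h.qf x hxΩ) (hκ0 x)
  · simp [hκ.zero0 fun h' => hxΩ (hκ.s h')]


/-! ### Boundary charts -/

lemma grad0 (g : Pl → ℝ) (x : Pl) : (gradient g x) 0 = fderiv ℝ g x e0 := by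
  have : ⟪gradient g x, e0⟫ = fderiv ℝ g x e0 := by
    unfold gradient; exact InnerProductSpace.toDual_symm_apply
  rw [← this, inner_eq]; simp

lemma grad1 (g : Pl → ℝ) (x : Pl) : (gradient g x) 1 = fderiv ℝ g x e1 := by
  have : ⟪gradient g x, e1⟫ = fderiv ℝ g x e1 := by
    unfold gradient; exact InnerProductSpace.toDual_symm_apply
  rw [← this, inner_eq]; simp

/-- A local defining function in coordinates. -/
structure Chart (Ω V : Set Pl) (g g1 g2 g11 g12 g21 g22 : Pl → ℝ) : Prop where
  oV : IsOpen V
  cg : C1 V g g1 g2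
  cg1 : C1 V g1 g11 g12
  cg2 : C1 V g2 g21 g22
  nz : ∀ x ∈ V, 0 < g1 x ^ 2 + g2 x ^ 2
  eq : Ω ∩ V = {x ∈ V | g x < 0}

lemma exists_chart {Ω : Set Pl} {η : Pl → Pl} (h : IsCkDomainWithNormal 2 Ω η) {p : Pl}
    (hp : p ∈ frontier Ω) : ∃ V g g1 g2 g11 g12 g21 g22, p ∈ V ∧
      Chart Ω V g g1 g2 g11 g12 g21 g22 ∧ η p 0 = - (√(g1 p ^ 2 + g2 p ^ 2))⁻¹ * g1 p ∧
      η p 1 = - (√(g1 p ^ 2 + g2 p ^ 2))⁻¹ * g2 p := by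
  obtain ⟨-, -, -, h⟩ := h
  obtain ⟨V, g, hV, hpV, hg, hgn, heq, hη⟩ := h p hp
  have hg' : ContDiffOn ℝ 2 g V := hg
  have hn : ‖gradient g p‖ = √(fderiv ℝ g p e0 ^ 2 + fderiv ℝ g p e1 ^ 2) := by
    rw [← grad0, ← grad1, ← normsq_eq, Real.sqrt_sq (norm_nonneg _)]
  have hd : ContDiffOn ℝ 1 (fderiv ℝ g) V := hg'.fderiv_of_isOpen hV (by norm_num)
  have hd0 : ContDiffOn ℝ 1 (fun x => fderiv ℝ g x e0) V := hd.clm_apply contDiffOn_const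
  have hd1 : ContDiffOn ℝ 1 (fun x => fderiv ℝ g x e1) V := hd.clm_apply contDiffOn_const
  refine ⟨V, g, fun x => fderiv ℝ g x e0, fun x => fderiv ℝ g x e1, _, _, _, _, hpV,
    ⟨hV, C1.of_contDiffOn hV (hg'.of_le (by norm_num)), C1.of_contDiffOn hV hd0,
      C1.of_contDiffOn hV hd1, ?_, heq⟩, ?_, ?_⟩
  · intro x hx
    rw [← grad0, ← grad1, ← normsq_eq]
    exact pow_pos (norm_pos_iff.mpr (hgn x hx)) 2
  · rw [hη, ← hn]; simp [grad0]
  · rw [hη, ← hn]; simp [grad1]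

namespace Chart
variable {Ω V : Set Pl} {g g1 g2 g11 g12 g21 g22 : Pl → ℝ}

lemma lt (h : Chart Ω V g g1 g2 g11 g12 g21 g22) {x : Pl} (hx : x ∈ V) : x ∈ Ω ↔ g x < 0 := by
  have : x ∈ Ω ∩ V ↔ x ∈ {x ∈ V | g x < 0} := by rw [h.eq]
  simpa [hx] using this

lemma le (h : Chart Ω V g g1 g2 g11 g12 g21 g22) {x : Pl} (hx : x ∈ V) (hc : x ∈ closure Ω) :
    g x ≤ 0 := by
  by_contra hlt
  push Not at hlt
  have hgc : ContinuousAt g x := (h.cg.der x hx).continuousAt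
  have hev : ∀ᶠ y in 𝓝 x, 0 < g y ∧ y ∈ V :=
    (hgc.eventually_const_lt hlt).and (h.oV.mem_nhds hx)
  obtain ⟨y, hy, hyΩ⟩ := mem_closure_iff_nhds.mp hc _ hev
  have := (h.lt hy.2).mp hyΩ
  linarith [hy.1]

lemma zero (h : Chart Ω V g g1 g2 g11 g12 g21 g22) (hΩ : IsOpen Ω) {x : Pl} (hx : x ∈ V)
    (hf : x ∈ frontier Ω) : g x = 0 := by
  rw [hΩ.frontier_eq] at hf
  refine le_antisymm (h.le hx hf.1) ?_
  by_contra hlt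
  push Not at hlt
  exact hf.2 ((h.lt hx).mpr hlt)

lemma frontier_of_zero (h : Chart Ω V g g1 g2 g11 g12 g21 g22) (hΩ : IsOpen Ω) {x : Pl} (hx : x ∈ V)
    (hf : x ∈ closure Ω) (h0 : g x = 0) : x ∈ frontier Ω := by
  rw [hΩ.frontier_eq]
  refine ⟨hf, fun h' => ?_⟩
  have := (h.lt hx).mp h'
  linarith

lemma line_deriv (h : Chart Ω V g g1 g2 g11 g12 g21 g22) {x : Pl} (hx : x ∈ V) (d : Pl) :
    HasDerivAt (fun s : ℝ => g (x + s • d)) (g1 x * d 0 + g2 x * d 1) 0 := by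
  have h1 : HasDerivAt (fun s : ℝ => x + s • d) d 0 := by
    simpa using ((hasDerivAt_id (0:ℝ)).smul_const d).const_add x
  have h0 := h.cg.der x hx
  rw [show x = x + (0:ℝ) • d by simp] at h0
  have h2 := h0.comp_hasDerivAt (0:ℝ) h1
  rw [lf_apply] at h2
  simp only [zero_smul, add_zero] at h2
  exact h2

lemma mem_of_deriv (h : Chart Ω V g g1 g2 g11 g12 g21 g22) (hΩ : IsOpen Ω) {x : Pl} (hx : x ∈ V)
    (hf : x ∈ frontier Ω) (d : Pl) (hd : g1 x * d 0 + g2 x * d 1 < 0) :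
    ∀ᶠ s : ℝ in 𝓝[>] 0, x + s • d ∈ Ω := by
  have h1 := (h.line_deriv hx d).hasDerivWithinAt (s := Ioi 0)
  rw [hasDerivWithinAt_iff_tendsto_slope' (by simp)] at h1
  have hev := h1.eventually_lt_const hd
  have hc : Continuous fun s : ℝ => x + s • d := by fun_prop
  have hV : ∀ᶠ s : ℝ in 𝓝[>] 0, x + s • d ∈ V := by
    refine (hc.continuousAt.eventually_mem (h.oV.mem_nhds ?_)).filter_mono nhdsWithin_le_nhds
    simpa using hx
  filter_upwards [hev, hV, self_mem_nhdsWithin] with s hs hsV hs0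
  rw [h.lt hsV]
  simp only [slope_def_field, zero_smul, add_zero, h.zero hΩ hx hf, sub_zero] at hs
  have hs0' : (0:ℝ) < s := hs0
  by_contra hcon
  push Not at hcon
  linarith [div_nonneg hcon hs0'.le]

lemma not_mem_of_deriv (h : Chart Ω V g g1 g2 g11 g12 g21 g22) (hΩ : IsOpen Ω) {x : Pl} (hx : x ∈ V)
    (hf : x ∈ frontier Ω) (d : Pl) (hd : 0 < g1 x * d 0 + g2 x * d 1) :
    ∀ᶠ s : ℝ in 𝓝[>] 0, x + s • d ∉ Ω := by
  have h1 := (h.line_deriv hx d).hasDerivWithinAt (s := Ioi 0)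
  rw [hasDerivWithinAt_iff_tendsto_slope' (by simp)] at h1
  have hev := h1.eventually_const_lt hd
  have hc : Continuous fun s : ℝ => x + s • d := by fun_prop
  have hV : ∀ᶠ s : ℝ in 𝓝[>] 0, x + s • d ∈ V := by
    refine (hc.continuousAt.eventually_mem (h.oV.mem_nhds ?_)).filter_mono nhdsWithin_le_nhds
    simpa using hx
  filter_upwards [hev, hV, self_mem_nhdsWithin] with s hs hsV hs0
  rw [h.lt hsV]
  simp only [slope_def_field, zero_smul, add_zero, h.zero hΩ hx hf, sub_zero] at hs
  have hs0' : 0 < s := hs0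
  have := (div_pos_iff_of_pos_right hs0').mp hs
  linarith

/-- Two charts at the same boundary point have parallel gradients. -/
lemma perp (h : Chart Ω V g g1 g2 g11 g12 g21 g22) (hΩ : IsOpen Ω)
    {V' : Set Pl} {k k1 k2 k11 k12 k21 k22 : Pl → ℝ} (h' : Chart Ω V' k k1 k2 k11 k12 k21 k22)
    {x : Pl} (hx : x ∈ V) (hx' : x ∈ V') (hf : x ∈ frontier Ω) (a b : ℝ)
    (hab : a * k1 x + b * k2 x = 0) : a * g1 x + b * g2 x = 0 := by
  have key : ∀ d : Pl, k1 x * d 0 + k2 x * d 1 < 0 → g1 x * d 0 + g2 x * d 1 ≤ 0 := by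
    intro d hd
    by_contra hlt
    push Not at hlt
    obtain ⟨s, hs1, hs2⟩ := ((h'.mem_of_deriv hΩ hx' hf d hd).and
      (h.not_mem_of_deriv hΩ hx hf d hlt)).exists
    exact hs2 hs1
  have key2 : ∀ c e : ℝ, c * k1 x + e * k2 x = 0 → c * g1 x + e * g2 x ≤ 0 := by
    intro c e hce
    by_contra hlt
    push Not at hlt
    set m := g1 x * k1 x + g2 x * k2 x with hm
    obtain ⟨ε, hε, hε'⟩ : ∃ ε > 0, ε * |m| < c * g1 x + e * g2 x := by
      refine ⟨(c * g1 x + e * g2 x) / (|m| + 1) , by positivity, ?_⟩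
      have : 0 ≤ |m| := abs_nonneg m
      rw [div_mul_eq_mul_div, div_lt_iff₀ (by positivity)]
      nlinarith
    have := key ((c - ε * k1 x) • e0 + (e - ε * k2 x) • e1) (by
      have := h'.nz x hx'
      simp; nlinarith)
    simp at this
    have h3 : ε * m ≤ ε * |m| := mul_le_mul_of_nonneg_left (le_abs_self m) hε.le
    rw [hm] at h3
    nlinarith
  have h1 := key2 a b hab
  have h2 := key2 (-a) (-b) (by linarith)
  linarith

end Chart


lemma Chart.tst {Ω V : Set Pl} {g g1 g2 g11 g12 g21 g22 κ κ1 κ2 : Pl → ℝ}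
    (h : Chart Ω V g g1 g2 g11 g12 g21 g22) (hΩ : IsOpen Ω) (hκ : Tst V κ κ1 κ2) {ε : ℝ}
    (hε : 0 < ε) :
    Tst (Ω ∩ V) (fun x => stp (-ε⁻¹ * g x) * κ x)
      (fun x => deriv stp (-ε⁻¹ * g x) * (-ε⁻¹ * g1 x) * κ x + stp (-ε⁻¹ * g x) * κ1 x)
      (fun x => deriv stp (-ε⁻¹ * g x) * (-ε⁻¹ * g2 x) * κ x + stp (-ε⁻¹ * g x) * κ2 x) := by
  have hc := ((h.cg.const_mul (-ε⁻¹)).comp (s := univ) (fun y _ => stp_deriv y)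
    stp_deriv_cont.continuousOn (fun _ _ => mem_univ _)).mul (hκ.c.mono (subset_univ _))
  set K := {x ∈ tsupport κ | g x ≤ -ε} with hK
  have hKc : IsCompact K := by
    have : K = tsupport κ ∩ g ⁻¹' (Iic (-ε)) := rfl
    have hk : IsCompact (tsupport κ) := hκ.k
    rw [this]
    exact hk.of_isClosed_subset ((h.cg.cont.mono hκ.s).preimage_isClosed_of_isClosed
      (isClosed_tsupport κ) isClosed_Iic) inter_subset_left
  have hKs : K ⊆ Ω ∩ V := fun x hx => ⟨(h.lt (hκ.s hx.1)).mpr (by linarith [hx.2]), hκ.s hx.1⟩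
  have hout : ∀ x, x ∉ K → x ∈ tsupport κ → stp (-ε⁻¹ * g x) = 0 ∧ deriv stp (-ε⁻¹ * g x) = 0 := by
    intro x hx hxs
    have hg : -ε < g x := by
      by_contra hcon
      exact hx ⟨hxs, by linarith⟩
    have : -ε⁻¹ * g x ≤ 1 := by
      rw [neg_mul, neg_le, ← sub_nonneg]
      have : ε⁻¹ * g x - -1 = (g x + ε) * ε⁻¹ := by field_simp; ring
      rw [this]
      have : 0 < ε⁻¹ := inv_pos.mpr hε
      nlinarith
    exact ⟨stp_zero this, stp_deriv_zero this⟩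
  refine Tst.of_C1 (hΩ.inter h.oV) hKc hKs (hc.mono inter_subset_right) ?_ ?_ ?_
  · intro x hx
    by_cases hxs : x ∈ tsupport κ
    · rw [(hout x hx hxs).1, zero_mul]
    · simp [hκ.zero0 hxs]
  · intro x hx
    by_cases hxs : x ∈ tsupport κ
    · rw [(hout x hx hxs).1, (hout x hx hxs).2]; simp
    · simp [hκ.zero0 hxs, hκ.zero1 hxs]
  · intro x hx
    by_cases hxs : x ∈ tsupport κ
    · rw [(hout x hx hxs).1, (hout x hx hxs).2]; simp
    · simp [hκ.zero0 hxs, hκ.zero2 hxs]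

/-- Uniform control of the boundary layer. -/
lemma Chart.layer {Ω V : Set Pl} {g g1 g2 g11 g12 g21 g22 κ κ1 κ2 : Pl → ℝ}
    (h : Chart Ω V g g1 g2 g11 g12 g21 g22) (hΩ : IsOpen Ω) (hκ : Tst V κ κ1 κ2) :
    ∃ C, 0 ≤ C ∧ ∀ ε > 0, Integrable (fun x => ε⁻¹ * (deriv stp (-ε⁻¹ * g x) * κ x *
      (g1 x ^ 2 + g2 x ^ 2))) ∧
      ∫ x, ε⁻¹ * (deriv stp (-ε⁻¹ * g x) * κ x * (g1 x ^ 2 + g2 x ^ 2)) ≤ C := by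
  set D : Pl → ℝ := fun x => g1 x * κ1 x + g2 x * κ2 x + (g11 x + g22 x) * κ x with hD
  have cD : ContinuousOn D V := ((h.cg.c1.mul hκ.cψ1.continuousOn).add
    (h.cg.c2.mul hκ.cψ2.continuousOn)).add ((h.cg1.c1.add h.cg2.c2).mul hκ.cψ.continuousOn)
  have iD : Integrable D := Tst.integrable_of h.oV hκ.k hκ.s cD
    (fun x hx => by simp [hD, hκ.zero0 hx, hκ.zero1 hx, hκ.zero2 hx])
  refine ⟨∫ x, |D x|, integral_nonneg fun x => abs_nonneg _, fun ε hε => ?_⟩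
  have cs : ContinuousOn (fun x => stp (-ε⁻¹ * g x)) V :=
    stp_contDiff.continuous.comp_continuousOn (continuousOn_const.mul h.cg.cont)
  have cs' : ContinuousOn (fun x => deriv stp (-ε⁻¹ * g x)) V :=
    stp_deriv_cont.comp_continuousOn (continuousOn_const.mul h.cg.cont)
  have i1 : Integrable (fun x => ε⁻¹ * (deriv stp (-ε⁻¹ * g x) * κ x *
      (g1 x ^ 2 + g2 x ^ 2))) := Tst.integrable_of h.oV hκ.k hκ.s
      (continuousOn_const.mul ((cs'.mul hκ.cψ.continuousOn).mul ((h.cg.c1.pow 2).add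
        (h.cg.c2.pow 2)))) (fun x hx => by simp [hκ.zero0 hx])
  have i2 : Integrable (fun x => stp (-ε⁻¹ * g x) * D x) := Tst.integrable_of h.oV hκ.k hκ.s
      (cs.mul cD) (fun x hx => by simp [hD, hκ.zero0 hx, hκ.zero1 hx, hκ.zero2 hx])
  refine ⟨i1, ?_⟩
  have e := (WD.of_C1 h.oV h.cg1 h.cg2).eq _ _ _ ((h.tst hΩ hκ hε).mono inter_subset_right)
  have e2 : ∫ x, ε⁻¹ * (deriv stp (-ε⁻¹ * g x) * κ x * (g1 x ^ 2 + g2 x ^ 2))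
      = ∫ x, stp (-ε⁻¹ * g x) * D x := by
    rw [← sub_eq_zero, ← integral_sub i1 i2, ← neg_eq_zero, ← integral_neg]
    refine Eq.trans ?_ e
    congr 1; funext x; simp only [hD]; ring
  rw [e2]
  refine integral_mono i2 iD.abs fun x => ?_
  calc stp (-ε⁻¹ * g x) * D x ≤ |stp (-ε⁻¹ * g x) * D x| := le_abs_self _
    _ = stp (-ε⁻¹ * g x) * |D x| := by rw [abs_mul, abs_of_nonneg (stp_nonneg _)]
    _ ≤ 1 * |D x| := mul_le_mul_of_nonneg_right (stp_le_one _) (abs_nonneg _)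
    _ = |D x| := one_mul _

lemma Good.bdry {Ω V : Set Pl} {η : Pl → Pl} {g g1 g2 g11 g12 g21 g22 : Pl → ℝ}
    (h : Chart Ω V g g1 g2 g11 g12 g21 g22) (hΩ : IsOpen Ω)
    (hpar : ∀ x ∈ frontier Ω, x ∈ V → ∀ a b, a * η x 0 + b * η x 1 = 0 →
      a * g1 x + b * g2 x = 0) : Good Ω η V := by
  refine ⟨h.oV, fun K hK hKV Y1 Y2 f q hG => ?_⟩
  obtain ⟨κ, κ1, κ2, hκ, hκ0, hκ1, U, hU, hKU, hU1⟩ := exists_cutoff h.oV hK hKV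
  obtain ⟨C, hC0, hC⟩ := h.layer hΩ hκ
  obtain ⟨M, hM⟩ := hG.qb
  have main : ∀ δ > 0, ∃ ε₀ > 0, ∀ ε, 0 < ε → ε < ε₀ →
      ∫ x, q x * (stp (-ε⁻¹ * g x) * κ x) ≤ δ * C := by
    intro δ hδ
    set S := {x ∈ K ∩ closure Ω | δ * (g1 x ^ 2 + g2 x ^ 2) ≤ |Y1 x * g1 x + Y2 x * g2 x|} with hS
    have hKc : IsCompact (K ∩ closure Ω) := hK.inter_right isClosed_closure
    have cy1 := hG.y1.mono (inter_subset_right : K ∩ closure Ω ⊆ closure Ω)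
    have cy2 := hG.y2.mono (inter_subset_right : K ∩ closure Ω ⊆ closure Ω)
    have hsV : K ∩ closure Ω ⊆ V := inter_subset_left.trans hKV
    have cg1 := h.cg.c1.mono hsV
    have cg2 := h.cg.c2.mono hsV
    have hSc : IsCompact S := by
      refine hKc.of_isClosed_subset ?_ (fun x hx => hx.1)
      exact hKc.isClosed.isClosed_le (continuousOn_const.mul ((cg1.pow 2).add (cg2.pow 2)))
        ((cy1.mul cg1).add (cy2.mul cg2)).abs
    have hneg : ∀ x ∈ S, g x < 0 := by
      intro x hx
      have hxV := hKV hx.1.1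
      refine lt_of_le_of_ne (h.le hxV hx.1.2) fun h0 => ?_
      have hfr := h.frontier_of_zero hΩ hxV hx.1.2 h0
      have h1 := hpar x hfr hxV _ _ (hG.yn x hfr)
      have h2 := hx.2
      rw [h1, abs_zero] at h2
      have := h.nz x hxV
      nlinarith
    obtain ⟨m, hm, hmS⟩ : ∃ m > 0, ∀ x ∈ S, g x ≤ -m := by
      rcases S.eq_empty_or_nonempty with hE | hE
      · exact ⟨1, one_pos, fun x hx => by rw [hE] at hx; exact absurd hx (by simp)⟩
      · obtain ⟨y, hy, hmax⟩ := hSc.exists_isMaxOn hE (h.cg.cont.mono (fun x hx => hsV hx.1))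
        exact ⟨-g y, by linarith [hneg y hy], fun x hx => by simpa using hmax hx⟩
    refine ⟨m / 2, by positivity, fun ε hε hεm => ?_⟩
    obtain ⟨iL, hL⟩ := hC ε hε
    have T := (h.tst hΩ hκ hε).mono inter_subset_left
    have e := hG.wd.eq _ _ _ T
    have cs : Continuous (fun x => stp (-ε⁻¹ * g x) * κ x) := T.cψ
    have iq : Integrable fun x => q x * (stp (-ε⁻¹ * g x) * κ x) :=
      Tst.integrable_of hΩ T.k T.s (hG.qc.mul cs.continuousOn) (fun x hx => by
        have := T.zero0 hx
        rw [this, mul_zero])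
    have il : Integrable fun x => f x * (stp (-ε⁻¹ * g x) * κ x) :=
      Tst.integrable_of hΩ T.k T.s (hG.wd.cf.mul cs.continuousOn) (fun x hx => by
        have := T.zero0 hx
        rw [this, mul_zero])
    have iY := hG.wd.integrable hΩ T
    have hle : ∫ x, q x * (stp (-ε⁻¹ * g x) * κ x) ≤
        ∫ x, δ * (ε⁻¹ * (deriv stp (-ε⁻¹ * g x) * κ x * (g1 x ^ 2 + g2 x ^ 2))) +
          (Y1 x * (deriv stp (-ε⁻¹ * g x) * (-ε⁻¹ * g1 x) * κ x + stp (-ε⁻¹ * g x) * κ1 x) +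
          Y2 x * (deriv stp (-ε⁻¹ * g x) * (-ε⁻¹ * g2 x) * κ x + stp (-ε⁻¹ * g x) * κ2 x) +
          f x * (stp (-ε⁻¹ * g x) * κ x)) := by
      refine integral_mono iq ((iL.const_mul δ).add iY) fun x => ?_
      by_cases hxΩ : x ∈ Ω
      · have hqf : q x * (stp (-ε⁻¹ * g x) * κ x) ≤ f x * (stp (-ε⁻¹ * g x) * κ x) :=
          mul_le_mul_of_nonneg_right (hG.qf x hxΩ) (mul_nonneg (stp_nonneg _) (hκ0 x))
        have hd0 := stp_deriv_nonneg (-ε⁻¹ * g x)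
        have hei : 0 < ε⁻¹ := inv_pos.mpr hε
        by_cases hxK : x ∈ K
        · obtain ⟨a, b, c⟩ := hU1 x (hKU hxK)
          simp only [a, b, c, mul_one, mul_zero, add_zero]
          rw [a, mul_one] at hqf
          have : 0 ≤ ε⁻¹ * deriv stp (-ε⁻¹ * g x) *
              (δ * (g1 x ^ 2 + g2 x ^ 2) - (Y1 x * g1 x + Y2 x * g2 x)) := by
            by_cases hs : x ∈ S
            · have : 2 ≤ -ε⁻¹ * g x := by
                have h1 := hmS x hs
                have h2 : 2 * ε ≤ - g x := by linarith
                have h3 := mul_le_mul_of_nonneg_left h2 hei.le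
                have h4 : ε⁻¹ * (2 * ε) = 2 := by field_simp
                rw [h4] at h3; linarith
              rw [stp_deriv_zero' this]; simp
            · have : |Y1 x * g1 x + Y2 x * g2 x| < δ * (g1 x ^ 2 + g2 x ^ 2) := by
                by_contra hcon
                exact hs ⟨⟨hxK, subset_closure hxΩ⟩, by linarith⟩
              have := le_abs_self (Y1 x * g1 x + Y2 x * g2 x)
              exact mul_nonneg (mul_nonneg hei.le hd0) (by linarith)
          nlinarith
        · rw [hG.z1 x (subset_closure hxΩ) hxK, hG.z2 x (subset_closure hxΩ) hxK]
          have : 0 ≤ δ * (ε⁻¹ * (deriv stp (-ε⁻¹ * g x) * κ x * (g1 x ^ 2 + g2 x ^ 2))) := by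
            have := hκ0 x
            positivity
          linarith
      · have hx : x ∉ tsupport (fun x => stp (-ε⁻¹ * g x) * κ x) := fun h' => hxΩ (T.s h')
        have z0 := T.zero0 hx
        have z1 := T.zero1 hx
        have z2 := T.zero2 hx
        rw [z0, z1, z2]
        have : 0 ≤ δ * (ε⁻¹ * (deriv stp (-ε⁻¹ * g x) * κ x * (g1 x ^ 2 + g2 x ^ 2))) := by
          have := hκ0 x
          have := stp_deriv_nonneg (-ε⁻¹ * g x)
          positivity
        linarith
    refine hle.trans ?_
    rw [integral_add (iL.const_mul δ) iY, e, add_zero, integral_const_mul]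
    exact mul_le_mul_of_nonneg_left hL hδ.le
  -- pass to the limit
  have hlim : Tendsto (fun n : ℕ => ∫ x, q x * (stp (-((1:ℝ) / (n + 1))⁻¹ * g x) * κ x)) atTop
      (𝓝 (∫ x, Ω.indicator q x)) := by
    have hT : ∀ n : ℕ, Tst Ω _ _ _ := fun n =>
      (h.tst hΩ hκ (ε := (1:ℝ) / (n + 1)) (by positivity)).mono inter_subset_left
    refine tendsto_integral_of_dominated_convergence (K.indicator fun _ => |M|) ?_ ?_ ?_ ?_
    · intro n
      refine (Tst.integrable_of hΩ (hT n).k (hT n).s (hG.qc.mul (hT n).cψ.continuousOn)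
        (fun x hx => ?_)).aestronglyMeasurable
      have := (hT n).zero0 hx
      simp only [Pi.mul_apply]
      rw [this, mul_zero]
    · rw [integrable_indicator_iff hK.measurableSet]
      exact integrableOn_const hK.measure_lt_top.ne
    · intro n
      refine Eventually.of_forall fun x => ?_
      by_cases hxΩ : x ∈ Ω
      · by_cases hxK : x ∈ K
        · rw [indicator_of_mem hxK, norm_mul, Real.norm_eq_abs, Real.norm_eq_abs, abs_mul,
            abs_of_nonneg (stp_nonneg _), abs_of_nonneg (hκ0 x)]
          have h1 := (hM x hxΩ).trans (le_abs_self M)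
          have h2 := stp_le_one (-((1:ℝ) / (n + 1))⁻¹ * g x)
          have h3 := mul_le_mul h2 (hκ1 x) (hκ0 x) zero_le_one
          rw [one_mul] at h3
          have h4 := mul_le_mul h1 h3 (mul_nonneg (stp_nonneg _) (hκ0 x)) (abs_nonneg M)
          linarith
        · rw [hG.qz x hxΩ hxK, indicator_of_notMem hxK]; simp
      · have := (hT n).zero0 (x := x) (fun h' => hxΩ ((hT n).s h'))
        rw [this, mul_zero, norm_zero]
        exact indicator_nonneg (fun _ _ => abs_nonneg _) _
    · refine Eventually.of_forall fun x => ?_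
      by_cases hxΩ : x ∈ Ω
      · rw [indicator_of_mem hxΩ]
        by_cases hxK : x ∈ K
        · have hg := (h.lt (hKV hxK)).mp hxΩ
          rw [(hU1 x (hKU hxK)).1]
          refine tendsto_const_nhds.congr' ?_
          obtain ⟨N, hN⟩ := exists_nat_gt (2 / (- g x))
          filter_upwards [eventually_ge_atTop N] with n hn
          rw [stp_one]; · simp
          have hn' : (N:ℝ) ≤ n := by exact_mod_cast hn
          rw [div_lt_iff₀ (by linarith)] at hN
          simp only [one_div, inv_inv]
          nlinarith
        · simp [hG.qz x hxΩ hxK]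
      · rw [indicator_of_notMem hxΩ]
        refine tendsto_const_nhds.congr fun n => ?_
        have := (hT n).zero0 (x := x) (fun h' => hxΩ ((hT n).s h'))
        rw [this, mul_zero]
  rw [integral_indicator hΩ.measurableSet] at hlim
  have hall : ∀ δ > 0, ∫ x in Ω, q x ≤ δ * C := by
    intro δ hδ
    obtain ⟨ε₀, hε₀, hm⟩ := main δ hδ
    refine le_of_tendsto hlim ?_
    have := tendsto_one_div_add_atTop_nhds_zero_nat (𝕜 := ℝ)
    filter_upwards [this.eventually_lt_const hε₀] with n hn
    exact hm _ (by positivity) hn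
  by_contra hcon
  push Not at hcon
  have := hall ((∫ x in Ω, q x) / (2 * (C + 1))) (by positivity)
  rw [div_mul_eq_mul_div, le_div_iff₀ (by positivity)] at this
  nlinarith

/-- Gauss-Green inequality for fields with zero normal flux. -/
lemma gauss_green {Ω K : Set Pl} {η : Pl → Pl} (hΩ : IsCkDomainWithNormal 2 Ω η)
    (hK : IsCompact K) {Y1 Y2 f q : Pl → ℝ} (h : GGd Ω η K Y1 Y2 f q) : ∫ x in Ω, q x ≤ 0 := by
  have ho : IsOpen Ω := hΩ.2.1
  have hpt : ∀ p : Pl, ∃ U, p ∈ U ∧ Good Ω η U := by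
    intro p
    by_cases hp : p ∈ Ω
    · exact ⟨Ω, hp, Good.inside ho⟩
    by_cases hp' : p ∈ closure Ω
    · have hf : p ∈ frontier Ω := by rw [ho.frontier_eq]; exact ⟨hp', hp⟩
      obtain ⟨V, g, g1, g2, g11, g12, g21, g22, hpV, hch, -, -⟩ := exists_chart hΩ hf
      refine ⟨V, hpV, Good.bdry hch ho fun x hx hxV a b hab => ?_⟩
      obtain ⟨V', k, k1, k2, k11, k12, k21, k22, hxV', hch', h0, h1⟩ := exists_chart hΩ hx
      refine hch.perp ho hch' hxV hxV' hx a b ?_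
      rw [h0, h1] at hab
      have hpos : 0 < (√(k1 x ^ 2 + k2 x ^ 2))⁻¹ :=
        inv_pos.mpr (Real.sqrt_pos.mpr (hch'.nz x hxV'))
      have : (√(k1 x ^ 2 + k2 x ^ 2))⁻¹ * (a * k1 x + b * k2 x) = 0 := by linarith
      exact (mul_eq_zero.mp this).resolve_left hpos.ne'
    · exact ⟨_, hp', Good.compl ho⟩
  obtain ⟨U, hKU, hU⟩ : ∃ U, K ⊆ U ∧ Good Ω η U := by
    refine hK.induction_on (p := fun s => ∃ U, s ⊆ U ∧ Good Ω η U) ?_ ?_ ?_ ?_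
    · exact ⟨Ω, empty_subset _, Good.inside ho⟩
    · rintro s t hst ⟨U, hU, hg⟩
      exact ⟨U, hst.trans hU, hg⟩
    · rintro s t ⟨U, hU, hg⟩ ⟨U', hU', hg'⟩
      exact ⟨U ∪ U', union_subset_union hU hU', hg.union ho hg'⟩
    · intro x _
      obtain ⟨U, hxU, hg⟩ := hpt x
      exact ⟨U, mem_nhdsWithin_of_mem_nhds (hg.1.mem_nhds hxU), U, Subset.rfl, hg⟩
  exact hU.2 K hK hKU _ _ _ _ h


/-! ### Tangential derivatives on the boundary -/

lemma Chart.strict {Ω V : Set Pl} {g g1 g2 g11 g12 g21 g22 : Pl → ℝ}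
    (h : Chart Ω V g g1 g2 g11 g12 g21 g22) {p : Pl} (hp : p ∈ V) :
    HasStrictFDerivAt g (lf (g1 p) (g2 p)) p := by
  have h1 := ((h.cg.contDiffOn h.oV).contDiffAt (h.oV.mem_nhds hp)).hasStrictFDerivAt one_ne_zero
  rwa [(h.cg.der p hp).fderiv] at h1

lemma Chart.curve {Ω V : Set Pl} {g g1 g2 g11 g12 g21 g22 : Pl → ℝ}
    (h : Chart Ω V g g1 g2 g11 g12 g21 g22) {p : Pl} (hp : p ∈ V) (h0 : g p = 0) :
    ∃ γ : ℝ → Pl, γ 0 = p ∧ HasDerivAt γ ((-g2 p) • e0 + g1 p • e1) 0 ∧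
      ∃ r > 0, ContinuousOn γ (Ioo (-r) r) ∧ ∀ s ∈ Ioo (-r) r, g (γ s) = 0 := by
  have hs := h.strict hp
  set L := lf (g1 p) (g2 p) with hL
  have hnz := h.nz p hp
  have hrange : L.range = ⊤ := by
    rw [LinearMap.range_eq_top]
    intro y
    refine ⟨(y / (g1 p ^ 2 + g2 p ^ 2)) • (g1 p • e0 + g2 p • e1), ?_⟩
    have : L ((y / (g1 p ^ 2 + g2 p ^ 2)) • (g1 p • e0 + g2 p • e1)) = y := by
      rw [hL, lf_apply]; simp; field_simp
    exact this
  set τ : Pl := (-g2 p) • e0 + g1 p • e1 with hτ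
  have hτk : τ ∈ L.ker := by
    rw [LinearMap.mem_ker]
    have : L τ = 0 := by rw [hL, lf_apply]; simp [hτ]; ring
    exact this
  set I := hs.implicitFunction g L hrange (g p) with hI
  have hId : HasStrictFDerivAt I L.ker.subtypeL 0 := hs.to_implicitFunction hrange
  set ℓ : ℝ → L.ker := fun s => s • ⟨τ, hτk⟩ with hℓ
  have hℓc : Continuous ℓ := by fun_prop
  have hℓ0 : ℓ 0 = 0 := by simp [hℓ]
  have hmap := hs.map_implicitFunction_eq hrange
  have hev1 : ∀ᶠ s : ℝ in 𝓝 0, g (I (ℓ s)) = g p := by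
    have : Tendsto (fun s : ℝ => (g p, ℓ s)) (𝓝 0) (𝓝 (g p, 0)) := by
      have := (continuous_const.prodMk hℓc : Continuous fun s : ℝ => (g p, ℓ s)).tendsto 0
      rwa [hℓ0] at this
    exact this.eventually hmap
  obtain ⟨K, S, hS, hlip⟩ := hId.exists_lipschitzOnWith
  have hev2 : ∀ᶠ s : ℝ in 𝓝 0, ℓ s ∈ S := by
    have := hℓc.tendsto 0
    rw [hℓ0] at this
    exact this.eventually hS
  obtain ⟨r, hr, hball⟩ := Metric.eventually_nhds_iff_ball.mp (hev1.and hev2)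
  rw [Real.ball_eq_Ioo] at hball
  simp only [zero_sub, zero_add] at hball
  refine ⟨fun s => I (ℓ s), ?_, ?_, r, hr, ?_, fun s hs' => ?_⟩
  · simp only [hℓ0]; exact hs.implicitFunction_apply_image hrange
  · have h1 : HasDerivAt ℓ ⟨τ, hτk⟩ 0 := by
      have h0' := (hasDerivAt_id (0:ℝ)).smul_const (⟨τ, hτk⟩ : L.ker)
      rw [one_smul] at h0'
      exact h0'
    have h2 := hId.hasFDerivAt
    rw [← hℓ0] at h2
    exact h2.comp_hasDerivAt (0:ℝ) h1
  · exact hlip.continuousOn.comp hℓc.continuousOn fun s hs' => (hball s hs').2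
  · rw [← h0]; exact (hball s hs').1

lemma seg_mv {Ω : Set Pl} {F G1 G2 : Pl → ℝ} (hF : ContinuousOn F (closure Ω))
    (hd : ∀ x ∈ Ω, HasFDerivAt F (lf (G1 x) (G2 x)) x) {x y : Pl} {c1 c2 ε : ℝ}
    (hseg : ∀ t ∈ Ioo (0:ℝ) 1, x + t • (y - x) ∈ Ω ∧ |G1 (x + t • (y - x)) - c1| ≤ ε ∧
      |G2 (x + t • (y - x)) - c2| ≤ ε) :
    |F y - F x - (c1 * (y - x) 0 + c2 * (y - x) 1)| ≤ 2 * ε * ‖y - x‖ := by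
  have hc : Continuous fun t : ℝ => x + t • (y - x) := by fun_prop
  have hcl : ∀ t ∈ Icc (0:ℝ) 1, x + t • (y - x) ∈ closure Ω := by
    intro t ht
    have : t ∈ closure (Ioo (0:ℝ) 1) := by rw [closure_Ioo (by norm_num)]; exact ht
    exact map_mem_closure (f := fun t : ℝ => x + t • (y - x)) hc this fun s hs => (hseg s hs).1
  obtain ⟨t, ht, he⟩ := exists_hasDerivAt_eq_slope (fun t : ℝ => F (x + t • (y - x)))
    (fun t => G1 (x + t • (y - x)) * (y - x) 0 + G2 (x + t • (y - x)) * (y - x) 1)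
    (zero_lt_one) (hF.comp hc.continuousOn hcl) (fun t ht => by
      have h1 : HasDerivAt (fun t : ℝ => x + t • (y - x)) (y - x) t := by
        simpa using ((hasDerivAt_id t).smul_const (y - x)).const_add x
      have h2 := (hd _ (hseg t ht).1).comp_hasDerivAt t h1
      rw [lf_apply] at h2
      exact h2)
  simp only [one_smul, zero_smul, add_zero, sub_zero, div_one, add_sub_cancel] at he
  obtain ⟨-, a1, a2⟩ := hseg t ht
  rw [← he]
  have e : G1 (x + t • (y - x)) * (y - x) 0 + G2 (x + t • (y - x)) * (y - x) 1 -
      (c1 * (y - x) 0 + c2 * (y - x) 1) = (G1 (x + t • (y - x)) - c1) * (y - x) 0 +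
      (G2 (x + t • (y - x)) - c2) * (y - x) 1 := by ring
  rw [e]
  refine (abs_add_le _ _).trans ?_
  rw [abs_mul, abs_mul]
  have b0 := abs_coord_le (y - x) 0
  have b1 := abs_coord_le (y - x) 1
  have hε : 0 ≤ ε := (abs_nonneg _).trans a1
  have := mul_le_mul a1 b0 (abs_nonneg _) hε
  have := mul_le_mul a2 b1 (abs_nonneg _) hε
  linarith

set_option maxHeartbeats 1600000 in
/-- A function constant on boundary components has vanishing tangential derivative. -/
lemma tangential {Ω : Set Pl} {η : Pl → Pl} (hΩ : IsCkDomainWithNormal 2 Ω η)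
    {F G1 G2 : Pl → ℝ} (hF : ContinuousOn F (closure Ω))
    (hd : ∀ x ∈ Ω, HasFDerivAt F (lf (G1 x) (G2 x)) x)
    (hG1 : ContinuousOn G1 (closure Ω)) (hG2 : ContinuousOn G2 (closure Ω))
    (hcomp : ∀ p ∈ frontier Ω, ∀ q ∈ connectedComponentIn (frontier Ω) p, F q = F p)
    {p : Pl} (hp : p ∈ frontier Ω) : G1 p * η p 1 = G2 p * η p 0 := by
  have ho : IsOpen Ω := hΩ.2.1
  have hpc : p ∈ closure Ω := frontier_subset_closure hp
  obtain ⟨V, g, g1, g2, g11, g12, g21, g22, hpV, hch, hη0, hη1⟩ := exists_chart hΩ hp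
  have hg0 := hch.zero ho hpV hp
  obtain ⟨γ, hγ0, hγd, r, hr, hγc, hγz⟩ := hch.curve hpV hg0
  set a1 := g1 p
  set a2 := g2 p
  have hA : 0 < a1 ^ 2 + a2 ^ 2 := hch.nz p hpV
  set τ : Pl := (-a2) • e0 + a1 • e1 with hτ
  set ν : Pl := (-a1 / (a1 ^ 2 + a2 ^ 2)) • e0 + (-a2 / (a1 ^ 2 + a2 ^ 2)) • e1 with hν
  have hLν : lf a1 a2 ν = -1 := by rw [lf_apply, hν]; simp; field_simp; ring
  have hLτ : lf a1 a2 τ = 0 := by rw [lf_apply, hτ]; simp; ring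
  suffices hz : G1 p * (-a2) + G2 p * a1 = 0 by
    rw [hη0, hη1]
    linear_combination (√(a1 ^ 2 + a2 ^ 2))⁻¹ * hz
  set B : ℝ := 2 * (2 * ‖ν‖ + ‖τ‖ + 1) + |G1 p| + |G2 p| with hB
  have hB0 : 0 < B := by positivity
  have key : ∀ ε > 0, |G1 p * (-a2) + G2 p * a1| ≤ ε * B := by
    intro ε hε
    set N : ℝ := ‖lf a1 a2‖ + 2 * ‖ν‖ + ‖τ‖ + 2 with hN
    have hN0 : 0 < N := by positivity
    set c : ℝ := min (1 / (2 * N)) (min 1 ε) with hc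
    have hc0 : 0 < c := by positivity
    have hc1 : c ≤ 1 := (min_le_right _ _).trans (min_le_left _ _)
    have hcε : c ≤ ε := (min_le_right _ _).trans (min_le_right _ _)
    have hcN : c * N ≤ 1 / 2 := by
      calc c * N ≤ 1 / (2 * N) * N := mul_le_mul_of_nonneg_right (min_le_left _ _) hN0.le
        _ = 1 / 2 := by field_simp
    -- neighbourhood of p
    have e1' := (hch.strict hpV).isLittleO.def hc0
    rw [nhds_prod_eq] at e1'
    obtain ⟨ρ1, hρ1, hst⟩ : ∃ ρ > 0, ∀ x ∈ ball p ρ, ∀ y ∈ ball p ρ,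
        ‖g x - g y - lf a1 a2 (x - y)‖ ≤ c * ‖x - y‖ := by
      rw [(Metric.nhds_basis_ball.prod_self).eventually_iff] at e1'
      obtain ⟨ρ, hρ, hh⟩ := e1'
      exact ⟨ρ, hρ, fun x hx y hy => hh (x := (x, y)) ⟨hx, hy⟩⟩
    obtain ⟨ρ2, hρ2, hV2⟩ := Metric.isOpen_iff.mp hch.oV p hpV
    obtain ⟨ρ3, hρ3, hG3⟩ := Metric.continuousWithinAt_iff.mp (hG1 p hpc) ε hε
    obtain ⟨ρ4, hρ4, hG4⟩ := Metric.continuousWithinAt_iff.mp (hG2 p hpc) ε hε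
    set ρ := min (min ρ1 ρ2) (min ρ3 ρ4) with hρ
    have hρ0 : 0 < ρ := by positivity
    have hball : ∀ x, ‖x - p‖ < ρ → x ∈ ball p ρ1 ∧ x ∈ V ∧ (x ∈ closure Ω → |G1 x - G1 p| ≤ ε ∧
        |G2 x - G2 p| ≤ ε) := by
      intro x hx
      have hx1 : dist x p < ρ1 := by
        rw [dist_eq_norm]; exact hx.trans_le ((min_le_left _ _).trans (min_le_left _ _))
      have hx2 : dist x p < ρ2 := by
        rw [dist_eq_norm]; exact hx.trans_le ((min_le_left _ _).trans (min_le_right _ _))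
      have hx3 : dist x p < ρ3 := by
        rw [dist_eq_norm]; exact hx.trans_le ((min_le_right _ _).trans (min_le_left _ _))
      have hx4 : dist x p < ρ4 := by
        rw [dist_eq_norm]; exact hx.trans_le ((min_le_right _ _).trans (min_le_right _ _))
      exact ⟨hx1, hV2 hx2, fun hcl => ⟨(hG3 hcl hx3).le, (hG4 hcl hx4).le⟩⟩
    -- choose s
    have ev1 : ∀ᶠ s : ℝ in 𝓝[>] 0, ‖γ s - p - s • τ‖ ≤ c * s := by
      have := (hasDerivAt_iff_isLittleO_nhds_zero.mp hγd).def hc0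
      have h2 : ∀ᶠ s : ℝ in 𝓝[>] 0, ‖γ (0 + s) - γ 0 - s • τ‖ ≤ c * ‖s‖ :=
        this.filter_mono nhdsWithin_le_nhds
      filter_upwards [h2, self_mem_nhdsWithin] with s hs hs0
      rwa [zero_add, hγ0, Real.norm_eq_abs, abs_of_pos hs0] at hs
    have ev2 : ∀ᶠ s : ℝ in 𝓝[>] 0, s * (2 * ‖ν‖ + ‖τ‖ + 2) < ρ := by
      have : Continuous fun s : ℝ => s * (2 * ‖ν‖ + ‖τ‖ + 2) := by fun_prop
      refine (this.continuousAt.eventually_lt continuousAt_const ?_).filter_mono nhdsWithin_le_nhds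
      simpa using hρ0
    have ev3 : ∀ᶠ s : ℝ in 𝓝[>] 0, s < r :=
      (eventually_lt_nhds hr).filter_mono nhdsWithin_le_nhds
    -- smallness for all parameters up to s
    rw [eventually_nhdsWithin_iff] at ev1
    obtain ⟨r1, hr1, hev1⟩ := Metric.eventually_nhds_iff_ball.mp ev1
    obtain ⟨s, ⟨hs2, hs3⟩, hs1, hs0⟩ := ((ev2.and ev3).and
      ((((eventually_lt_nhds hr1).filter_mono nhdsWithin_le_nhds : ∀ᶠ s : ℝ in 𝓝[>] 0, s < r1)).and
        (self_mem_nhdsWithin))).exists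
    have hs0 : (0:ℝ) < s := hs0
    have hnear : ∀ σ, 0 < σ → σ ≤ s → ‖γ σ - p - σ • τ‖ ≤ c * σ := by
      intro σ h1 h2
      refine hev1 σ ?_ h1
      rw [Real.ball_eq_Ioo]; constructor <;> simp <;> linarith
    have hnear2 : ∀ σ, 0 ≤ σ → σ ≤ s → ‖γ σ - p‖ ≤ s * ‖τ‖ + s := by
      intro σ h1 h2
      rcases h1.eq_or_lt with h1 | h1
      · rw [← h1, hγ0]; simp; positivity
      have h3 := hnear σ h1 h2
      have h4 : ‖γ σ - p‖ ≤ ‖γ σ - p - σ • τ‖ + ‖σ • τ‖ := by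
        have := norm_add_le (γ σ - p - σ • τ) (σ • τ)
        simpa using this
      rw [norm_smul, Real.norm_eq_abs, abs_of_pos h1] at h4
      have : σ * ‖τ‖ ≤ s * ‖τ‖ := mul_le_mul_of_nonneg_right h2 (norm_nonneg _)
      have h5 : c * σ ≤ 1 * s := mul_le_mul hc1 h2 h1.le zero_le_one
      linarith
    have hs2' : 2 * (s * ‖ν‖) + s * ‖τ‖ + 2 * s < ρ := by
      have : s * (2 * ‖ν‖ + ‖τ‖ + 2) = 2 * (s * ‖ν‖) + s * ‖τ‖ + 2 * s := by ring
      linarith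
    have hsν0 : 0 ≤ s * ‖ν‖ := mul_nonneg hs0.le (norm_nonneg _)
    have hsτ0 : 0 ≤ s * ‖τ‖ := mul_nonneg hs0.le (norm_nonneg _)
    have hnτ := norm_nonneg τ
    have hnν := norm_nonneg ν
    have hnl := norm_nonneg (lf a1 a2)
    -- points pushed in the inner direction are in Ω
    have hin : ∀ y, g y = 0 → ‖y - p‖ ≤ s * ‖τ‖ + s → ∀ t, 0 < t → t ≤ s → y + t • ν ∈ Ω := by
      intro y hy0 hyp t ht0 hts
      have hb1 : ‖y - p‖ < ρ := by linarith
      have hb2 : ‖y + t • ν - p‖ < ρ := by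
        have h1 : ‖y + t • ν - p‖ ≤ ‖y - p‖ + ‖t • ν‖ := by
          have := norm_add_le (y - p) (t • ν)
          rwa [show y - p + t • ν = y + t • ν - p by abel] at this
        rw [norm_smul, Real.norm_eq_abs, abs_of_pos ht0] at h1
        have : t * ‖ν‖ ≤ s * ‖ν‖ := mul_le_mul_of_nonneg_right hts hnν
        linarith
      rw [hch.lt (hball _ hb2).2.1]
      have h3 := hst _ (hball _ hb2).1 _ (hball _ hb1).1
      rw [add_sub_cancel_left, hy0, map_smul, hLν, norm_smul, Real.norm_eq_abs, Real.norm_eq_abs,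
        abs_of_pos ht0, smul_eq_mul] at h3
      have h4 := (abs_le.mp h3).2
      have : c * ‖ν‖ ≤ 1 / 2 := by
        refine le_trans ?_ hcN
        exact mul_le_mul_of_nonneg_left (by rw [hN]; linarith) hc0.le
      have h6 := mul_le_mul_of_nonneg_left this ht0.le
      have h7 : c * (t * ‖ν‖) = t * (c * ‖ν‖) := by ring
      rw [h7] at h4
      linarith
    have hγin : ∀ σ, 0 ≤ σ → σ ≤ s → γ σ ∈ frontier Ω := by
      intro σ h1 h2
      have hz := hγz σ ⟨by linarith, by linarith⟩
      have hn2 := hnear2 σ h1 h2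
      have hb1 : ‖γ σ - p‖ < ρ := by linarith
      refine hch.frontier_of_zero ho (hball _ hb1).2.1 ?_ hz
      have hcont : Continuous fun t : ℝ => γ σ + t • ν := by fun_prop
      have : (0:ℝ) ∈ closure (Ioc 0 s) := by
        rw [closure_Ioc hs0.ne]; exact ⟨le_rfl, hs0.le⟩
      have h3 := map_mem_closure (f := fun t : ℝ => γ σ + t • ν) hcont this fun t ht => hin _ hz hn2 t ht.1 ht.2
      simpa using h3
    have hFeq : F (γ s) = F p := by
      refine hcomp p hp _ ?_
      have hpre : IsPreconnected (γ '' Icc 0 s) :=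
        isPreconnected_Icc.image _ (hγc.mono fun σ hσ => ⟨by linarith [hσ.1], by linarith [hσ.2]⟩)
      refine hpre.subset_connectedComponentIn ⟨0, ⟨le_rfl, hs0.le⟩, hγ0⟩ ?_ ⟨s, ⟨hs0.le, le_rfl⟩, rfl⟩
      rintro _ ⟨σ, hσ, rfl⟩
      exact hγin σ hσ.1 hσ.2
    have hn := hnear s hs0 le_rfl
    have hn2 := hnear2 s hs0.le le_rfl
    have hgs := hγz s ⟨by linarith, hs3⟩
    set d := γ s - p with hd'
    have hsν : ‖s • ν‖ = s * ‖ν‖ := by rw [norm_smul, Real.norm_eq_abs, abs_of_pos hs0]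
    -- generic estimate of G along points of Ω near p
    have hGest : ∀ x ∈ Ω, ‖x - p‖ < ρ → x ∈ Ω ∧ |G1 x - G1 p| ≤ ε ∧ |G2 x - G2 p| ≤ ε :=
      fun x hx hxp => ⟨hx, (hball x hxp).2.2 (subset_closure hx)⟩
    have seg1 := seg_mv hF hd (x := p) (y := p + s • ν) (c1 := G1 p) (c2 := G2 p) (ε := ε) (by
      intro t ht
      rw [add_sub_cancel_left, smul_smul]
      have hts : t * s ≤ s := mul_le_of_le_one_left hs0.le ht.2.le
      refine hGest _ (hin p hg0 (by simp; positivity) _ (mul_pos ht.1 hs0) hts) ?_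
      rw [add_sub_cancel_left, norm_smul, Real.norm_eq_abs, abs_of_pos (mul_pos ht.1 hs0)]
      linarith [mul_le_mul_of_nonneg_right hts hnν])
    have seg3 := seg_mv hF hd (x := γ s) (y := γ s + s • ν) (c1 := G1 p) (c2 := G2 p) (ε := ε) (by
      intro t ht
      rw [add_sub_cancel_left, smul_smul]
      have hts : t * s ≤ s := mul_le_of_le_one_left hs0.le ht.2.le
      refine hGest _ (hin _ hgs hn2 _ (mul_pos ht.1 hs0) hts) ?_
      have h1 : ‖γ s + (t * s) • ν - p‖ ≤ ‖d‖ + ‖(t * s) • ν‖ := by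
        have := norm_add_le d ((t * s) • ν)
        rwa [hd', show γ s - p + (t * s) • ν = γ s + (t * s) • ν - p by abel] at this
      rw [norm_smul, Real.norm_eq_abs, abs_of_pos (mul_pos ht.1 hs0)] at h1
      linarith [mul_le_mul_of_nonneg_right hts hnν])
    have hLd : lf a1 a2 d ≤ ‖lf a1 a2‖ * (c * s) := by
      have h1 : lf a1 a2 d = lf a1 a2 (d - s • τ) := by rw [map_sub _ d, map_smul, hLτ]; simp
      rw [h1]
      refine (le_abs_self _).trans ?_
      rw [← Real.norm_eq_abs]
      exact ((lf a1 a2).le_opNorm _).trans (mul_le_mul_of_nonneg_left hn hnl)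
    have seg2 := seg_mv hF hd (x := p + s • ν) (y := γ s + s • ν) (c1 := G1 p) (c2 := G2 p)
      (ε := ε) (by
      intro t ht
      rw [add_sub_add_right_eq_sub]
      change p + s • ν + t • d ∈ Ω ∧ |G1 (p + s • ν + t • d) - G1 p| ≤ ε ∧
        |G2 (p + s • ν + t • d) - G2 p| ≤ ε
      have hnorm : ‖p + s • ν + t • d - p‖ ≤ s * ‖ν‖ + (s * ‖τ‖ + s) := by
        have h1 := norm_add_le (s • ν) (t • d)
        rw [show s • ν + t • d = p + s • ν + t • d - p by abel, hsν, norm_smul, Real.norm_eq_abs,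
          abs_of_pos ht.1] at h1
        have : t * ‖d‖ ≤ 1 * ‖d‖ := mul_le_mul_of_nonneg_right ht.2.le (norm_nonneg _)
        linarith
      have hlt : ‖p + s • ν + t • d - p‖ < ρ := by linarith
      refine hGest _ ?_ hlt
      rw [hch.lt (hball _ hlt).2.1]
      have h3 := hst _ (hball _ hlt).1 p (hball p (by simpa using hρ0)).1
      rw [hg0, sub_zero] at h3
      have h4 : lf a1 a2 (p + s • ν + t • d - p) = - s + t * lf a1 a2 d := by
        rw [show p + s • ν + t • d - p = s • ν + t • d by abel, map_add, map_smul, map_smul, hLν]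
        simp
      rw [h4] at h3
      have h5 := (abs_le.mp h3).2
      have h6 : t * lf a1 a2 d ≤ ‖lf a1 a2‖ * (c * s) := by
        have hpos : 0 ≤ ‖lf a1 a2‖ * (c * s) := by positivity
        have := mul_le_mul_of_nonneg_left hLd ht.1.le
        exact this.trans (mul_le_of_le_one_left hpos ht.2.le)
      have h7 : c * ‖p + s • ν + t • d - p‖ ≤ c * (s * ‖ν‖ + (s * ‖τ‖ + s)) :=
        mul_le_mul_of_nonneg_left hnorm hc0.le
      have h8 : s * (c * N) ≤ s * (1 / 2) := mul_le_mul_of_nonneg_left hcN hs0.le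
      have h9 : s * (c * N) = ‖lf a1 a2‖ * (c * s) + c * (s * ‖ν‖ + (s * ‖τ‖ + s)) +
        (c * s * (‖ν‖ + 1)) := by rw [hN]; ring
      have h10 : 0 ≤ c * s * (‖ν‖ + 1) := by positivity
      linarith)
    rw [add_sub_cancel_left, hsν] at seg1 seg3
    rw [add_sub_add_right_eq_sub] at seg2
    change |_ - _ - (G1 p * d 0 + G2 p * d 1)| ≤ _ * ‖d‖ at seg2
    have hcd : |G1 p * d 0 + G2 p * d 1| ≤ 2 * ε * (2 * s * ‖ν‖ + ‖d‖) := by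
      rw [hFeq] at seg3
      rw [abs_le] at *
      constructor <;> linarith [seg1.1, seg1.2, seg2.1, seg2.2, seg3.1, seg3.2]
    have t0 : |d 0 - s * (-a2)| ≤ c * s := by
      have := (abs_coord_le (d - s • τ) 0).trans hn
      simpa [hτ] using this
    have t1 : |d 1 - s * a1| ≤ c * s := by
      have := (abs_coord_le (d - s • τ) 1).trans hn
      simpa [hτ] using this
    have hfin : s * |G1 p * (-a2) + G2 p * a1| ≤ s * (ε * B) := by
      have e : s * |G1 p * (-a2) + G2 p * a1| = |(G1 p * d 0 + G2 p * d 1) -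
          G1 p * (d 0 - s * (-a2)) - G2 p * (d 1 - s * a1)| := by
        rw [← abs_of_pos hs0, ← abs_mul, abs_of_pos hs0]; congr 1; ring
      rw [e]
      refine (abs_sub _ _).trans ?_
      refine (add_le_add_left (abs_sub _ _) _).trans ?_
      rw [abs_mul, abs_mul]
      have u0 := mul_le_mul_of_nonneg_left t0 (abs_nonneg (G1 p))
      have u1 := mul_le_mul_of_nonneg_left t1 (abs_nonneg (G2 p))
      have v0 : |G1 p| * (c * s) ≤ |G1 p| * (ε * s) := by gcongr
      have v1 : |G2 p| * (c * s) ≤ |G2 p| * (ε * s) := by gcongr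
      have w : 2 * ε * (2 * s * ‖ν‖ + ‖d‖) ≤ 2 * ε * (2 * s * ‖ν‖ + (s * ‖τ‖ + s)) := by gcongr
      have hexp : s * (ε * B) = 2 * ε * (2 * s * ‖ν‖ + (s * ‖τ‖ + s)) + |G1 p| * (ε * s) +
          |G2 p| * (ε * s) := by rw [hB]; ring
      linarith
    exact le_of_mul_le_mul_left hfin hs0
  by_contra hne
  have hpos : 0 < |G1 p * (-a2) + G2 p * a1| := abs_pos.mpr hne
  have := key (|G1 p * (-a2) + G2 p * a1| / (2 * B)) (by positivity)
  rw [div_mul_eq_mul_div, le_div_iff₀ (by positivity)] at this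
  have h2 := mul_pos hpos hB0
  linarith


/-! ### Logarithmic cutoffs -/

lemma stp_deriv_bdd : ∃ D > 0, ∀ t, |deriv stp t| ≤ D := by
  obtain ⟨D, hD⟩ := isCompact_Icc.exists_bound_of_continuousOn
    (stp_deriv_cont.continuousOn (s := Icc (1:ℝ) 2))
  refine ⟨|D| + 1, by positivity, fun t => ?_⟩
  by_cases h1 : t ≤ 1
  · rw [stp_deriv_zero h1, abs_zero]; positivity
  by_cases h2 : 2 ≤ t
  · rw [stp_deriv_zero' h2, abs_zero]; positivity
  have := hD t ⟨(not_le.mp h1).le, (not_le.mp h2).le⟩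
  rw [Real.norm_eq_abs] at this
  linarith [le_abs_self D]

lemma ind_integral {A r : ℝ} (hA : 0 ≤ A) (hr : 0 ≤ r) :
    Integrable ((closedBall (0:Pl) r).indicator fun _ => A) ∧
    ∫ x, (closedBall (0:Pl) r).indicator (fun _ => A) x = r ^ 2 * Real.pi * A := by
  have hvol : volume (closedBall (0:Pl) r) = ENNReal.ofReal r ^ 2 * ENNReal.ofReal Real.pi := by
    rw [EuclideanSpace.volume_closedBall_fin_two]
  constructor
  · exact (integrable_indicator_iff measurableSet_closedBall).mpr
      (integrableOn_const (isCompact_closedBall _ _).measure_lt_top.ne)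
  · rw [integral_indicator measurableSet_closedBall, setIntegral_const, Measure.real, hvol,
      ENNReal.toReal_mul, ENNReal.toReal_pow, ENNReal.toReal_ofReal hr,
      ENNReal.toReal_ofReal Real.pi_pos.le, smul_eq_mul]

lemma exists_logcut (R : ℝ) {ε : ℝ} (hε : 0 < ε) : ∃ φ φ1 φ2 : Pl → ℝ, C1 univ φ φ1 φ2 ∧
    (∀ x, 0 ≤ φ x) ∧ (∀ x, φ x ≤ 1) ∧ (∀ x, ‖x‖ ≤ R → φ x = 1) ∧
    (∃ ρ : ℝ, ∀ x, x ∉ closedBall (0:Pl) ρ → φ x = 0 ∧ φ1 x = 0 ∧ φ2 x = 0) ∧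
    (∀ x, φ1 x ^ 2 + φ2 x ^ 2 ≤ 1) ∧ ∫ x, (φ1 x ^ 2 + φ2 x ^ 2) ≤ ε := by
  obtain ⟨D, hD, hDb⟩ := stp_deriv_bdd
  set C : ℝ := 4 * D ^ 2 * (3 * (Real.pi * Real.exp 1)) with hC
  have hC0 : 0 < C := by have := Real.pi_pos; positivity
  obtain ⟨n, hn⟩ := exists_nat_gt (1 + R ^ 2 + 2 * D + C / ε)
  have hCε : 0 < C / ε := by positivity
  have hn1 : (1:ℝ) ≤ n := by nlinarith [sq_nonneg R]
  have hn0 : (0:ℝ) < n := by linarith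
  set f : Pl → ℝ := fun x => 1 + x 0 * x 0 + x 1 * x 1 with hf
  have hf1 : ∀ x, 1 ≤ f x := fun x => by simp only [hf]; nlinarith [sq_nonneg (x 0), sq_nonneg (x 1)]
  have hfn : ∀ x, f x = 1 + ‖x‖ ^ 2 := fun x => by rw [normsq_eq]; simp only [hf]; ring
  have hfC : C1 univ f (fun x => 2 * x 0) (fun x => 2 * x 1) :=
    (((C1.const 1).add (C1.x0.mul C1.x0)).add (C1.x1.mul C1.x1)).congr_der
      (fun x _ => by ring) (fun x _ => by ring)
  have hL := hfC.comp (s := Ioi 0) (φ := fun y => Real.log y / n) (φ' := fun y => y⁻¹ / n)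
    (fun y hy => (Real.hasDerivAt_log (ne_of_gt hy)).div_const _)
    ((continuousOn_id.inv₀ fun y hy => ne_of_gt hy).div_const _)
    (fun x _ => lt_of_lt_of_le one_pos (hf1 x))
  have hS := (C1.const 1).sub (hL.comp (s := univ) (φ := stp) (φ' := deriv stp)
    (fun y _ => stp_deriv y) stp_deriv_cont.continuousOn (fun _ _ => mem_univ _))
  have hgr : ∀ x, (0 - deriv stp (Real.log (f x) / n) * ((f x)⁻¹ / n * (2 * x 0))) ^ 2 +
      (0 - deriv stp (Real.log (f x) / n) * ((f x)⁻¹ / n * (2 * x 1))) ^ 2 ≤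
      4 * D ^ 2 / n ^ 2 * (f x)⁻¹ := by
    intro x
    have h1 : (0 - deriv stp (Real.log (f x) / n) * ((f x)⁻¹ / n * (2 * x 0))) ^ 2 +
      (0 - deriv stp (Real.log (f x) / n) * ((f x)⁻¹ / n * (2 * x 1))) ^ 2 =
      deriv stp (Real.log (f x) / n) ^ 2 * (4 / n ^ 2 * ((f x)⁻¹ * ((f x - 1) * (f x)⁻¹))) := by
      simp only [hf]; ring
    have h2 : deriv stp (Real.log (f x) / n) ^ 2 ≤ D ^ 2 := by
      rw [← sq_abs]; exact pow_le_pow_left₀ (abs_nonneg _) (hDb _) 2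
    have hfx := hf1 x
    have h3 : (f x - 1) * (f x)⁻¹ ≤ 1 := by
      rw [← div_eq_mul_inv, div_le_one (by linarith)]; linarith
    have h30 : 0 ≤ (f x - 1) * (f x)⁻¹ := mul_nonneg (by linarith) (by positivity)
    rw [h1]
    calc _ ≤ D ^ 2 * (4 / n ^ 2 * ((f x)⁻¹ * 1)) := by gcongr
      _ = _ := by ring
  refine ⟨_, _, _, hS, fun x => ?_, fun x => ?_, fun x hx => ?_, ⟨Real.exp (2 * n), fun x hx => ?_⟩,
    fun x => ?_, ?_⟩
  · simpa using stp_le_one _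
  · simpa using stp_nonneg _
  · have : Real.log (f x) / n ≤ 1 := by
      rw [div_le_one hn0, Real.log_le_iff_le_exp (by linarith [hf1 x])]
      have h1 : ‖x‖ ^ 2 ≤ R ^ 2 := pow_le_pow_left₀ (norm_nonneg _) hx 2
      have := Real.add_one_le_exp (n:ℝ)
      rw [hfn]; linarith
    rw [stp_zero this, sub_zero]
  · have hx' : Real.exp (2 * n) < ‖x‖ := by simpa using hx
    have : 2 ≤ Real.log (f x) / n := by
      rw [le_div_iff₀ hn0, Real.le_log_iff_exp_le (by linarith [hf1 x]), hfn]
      nlinarith [Real.exp_pos (2 * n : ℝ), sq_nonneg (‖x‖ - 1)]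
    rw [stp_one this, stp_deriv_zero' this]; simp
  · refine (hgr x).trans ?_
    have : (f x)⁻¹ ≤ 1 := inv_le_one_of_one_le₀ (hf1 x)
    have h2 : 4 * D ^ 2 / n ^ 2 ≤ 1 := by
      rw [div_le_one (by positivity)]
      nlinarith [sq_nonneg R]
    have h3 := mul_le_mul h2 this (inv_nonneg.mpr (by linarith [hf1 x])) zero_le_one
    rwa [mul_one] at h3
  · set bd : Pl → ℝ := fun x => ∑ k ∈ Finset.range (2 * n + 1),
      (closedBall (0:Pl) (Real.exp ((k + 1) / 2))).indicator
        (fun _ => 4 * D ^ 2 / n ^ 2 * Real.exp (-k)) x with hbd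
    have hbi : Integrable bd := integrable_finset_sum _ fun k _ =>
      (ind_integral (by positivity) (Real.exp_pos _).le).1
    have hbI : ∫ x, bd x ≤ ε := by
      rw [hbd, integral_finset_sum _ fun k _ =>
        (ind_integral (by positivity) (Real.exp_pos _).le).1]
      have : ∀ k ∈ Finset.range (2 * n + 1), ∫ x, (closedBall (0:Pl) (Real.exp ((k + 1) / 2))).indicator
        (fun _ => 4 * D ^ 2 / n ^ 2 * Real.exp (-k)) x = 4 * D ^ 2 / n ^ 2 * (Real.pi * Real.exp 1) := by
        intro k _
        rw [(ind_integral (by positivity) (Real.exp_pos _).le).2, ← Real.exp_nat_mul]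
        have : Real.exp 1 = Real.exp ((2:ℕ) * (((k:ℝ) + 1) / 2)) * Real.exp (-k) := by
          rw [← Real.exp_add]; congr 1; push_cast; ring
        rw [this]; ring
      rw [Finset.sum_congr rfl this, Finset.sum_const, Finset.card_range, nsmul_eq_mul]
      have hpe : 0 < Real.pi * Real.exp 1 := by have := Real.pi_pos; positivity
      calc ((2 * n + 1 : ℕ) : ℝ) * (4 * D ^ 2 / n ^ 2 * (Real.pi * Real.exp 1))
          ≤ (3 * n) * (4 * D ^ 2 / n ^ 2 * (Real.pi * Real.exp 1)) := by
            gcongr; push_cast; linarith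
        _ = C / n := by rw [hC]; field_simp
        _ ≤ ε := by
          rw [div_le_iff₀ hn0]
          have h1 : C / ε < n := by nlinarith [sq_nonneg R]
          rw [div_lt_iff₀ hε] at h1; linarith
    refine (integral_mono_of_nonneg (ae_of_all _ fun x => by positivity) hbi
      (ae_of_all _ fun x => ?_)).trans hbI
    have hnn : ∀ k ∈ Finset.range (2 * n + 1), 0 ≤ (closedBall (0:Pl)
        (Real.exp (((k:ℕ) + 1) / 2))).indicator (fun _ => 4 * D ^ 2 / n ^ 2 * Real.exp (-k)) x :=
      fun k _ => indicator_nonneg (fun _ _ => by positivity) x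
    by_cases hx : 2 ≤ Real.log (f x) / n
    · simp only [stp_deriv_zero' hx]
      simp only [zero_mul, sub_zero]
      refine le_trans (by norm_num) (Finset.sum_nonneg hnn)
    · refine (hgr x).trans ?_
      have hfx := hf1 x
      have hlog := Real.log_nonneg hfx
      rw [not_le, div_lt_iff₀ hn0] at hx
      set k := ⌊Real.log (f x)⌋₊ with hk
      have hk1 : (k:ℝ) ≤ Real.log (f x) := Nat.floor_le hlog
      have hk2 : Real.log (f x) < k + 1 := Nat.lt_floor_add_one _
      have hkn : k ∈ Finset.range (2 * n + 1) := by
        rw [Finset.mem_range]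
        have : (k:ℝ) < 2 * n + 1 := by linarith
        exact_mod_cast this
      refine le_trans ?_ (Finset.single_le_sum hnn hkn)
      have hmem : x ∈ closedBall (0:Pl) (Real.exp ((k + 1) / 2)) := by
        rw [mem_closedBall, dist_zero_right]
        refine le_of_sq_le_sq ?_ (Real.exp_pos _).le
        rw [← Real.exp_nat_mul]
        have h1 : f x < Real.exp (k + 1) := (Real.log_lt_iff_lt_exp (by linarith)).mp hk2
        rw [hfn] at h1
        rw [show ((2:ℕ):ℝ) * (((k:ℝ) + 1) / 2) = k + 1 by push_cast; ring]
        linarith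
      rw [indicator_of_mem hmem]
      gcongr
      rw [Real.exp_neg]
      gcongr
      exact (Real.le_log_iff_exp_le (by linarith)).mp hk1

/-- A nonnegative continuous function with small integral on compact sets vanishes. -/
lemma zero_of_small {Ω : Set Pl} (hΩ : IsOpen Ω) {F : Pl → ℝ} (hF : ContinuousOn F Ω)
    (h0 : ∀ x ∈ Ω, 0 ≤ F x)
    (hs : ∀ R : ℝ, ∀ ε > 0, ∃ q : Pl → ℝ, IntegrableOn q Ω ∧ (∀ x ∈ Ω, 0 ≤ q x) ∧
      (∀ x ∈ Ω, ‖x‖ ≤ R → F x ≤ q x) ∧ ∫ x in Ω, q x ≤ ε) : ∀ x ∈ Ω, F x = 0 := by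
  intro x hx
  by_contra hne
  have hpos : 0 < F x := lt_of_le_of_ne (h0 x hx) (Ne.symm hne)
  have hev : ∀ᶠ y in 𝓝 x, F x / 2 < F y :=
    (hF.continuousAt (hΩ.mem_nhds hx)).eventually_const_lt (by linarith)
  obtain ⟨r, hr, hball⟩ := Metric.eventually_nhds_iff_ball.mp (hev.and (hΩ.mem_nhds hx))
  have hvol : 0 < (volume (ball x r)).toReal :=
    ENNReal.toReal_pos (measure_ball_pos _ _ hr).ne' measure_ball_lt_top.ne
  obtain ⟨q, hqi, hq0, hqF, hqε⟩ := hs (‖x‖ + r) (F x / 4 * (volume (ball x r)).toReal) (by positivity)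
  have hsub : ball x r ⊆ Ω := fun y hy => (hball y hy).2
  have h1 : ∫ y in ball x r, F x / 2 ≤ ∫ y in ball x r, q y := by
    refine setIntegral_mono_on (integrableOn_const measure_ball_lt_top.ne) (hqi.mono_set hsub)
      measurableSet_ball fun y hy => ?_
    refine (hball y hy).1.le.trans (hqF y (hsub hy) ?_)
    have : ‖y - x‖ < r := by simpa [dist_eq_norm] using hy
    have := norm_add_le x (y - x)
    rw [add_sub_cancel] at this; linarith
  have h2 : ∫ y in ball x r, q y ≤ ∫ y in Ω, q y := by
    refine setIntegral_mono_set hqi ?_ (Eventually.of_forall hsub)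
    filter_upwards [ae_restrict_mem hΩ.measurableSet] with y hy using hq0 y hy
  rw [setIntegral_const, smul_eq_mul, Measure.real] at h1
  nlinarith

/-- Boundedness from continuity on the closure and compact support. -/
lemma bdd_of_cont {Ω : Set Pl} {ρ : ℝ} {q : Pl → ℝ} (hq : ContinuousOn q (closure Ω))
    (hz : ∀ x ∈ Ω, x ∉ closedBall (0:Pl) ρ → q x = 0) : ∃ M, ∀ x ∈ Ω, |q x| ≤ M := by
  have hK : IsCompact (closure Ω ∩ closedBall (0:Pl) ρ) :=
    (isCompact_closedBall _ _).inter_left isClosed_closure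
  obtain ⟨M, hM⟩ := hK.exists_bound_of_continuousOn (hq.mono inter_subset_left)
  refine ⟨|M|, fun x hx => ?_⟩
  by_cases hb : x ∈ closedBall (0:Pl) ρ
  · exact (hM x ⟨subset_closure hx, hb⟩).trans (le_abs_self M)
  · rw [hz x hx hb, abs_zero]; positivity


/-! ### Cutoff argument -/

/-- A cutoff function supported in a ball. -/
structure Cut (φ φ1 φ2 : Pl → ℝ) (ρ : ℝ) : Prop where
  c : C1 univ φ φ1 φ2
  nn : ∀ x, 0 ≤ φ x
  le1 : ∀ x, φ x ≤ 1
  z : ∀ x, x ∉ closedBall (0:Pl) ρ → φ x = 0 ∧ φ1 x = 0 ∧ φ2 x = 0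
  gb : ∀ x, φ1 x ^ 2 + φ2 x ^ 2 ≤ 1

lemma Cut.cc {φ φ1 φ2 : Pl → ℝ} {ρ : ℝ} (h : Cut φ φ1 φ2 ρ) : Continuous φ :=
  continuousOn_univ.mp h.c.cont
lemma Cut.cc1 {φ φ1 φ2 : Pl → ℝ} {ρ : ℝ} (h : Cut φ φ1 φ2 ρ) : Continuous φ1 :=
  continuousOn_univ.mp h.c.c1
lemma Cut.cc2 {φ φ1 φ2 : Pl → ℝ} {ρ : ℝ} (h : Cut φ φ1 φ2 ρ) : Continuous φ2 :=
  continuousOn_univ.mp h.c.c2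

lemma Cut.int {φ φ1 φ2 : Pl → ℝ} {ρ : ℝ} (h : Cut φ φ1 φ2 ρ) :
    Integrable fun x => φ1 x ^ 2 + φ2 x ^ 2 := by
  have hc : Continuous fun x => φ1 x ^ 2 + φ2 x ^ 2 := (h.cc1.pow 2).add (h.cc2.pow 2)
  refine hc.integrable_of_hasCompactSupport ?_
  refine HasCompactSupport.intro (isCompact_closedBall (0:Pl) ρ) fun x hx => ?_
  rw [(h.z x hx).2.1, (h.z x hx).2.2]; norm_num

lemma Cut.intF {Ω : Set Pl} (hΩ : IsOpen Ω) {φ φ1 φ2 : Pl → ℝ} {ρ : ℝ} (h : Cut φ φ1 φ2 ρ) {m : ℕ}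
    (hm : m ≠ 0) {F : Pl → ℝ} (hF : ContinuousOn F (closure Ω)) :
    IntegrableOn (fun x => φ x ^ m * F x) Ω := by
  have hc : ContinuousOn (fun x => φ x ^ m * F x) (closure Ω) :=
    (h.cc.pow m).continuousOn.mul hF
  have hz : ∀ x ∈ Ω, x ∉ closedBall (0:Pl) ρ → φ x ^ m * F x = 0 := fun x _ hx => by
    rw [(h.z x hx).1, zero_pow hm, zero_mul]
  exact integrableOn_of_bdd hΩ (isCompact_closedBall _ _) (hc.mono subset_closure)
    (bdd_of_cont hc hz) hz

lemma cut_zero {Ω : Set Pl} (hΩ : IsOpen Ω) {m : ℕ} (hm : m ≠ 0) {F : Pl → ℝ}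
    (hF : ContinuousOn F (closure Ω)) (h0 : ∀ x ∈ Ω, 0 ≤ F x) {C : ℝ} (hC : 0 ≤ C)
    (key : ∀ φ φ1 φ2 ρ, Cut φ φ1 φ2 ρ → ∀ ε > 0,
      ∫ x in Ω, φ x ^ m * F x ≤ C * (∫ x in Ω, (φ1 x ^ 2 + φ2 x ^ 2)) + ε) :
    ∀ x ∈ Ω, F x = 0 := by
  refine zero_of_small hΩ (hF.mono subset_closure) h0 fun R ε hε => ?_
  obtain ⟨φ, φ1, φ2, hc, hn, hl, hR, ⟨ρ, hρ⟩, hg, hI⟩ :=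
    exists_logcut R (ε := ε / 2 / (C + 1)) (by positivity)
  have hcut : Cut φ φ1 φ2 ρ := ⟨hc, hn, hl, hρ, hg⟩
  refine ⟨fun x => φ x ^ m * F x, hcut.intF hΩ hm hF,
    fun x hx => mul_nonneg (pow_nonneg (hn x) m) (h0 x hx), fun x _ hxR => ?_, ?_⟩
  · change F x ≤ φ x ^ m * F x
    rw [hR x hxR, one_pow, one_mul]
  refine (key φ φ1 φ2 ρ hcut (ε / 2) (by positivity)).trans ?_
  have h1 : ∫ x in Ω, (φ1 x ^ 2 + φ2 x ^ 2) ≤ ε / 2 / (C + 1) :=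
    (setIntegral_le_integral hcut.int (ae_of_all _ fun x => by positivity)).trans hI
  have h2 : C * ∫ x in Ω, (φ1 x ^ 2 + φ2 x ^ 2) ≤ C * (ε / 2 / (C + 1)) :=
    mul_le_mul_of_nonneg_left h1 hC
  have h3 : C * (ε / 2 / (C + 1)) ≤ ε / 2 := by
    rw [mul_div_assoc', div_le_iff₀ (by positivity)]; nlinarith
  linarith

/-- Cutoff argument through the Gauss-Green inequality. -/
lemma gg_cut {Ω : Set Pl} {η : Pl → Pl} (hΩ : IsCkDomainWithNormal 2 Ω η) {m : ℕ} (hm : m ≠ 0)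
    {F : Pl → ℝ} (hF : ContinuousOn F (closure Ω)) (h0 : ∀ x ∈ Ω, 0 ≤ F x) {C : ℝ} (hC : 0 ≤ C)
    (key : ∀ φ φ1 φ2 ρ, Cut φ φ1 φ2 ρ → ∃ Y1 Y2 f : Pl → ℝ, WD Ω Y1 Y2 f ∧
      ContinuousOn Y1 (closure Ω) ∧ ContinuousOn Y2 (closure Ω) ∧
      (∀ x, φ x = 0 → Y1 x = 0 ∧ Y2 x = 0) ∧
      (∀ x ∈ frontier Ω, Y1 x * η x 0 + Y2 x * η x 1 = 0) ∧
      ∀ x ∈ Ω, φ x ^ m * F x - C * (φ1 x ^ 2 + φ2 x ^ 2) ≤ f x) : ∀ x ∈ Ω, F x = 0 := by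
  have ho := hΩ.2.1
  refine cut_zero ho hm hF h0 hC fun φ φ1 φ2 ρ hcut ε hε => ?_
  obtain ⟨Y1, Y2, f, hwd, hy1, hy2, hz, hn, hq⟩ := key φ φ1 φ2 ρ hcut
  have hqc : ContinuousOn (fun x => φ x ^ m * F x - C * (φ1 x ^ 2 + φ2 x ^ 2)) (closure Ω) :=
    ((hcut.cc.pow m).continuousOn.mul hF).sub
      (continuous_const.mul ((hcut.cc1.pow 2).add (hcut.cc2.pow 2))).continuousOn
  have hqz : ∀ x ∈ Ω, x ∉ closedBall (0:Pl) ρ →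
      φ x ^ m * F x - C * (φ1 x ^ 2 + φ2 x ^ 2) = 0 := fun x _ hx => by
    rw [(hcut.z x hx).1, (hcut.z x hx).2.1, (hcut.z x hx).2.2, zero_pow hm]; ring
  have := gauss_green hΩ (isCompact_closedBall (0:Pl) ρ) (Y1 := Y1) (Y2 := Y2) (f := f)
    { wd := hwd, y1 := hy1, y2 := hy2
      z1 := fun x _ hx => (hz x (hcut.z x hx).1).1
      z2 := fun x _ hx => (hz x (hcut.z x hx).1).2
      yn := hn
      qc := hqc.mono subset_closure
      qb := bdd_of_cont hqc hqz
      qz := hqz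
      qf := hq }
  rw [integral_sub (hcut.intF ho hm hF) ((hcut.int.integrableOn).const_mul C),
    integral_const_mul] at this
  linarith

/-! ### The capillary data -/

/-- The inverse area element. -/
def Nf (p1 p2 : Pl → ℝ) (x : Pl) : ℝ := (√(1 + p1 x ^ 2 + p2 x ^ 2))⁻¹

/-- First component of `A(p)` applied to `(a, b)`. -/
def A1 (p1 p2 a b : Pl → ℝ) (x : Pl) : ℝ :=
  Nf p1 p2 x ^ 3 * (a x * (1 + p2 x ^ 2) - p1 x * p2 x * b x)

/-- Second component of `A(p)` applied to `(a, b)`. -/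
def A2 (p1 p2 a b : Pl → ℝ) (x : Pl) : ℝ :=
  Nf p1 p2 x ^ 3 * (b x * (1 + p1 x ^ 2) - p1 x * p2 x * a x)

section
variable {p1 p2 : Pl → ℝ}

lemma Nf_pos (x : Pl) : 0 < Nf p1 p2 x := by unfold Nf; positivity

lemma Nf_sq (x : Pl) : Nf p1 p2 x ^ 2 * (1 + p1 x ^ 2 + p2 x ^ 2) = 1 := by
  unfold Nf
  rw [inv_pow, Real.sq_sqrt (by positivity)]
  exact inv_mul_cancel₀ (by positivity)

lemma Nf_le_one (x : Pl) : Nf p1 p2 x ≤ 1 := by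
  have h := Nf_sq (p1 := p1) (p2 := p2) x
  have h0 := Nf_pos (p1 := p1) (p2 := p2) x
  nlinarith [sq_nonneg (p1 x), sq_nonneg (p2 x), mul_nonneg (sq_nonneg (Nf p1 p2 x)) (sq_nonneg (p1 x)),
    mul_nonneg (sq_nonneg (Nf p1 p2 x)) (sq_nonneg (p2 x))]

lemma Nf_cont {s : Set Pl} (h1 : ContinuousOn p1 s) (h2 : ContinuousOn p2 s) :
    ContinuousOn (Nf p1 p2) s := by
  unfold Nf
  refine ContinuousOn.inv₀ ?_ fun x _ => by positivity
  exact ((continuousOn_const.add (h1.pow 2)).add (h2.pow 2)).sqrt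

lemma A1_cont {s : Set Pl} {a b : Pl → ℝ} (h1 : ContinuousOn p1 s) (h2 : ContinuousOn p2 s)
    (ha : ContinuousOn a s) (hb : ContinuousOn b s) : ContinuousOn (A1 p1 p2 a b) s := by
  unfold A1
  have := Nf_cont h1 h2
  fun_prop

lemma A2_cont {s : Set Pl} {a b : Pl → ℝ} (h1 : ContinuousOn p1 s) (h2 : ContinuousOn p2 s)
    (ha : ContinuousOn a s) (hb : ContinuousOn b s) : ContinuousOn (A2 p1 p2 a b) s := by
  unfold A2
  have := Nf_cont h1 h2
  fun_prop

/-- Positivity of `A` with cross terms. -/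
lemma A_form (x : Pl) (a b : ℝ) :
    0 ≤ Nf p1 p2 x ^ 3 * ((a * (1 + p2 x ^ 2) - p1 x * p2 x * b) * a +
      (b * (1 + p1 x ^ 2) - p1 x * p2 x * a) * b) := by
  have h0 := Nf_pos (p1 := p1) (p2 := p2) x
  have : (a * (1 + p2 x ^ 2) - p1 x * p2 x * b) * a +
      (b * (1 + p1 x ^ 2) - p1 x * p2 x * a) * b = a ^ 2 + b ^ 2 + (a * p2 x - b * p1 x) ^ 2 := by ring
  rw [this]; positivity

lemma A_form_le (x : Pl) (a b : ℝ) :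
    Nf p1 p2 x ^ 3 * ((a * (1 + p2 x ^ 2) - p1 x * p2 x * b) * a +
      (b * (1 + p1 x ^ 2) - p1 x * p2 x * a) * b) ≤ a ^ 2 + b ^ 2 := by
  have h0 := Nf_pos (p1 := p1) (p2 := p2) x
  have h1 := Nf_le_one (p1 := p1) (p2 := p2) x
  have h2 := Nf_sq (p1 := p1) (p2 := p2) x
  set N := Nf p1 p2 x
  have e : (a * (1 + p2 x ^ 2) - p1 x * p2 x * b) * a +
      (b * (1 + p1 x ^ 2) - p1 x * p2 x * a) * b = a ^ 2 + b ^ 2 + (a * p2 x - b * p1 x) ^ 2 := by ring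
  have h3 : a ^ 2 + b ^ 2 + (a * p2 x - b * p1 x) ^ 2 ≤ (a ^ 2 + b ^ 2) * (1 + p1 x ^ 2 + p2 x ^ 2) := by
    nlinarith [sq_nonneg (a * p1 x + b * p2 x)]
  rw [e]
  calc N ^ 3 * (a ^ 2 + b ^ 2 + (a * p2 x - b * p1 x) ^ 2)
      ≤ N ^ 3 * ((a ^ 2 + b ^ 2) * (1 + p1 x ^ 2 + p2 x ^ 2)) := by gcongr
    _ = N * (a ^ 2 + b ^ 2) * (N ^ 2 * (1 + p1 x ^ 2 + p2 x ^ 2)) := by ring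
    _ = N * (a ^ 2 + b ^ 2) := by rw [h2, mul_one]
    _ ≤ 1 * (a ^ 2 + b ^ 2) := by gcongr
    _ = _ := one_mul _

lemma A_form_zero (x : Pl) (a b : ℝ)
    (h : Nf p1 p2 x ^ 3 * ((a * (1 + p2 x ^ 2) - p1 x * p2 x * b) * a +
      (b * (1 + p1 x ^ 2) - p1 x * p2 x * a) * b) = 0) : a = 0 ∧ b = 0 := by
  have h0 := Nf_pos (p1 := p1) (p2 := p2) x
  have e : (a * (1 + p2 x ^ 2) - p1 x * p2 x * b) * a +
      (b * (1 + p1 x ^ 2) - p1 x * p2 x * a) * b = a ^ 2 + b ^ 2 + (a * p2 x - b * p1 x) ^ 2 := by ring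
  rw [e] at h
  rcases mul_eq_zero.mp h with h | h
  · exact absurd h (by positivity)
  · constructor <;> nlinarith [sq_nonneg a, sq_nonneg b, sq_nonneg (a * p2 x - b * p1 x)]

lemma C1.Nf {Ω : Set Pl} {a b c d : Pl → ℝ} (h1 : C1 Ω p1 a b) (h2 : C1 Ω p2 c d) :
    C1 Ω (Nf p1 p2) (fun x => -(Nf p1 p2 x ^ 3 * (p1 x * a x + p2 x * c x)))
      (fun x => -(Nf p1 p2 x ^ 3 * (p1 x * b x + p2 x * d x))) := by
  have hq := ((C1.const (Ω := Ω) 1).add (h1.mul h1)).add (h2.mul h2)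
  have hs := hq.comp (s := Ioi 0) (φ := fun y => (√y)⁻¹)
    (φ' := fun y => -((√y)⁻¹ ^ 3 / 2)) (fun y hy => by
      have hy' : (0:ℝ) < y := hy
      have := (Real.hasDerivAt_sqrt hy'.ne').inv (Real.sqrt_pos.mpr hy').ne'
      refine this.congr_deriv ?_
      have h1 : √y ≠ 0 := (Real.sqrt_pos.mpr hy').ne'
      field_simp)
    (by
      refine ContinuousOn.neg (ContinuousOn.div_const (ContinuousOn.pow (ContinuousOn.inv₀
        Real.continuous_sqrt.continuousOn fun y hy => (Real.sqrt_pos.mpr hy).ne') 3) 2))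
    (fun x _ => by
      have := mul_self_nonneg (p1 x)
      have := mul_self_nonneg (p2 x)
      change (0:ℝ) < 1 + p1 x * p1 x + p2 x * p2 x
      linarith)
  have e : (fun x => (√(1 + p1 x * p1 x + p2 x * p2 x))⁻¹) = _root_.Nf p1 p2 := by
    funext x; unfold _root_.Nf; rw [sq, sq]
  have e' : ∀ x, (√(1 + p1 x * p1 x + p2 x * p2 x))⁻¹ = _root_.Nf p1 p2 x := fun x => congrFun e x
  rw [e] at hs
  refine hs.congr_der (fun x _ => ?_) (fun x _ => ?_) <;> · rw [e']; ring

end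

/-- All the coordinate information about the capillary problem. -/
structure Cap (Ω : Set Pl) (η : Pl → Pl) (u p1 p2 r s t : Pl → ℝ) (H cst b : ℝ) (S : Set Pl) :
    Prop where
  dom : IsCkDomainWithNormal 2 Ω η
  cu : ContinuousOn u (closure Ω)
  cp1 : ContinuousOn p1 (closure Ω)
  cp2 : ContinuousOn p2 (closure Ω)
  cr : ContinuousOn r (closure Ω)
  cs : ContinuousOn s (closure Ω)
  ct : ContinuousOn t (closure Ω)
  du : C1 Ω u p1 p2
  dp1 : C1 Ω p1 r s
  dp2 : C1 Ω p2 s t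
  eq : ∀ x ∈ Ω, A1 p1 p2 r s x + A2 p1 p2 s t x = -H
  star : ∀ x ∈ S, u x = cst ∧ p1 x = b * η x 0 ∧ p2 x = b * η x 1
  nstar : ∀ x ∈ frontier Ω, x ∉ S → p1 x = 0 ∧ p2 x = 0
  tan : ∀ x ∈ frontier Ω, (r x * p1 x + s x * p2 x) * η x 1 = (s x * p1 x + t x * p2 x) * η x 0
  hη : ∀ x ∈ frontier Ω, η x 0 ^ 2 + η x 1 ^ 2 = 1
  hb : b ≠ 0
  Ssub : S ⊆ frontier Ω
  nS : ∃ x ∈ frontier Ω, x ∉ S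

namespace Cap
variable {Ω : Set Pl} {η : Pl → Pl} {u p1 p2 r s t : Pl → ℝ} {H cst b : ℝ} {S : Set Pl}

lemma op (h : Cap Ω η u p1 p2 r s t H cst b S) : IsOpen Ω := h.dom.2.1

lemma dV1 (h : Cap Ω η u p1 p2 r s t H cst b S) :
    C1 Ω (fun x => Nf p1 p2 x * p1 x) (A1 p1 p2 r s) (A1 p1 p2 s t) := by
  refine ((C1.Nf h.dp1 h.dp2).mul h.dp1).congr_der (fun x _ => ?_) (fun x _ => ?_)
  · unfold A1
    linear_combination (-(Nf p1 p2 x) * r x) * Nf_sq (p1 := p1) (p2 := p2) x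
  · unfold A1
    linear_combination (-(Nf p1 p2 x) * s x) * Nf_sq (p1 := p1) (p2 := p2) x

lemma dV2 (h : Cap Ω η u p1 p2 r s t H cst b S) :
    C1 Ω (fun x => Nf p1 p2 x * p2 x) (A2 p1 p2 r s) (A2 p1 p2 s t) := by
  refine ((C1.Nf h.dp1 h.dp2).mul h.dp2).congr_der (fun x _ => ?_) (fun x _ => ?_)
  · unfold A2
    linear_combination (-(Nf p1 p2 x) * s x) * Nf_sq (p1 := p1) (p2 := p2) x
  · unfold A2
    linear_combination (-(Nf p1 p2 x) * t x) * Nf_sq (p1 := p1) (p2 := p2) x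

lemma wdV (h : Cap Ω η u p1 p2 r s t H cst b S) :
    WD Ω (fun x => Nf p1 p2 x * p1 x) (fun x => Nf p1 p2 x * p2 x) (fun _ => -H) :=
  (WD.of_C1 h.op h.dV1 h.dV2).congr (fun _ _ => rfl) (fun _ _ => rfl) (fun x hx => h.eq x hx)

lemma wdD (h : Cap Ω η u p1 p2 r s t H cst b S) (d : Pl) :
    WD Ω (fun x => A1 p1 p2 r s x * d 0 + A1 p1 p2 s t x * d 1)
      (fun x => A2 p1 p2 r s x * d 0 + A2 p1 p2 s t x * d 1) (fun _ => 0) :=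
  WD.deriv_field h.op h.dV1 h.dV2 _ h.eq d

lemma neg (h : Cap Ω η u p1 p2 r s t H cst b S) :
    Cap Ω η (fun x => -u x) (fun x => -p1 x) (fun x => -p2 x) (fun x => -r x) (fun x => -s x)
      (fun x => -t x) (-H) (-cst) (-b) S where
  dom := h.dom
  cu := h.cu.neg
  cp1 := h.cp1.neg
  cp2 := h.cp2.neg
  cr := h.cr.neg
  cs := h.cs.neg
  ct := h.ct.neg
  du := h.du.neg
  dp1 := h.dp1.neg
  dp2 := h.dp2.neg
  eq x hx := by
    have e := h.eq x hx
    unfold A1 A2 at *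
    have : Nf (fun x => -p1 x) (fun x => -p2 x) x = Nf p1 p2 x := by unfold Nf; simp only [neg_sq]
    rw [this]; linear_combination -e
  star x hx := by obtain ⟨a, b, c⟩ := h.star x hx; rw [a, b, c]; exact ⟨rfl, by ring, by ring⟩
  nstar x hx hs := by obtain ⟨a, b⟩ := h.nstar x hx hs; rw [a, b]; simp
  tan x hx := by linear_combination h.tan x hx
  hη := h.hη
  hb := neg_ne_zero.mpr h.hb
  Ssub := h.Ssub
  nS := h.nS

/-- Step 1: one sided bound. -/
lemma le_of_neg (h : Cap Ω η u p1 p2 r s t H cst b S) (hH : H < 0) : ∀ x ∈ Ω, u x ≤ cst := by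
  set k := -H with hk
  have hk0 : 0 < k := by rw [hk]; linarith
  have hT : C1 Ω (fun x => stp (u x - cst + 1)) (fun x => deriv stp (u x - cst + 1) * p1 x)
      (fun x => deriv stp (u x - cst + 1) * p2 x) :=
    (((h.du.sub (C1.const cst)).add (C1.const 1)).comp (s := univ) (φ := stp) (φ' := deriv stp)
      (fun y _ => stp_deriv y) stp_deriv_cont.continuousOn (fun _ _ => mem_univ _)).congr_der
      (fun x _ => by ring) (fun x _ => by ring)
  have hTc : ContinuousOn (fun x => stp (u x - cst + 1)) (closure Ω) :=
    stp_contDiff.continuous.comp_continuousOn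
      ((h.cu.sub continuousOn_const).add continuousOn_const)
  have hNc := Nf_cont h.cp1 h.cp2
  have key := gg_cut h.dom (m := 3) (by norm_num) (F := fun x => k / 2 * stp (u x - cst + 1))
    (continuousOn_const.mul hTc) (fun x _ => mul_nonneg (by positivity) (stp_nonneg _))
    (C := 9 / (2 * k)) (by positivity) (by
    intro φ φ1 φ2 ρ hcut
    have hφ := hcut.c.mono (subset_univ Ω)
    have hg := ((hφ.mul hφ).mul hφ).mul hT
    refine ⟨_, _, _, h.wdV.smul h.op hg, ?_, ?_, ?_, ?_, ?_⟩
    · have := hcut.cc.continuousOn (s := closure Ω)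
      have := h.cp1
      fun_prop
    · have := hcut.cc.continuousOn (s := closure Ω)
      have := h.cp2
      fun_prop
    · intro x hx
      simp only [hx]; constructor <;> ring
    · intro x hx
      by_cases hxS : x ∈ S
      · rw [(h.star x hxS).1, sub_self, stp_zero (by norm_num)]; ring
      · rw [(h.nstar x hx hxS).1, (h.nstar x hx hxS).2]; ring
    · intro x hx
      have hN := Nf_sq (p1 := p1) (p2 := p2) x
      have hN0 := Nf_pos (p1 := p1) (p2 := p2) x
      have hφ0 := hcut.nn x
      have hφ1 := hcut.le1 x
      have hT0 := stp_nonneg (u x - cst + 1)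
      have hT1 := stp_le_one (u x - cst + 1)
      have hT' := stp_deriv_nonneg (u x - cst + 1)
      set N := Nf p1 p2 x
      set T := stp (u x - cst + 1)
      set T' := deriv stp (u x - cst + 1)
      set P := N * (p1 x * φ1 x + p2 x * φ2 x) with hP
      have hPb : P ^ 2 ≤ φ1 x ^ 2 + φ2 x ^ 2 := by
        have h1 : N ^ 2 * (p1 x ^ 2 + p2 x ^ 2) ≤ 1 := by nlinarith [sq_nonneg N]
        have h2 : (p1 x * φ1 x + p2 x * φ2 x) ^ 2 ≤
            (p1 x ^ 2 + p2 x ^ 2) * (φ1 x ^ 2 + φ2 x ^ 2) := by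
          nlinarith [sq_nonneg (p1 x * φ2 x - p2 x * φ1 x)]
        calc P ^ 2 = N ^ 2 * (p1 x * φ1 x + p2 x * φ2 x) ^ 2 := by rw [hP]; ring
          _ ≤ N ^ 2 * ((p1 x ^ 2 + p2 x ^ 2) * (φ1 x ^ 2 + φ2 x ^ 2)) := by gcongr
          _ = (N ^ 2 * (p1 x ^ 2 + p2 x ^ 2)) * (φ1 x ^ 2 + φ2 x ^ 2) := by ring
          _ ≤ 1 * (φ1 x ^ 2 + φ2 x ^ 2) := by gcongr
          _ = _ := one_mul _
      have e1 : 0 ≤ φ x ^ 3 * T' * N * (p1 x ^ 2 + p2 x ^ 2) := by positivity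
      have e2 : 0 ≤ T * (φ x / (2 * k) * (k * φ x + 3 * P) ^ 2) := by positivity
      have e3 : T * (φ x / (2 * k) * (k * φ x + 3 * P) ^ 2) =
        T * (k / 2 * φ x ^ 3 + 3 * φ x ^ 2 * P) + 9 / (2 * k) * (T * φ x * P ^ 2) := by
        field_simp; ring
      have e4 : T * φ x * P ^ 2 ≤ 1 * (φ1 x ^ 2 + φ2 x ^ 2) := by
        refine mul_le_mul ?_ hPb (sq_nonneg _) zero_le_one
        exact mul_le_one₀ hT1 hφ0 hφ1
      have e5 : 9 / (2 * k) * (T * φ x * P ^ 2) ≤ 9 / (2 * k) * (1 * (φ1 x ^ 2 + φ2 x ^ 2)) := by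
        gcongr
      have e6 : φ x * φ x * φ x * T * k + (N * p1 x * (((φ1 x * φ x + φ x * φ1 x) * φ x +
          φ x * φ x * φ1 x) * T + φ x * φ x * φ x * (T' * p1 x)) + N * p2 x *
          (((φ2 x * φ x + φ x * φ2 x) * φ x + φ x * φ x * φ2 x) * T +
          φ x * φ x * φ x * (T' * p2 x))) = k * φ x ^ 3 * T + 3 * φ x ^ 2 * T * P +
          φ x ^ 3 * T' * N * (p1 x ^ 2 + p2 x ^ 2) := by rw [hP]; ring
      rw [e6]
      nlinarith)
  intro x hx
  have h1 := key x hx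
  by_contra hlt
  have : 0 < stp (u x - cst + 1) := Real.smoothTransition.pos_of_pos (by linarith)
  have : 0 < k / 2 * stp (u x - cst + 1) := by positivity
  linarith

end Cap


/-! ### Gradient bound -/

/-- Square of the positive part. -/
def psq (y : ℝ) : ℝ := (max y 0) ^ 2

lemma psq_deriv (y : ℝ) : HasDerivAt psq (2 * max y 0) y := by
  rcases lt_trichotomy y 0 with hy | hy | hy
  · have : psq =ᶠ[𝓝 y] fun _ => 0 := by
      filter_upwards [Iio_mem_nhds hy] with z hz
      unfold psq; rw [max_eq_right (le_of_lt hz)]; norm_num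
    rw [max_eq_right hy.le, mul_zero]
    exact (hasDerivAt_const y (0:ℝ)).congr_of_eventuallyEq this
  · subst hy
    rw [max_self, mul_zero, hasDerivAt_iff_isLittleO_nhds_zero]
    have h1 : (fun h : ℝ => psq (0 + h) - psq 0 - h • (0:ℝ)) =O[𝓝 0] fun h : ℝ => h ^ 2 := by
      refine Asymptotics.isBigO_of_le _ fun h => ?_
      unfold psq
      simp only [zero_add, max_self, smul_zero, sub_zero]
      rw [zero_pow two_ne_zero, sub_zero, norm_pow, norm_pow]
      refine pow_le_pow_left₀ (norm_nonneg _) ?_ 2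
      rw [Real.norm_eq_abs, Real.norm_eq_abs]
      rcases le_total h 0 with hh | hh
      · rw [max_eq_right hh]; simp
      · rw [max_eq_left hh]
    refine h1.trans_isLittleO ?_
    exact Asymptotics.isLittleO_pow_id (by norm_num)
  · have : psq =ᶠ[𝓝 y] fun z => z ^ 2 := by
      filter_upwards [Ioi_mem_nhds hy] with z hz
      unfold psq; rw [max_eq_left (le_of_lt hz)]
    rw [max_eq_left hy.le]
    have h2 := (hasDerivAt_pow 2 y).congr_of_eventuallyEq this
    simpa using h2

lemma psq_cont' : Continuous fun y : ℝ => 2 * max y 0 := by fun_prop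

lemma C1.congr_on {Ω : Set Pl} {f f1 f2 g g1 g2 : Pl → ℝ} (hΩ : IsOpen Ω) (hf : C1 Ω f f1 f2)
    (h : ∀ x ∈ Ω, f x = g x) (h1 : ∀ x ∈ Ω, f1 x = g1 x) (h2 : ∀ x ∈ Ω, f2 x = g2 x) :
    C1 Ω g g1 g2 where
  der x hx := by
    rw [← h1 x hx, ← h2 x hx]
    refine (hf.der x hx).congr_of_eventuallyEq ?_
    filter_upwards [hΩ.mem_nhds hx] with y hy using (h y hy).symm
  c1 := hf.c1.congr fun x hx => (h1 x hx).symm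
  c2 := hf.c2.congr fun x hx => (h2 x hx).symm

lemma trace_nonneg {p q r s t : ℝ} : 0 ≤ (r * (1 + q ^ 2) - p * q * s) ^ 2 +
    2 * ((s * (1 + q ^ 2) - p * q * t) * (s * (1 + p ^ 2) - p * q * r)) +
    (t * (1 + p ^ 2) - p * q * s) ^ 2 := by
  set a := 1 + q ^ 2 with ha
  have ha0 : 0 < a := by positivity
  have key : a ^ 2 * ((r * (1 + q ^ 2) - p * q * s) ^ 2 +
    2 * ((s * (1 + q ^ 2) - p * q * t) * (s * (1 + p ^ 2) - p * q * r)) +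
    (t * (1 + p ^ 2) - p * q * s) ^ 2) = (a ^ 2 * r - 2 * a * (p * q) * s + (p * q) ^ 2 * t) ^ 2 +
    2 * (1 + p ^ 2 + q ^ 2) * (a * s - p * q * t) ^ 2 + ((1 + p ^ 2 + q ^ 2) * t) ^ 2 := by
    rw [ha]; ring
  have h2 : 0 ≤ (a ^ 2 * r - 2 * a * (p * q) * s + (p * q) ^ 2 * t) ^ 2 +
    2 * (1 + p ^ 2 + q ^ 2) * (a * s - p * q * t) ^ 2 + ((1 + p ^ 2 + q ^ 2) * t) ^ 2 := by positivity
  rw [← key] at h2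
  exact nonneg_of_mul_nonneg_right h2 (by positivity)

lemma qpos_real {N p q R x0 x1 E ε C H b tr : ℝ} (hN : N ^ 2 * (1 + p ^ 2 + q ^ 2) = 1)
    (hN0 : 0 < N) (htr : 0 ≤ tr) (hζ : 0 < E - ε * (R ^ 2 + x0 ^ 2 + x1 ^ 2))
    (hNb : N ^ 2 * (1 + b ^ 2) < 1) (hE0 : 0 < E) (hC : 0 < C) (hR1 : 1 ≤ R)
    (hR : (4 + H) < C ^ 2 * (b ^ 2 / (1 + b ^ 2)) * R) (hε : 0 < ε) (hH : 0 ≤ H) :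
    0 < (E - ε * (R ^ 2 + x0 ^ 2 + x1 ^ 2)) * tr +
      E * (C ^ 2 * (N ^ 2 * (p ^ 2 + q ^ 2)) + C * H * N) -
      ε * (4 - 2 * (N ^ 2 * (p ^ 2 + q ^ 2)) + 2 * H * (N * (p * x0 + q * x1))) := by
  have hP1 : N ^ 2 * (p ^ 2 + q ^ 2) = 1 - N ^ 2 := by linarith
  rw [hP1]
  obtain ⟨P, hP⟩ : ∃ P, P = 1 - N ^ 2 := ⟨_, rfl⟩
  have hPb : b ^ 2 / (1 + b ^ 2) < P := by
    rw [div_lt_iff₀ (by positivity), hP]; linarith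
  have hP0 : 0 ≤ P := le_trans (by positivity) hPb.le
  have hPle : P ≤ 1 := by rw [hP]; linarith [sq_nonneg N]
  have g1 := mul_nonneg hζ.le htr
  have g2 : 0 ≤ E * (C * H * N) := by positivity
  have hR0 : 0 < R := by linarith
  have g3 : 2 * (N * (p * x0 + q * x1)) * R ≤ R ^ 2 + x0 ^ 2 + x1 ^ 2 := by
    have a1 := sq_nonneg (R * N * p - x0)
    have a2 := sq_nonneg (R * N * q - x1)
    have a3 : R ^ 2 * (1 - N ^ 2) ≤ R ^ 2 * 1 :=
      mul_le_mul_of_nonneg_left (hP ▸ hPle) (sq_nonneg R)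
    rw [← hP1] at a3
    linarith
  have a2 : R ≤ R ^ 2 + x0 ^ 2 + x1 ^ 2 := by
    have : R * 1 ≤ R * R := mul_le_mul_of_nonneg_left hR1 hR0.le
    linarith [sq_nonneg x0, sq_nonneg x1]
  rw [← hP]
  generalize N * (p * x0 + q * x1) = Q at *
  generalize R ^ 2 + x0 ^ 2 + x1 ^ 2 = ρ at *
  have g4 : (4 - 2 * P + 2 * H * Q) * R ≤ (4 + H) * ρ := by
    have a1 : H * (2 * Q * R) ≤ H * ρ := mul_le_mul_of_nonneg_left g3 hH
    have a3 : 0 ≤ P * R := mul_nonneg hP0 hR0.le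
    linarith
  have g5 : ε * (4 - 2 * P + 2 * H * Q) * R < E * (C ^ 2 * P) * R := by
    calc ε * (4 - 2 * P + 2 * H * Q) * R = ε * ((4 - 2 * P + 2 * H * Q) * R) := by ring
      _ ≤ ε * ((4 + H) * ρ) := mul_le_mul_of_nonneg_left g4 hε.le
      _ = (4 + H) * (ε * ρ) := by ring
      _ ≤ (4 + H) * E := mul_le_mul_of_nonneg_left (by linarith) (by linarith)
      _ < (C ^ 2 * (b ^ 2 / (1 + b ^ 2)) * R) * E := mul_lt_mul_of_pos_right hR hE0
      _ ≤ (C ^ 2 * P * R) * E := by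
          refine mul_le_mul_of_nonneg_right (mul_le_mul_of_nonneg_right
            (mul_le_mul_of_nonneg_left hPb.le (sq_nonneg C)) hR0.le) hE0.le
      _ = E * (C ^ 2 * P) * R := by ring
  have g6 := lt_of_mul_lt_mul_right g5 hR0.le
  linarith

lemma ge_on_closure_of_cont {Ω : Set Pl} {u : Pl → ℝ} (hu : ContinuousOn u (closure Ω)) {m : ℝ}
    (hm : ∀ x ∈ Ω, m ≤ u x) : ∀ x ∈ closure Ω, m ≤ u x := by
  intro x hx
  have hcl : IsClosed (closure Ω ∩ u ⁻¹' Ici m) :=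
    hu.preimage_isClosed_of_isClosed isClosed_closure isClosed_Ici
  have : closure Ω ⊆ closure Ω ∩ u ⁻¹' Ici m :=
    closure_minimal (fun y hy => ⟨subset_closure hy, hm y hy⟩) hcl
  exact (this hx).2

namespace Cap
variable {Ω : Set Pl} {η : Pl → Pl} {u p1 p2 r s t : Pl → ℝ} {H cst b : ℝ} {S : Set Pl}

/-- The weak equation satisfied in the gradient estimate. -/
lemma wdG (h : Cap Ω η u p1 p2 r s t H cst b S) (C R ε : ℝ) :
    WD Ω (fun x => (Real.exp (-C * u x) - ε * (R ^ 2 + x 0 ^ 2 + x 1 ^ 2)) *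
        (Nf p1 p2 x * (p1 x * A1 p1 p2 r s x + p2 x * A1 p1 p2 s t x)) +
        (-(C * Real.exp (-C * u x) * p1 x * Nf p1 p2 x ^ 2) - 2 * ε * x 0 +
          2 * ε * Nf p1 p2 x ^ 2 * (p1 x * x 0 + p2 x * x 1) * p1 x))
      (fun x => (Real.exp (-C * u x) - ε * (R ^ 2 + x 0 ^ 2 + x 1 ^ 2)) *
        (Nf p1 p2 x * (p1 x * A2 p1 p2 r s x + p2 x * A2 p1 p2 s t x)) +
        (-(C * Real.exp (-C * u x) * p2 x * Nf p1 p2 x ^ 2) - 2 * ε * x 1 +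
          2 * ε * Nf p1 p2 x ^ 2 * (p1 x * x 0 + p2 x * x 1) * p2 x))
      (fun x => (Real.exp (-C * u x) - ε * (R ^ 2 + x 0 ^ 2 + x 1 ^ 2)) *
        (A1 p1 p2 r s x ^ 2 + 2 * (A1 p1 p2 s t x * A2 p1 p2 r s x) + A2 p1 p2 s t x ^ 2) +
        Real.exp (-C * u x) * (C ^ 2 * (Nf p1 p2 x ^ 2 * (p1 x ^ 2 + p2 x ^ 2)) + C * H * Nf p1 p2 x)
        - ε * (4 - 2 * (Nf p1 p2 x ^ 2 * (p1 x ^ 2 + p2 x ^ 2)) +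
          2 * H * (Nf p1 p2 x * (p1 x * x 0 + p2 x * x 1)))) := by
  have ho := h.op
  have hE : C1 Ω (fun x => Real.exp (-C * u x)) (fun x => Real.exp (-C * u x) * (-C * p1 x))
      (fun x => Real.exp (-C * u x) * (-C * p2 x)) :=
    (h.du.const_mul (-C)).comp (s := univ) (φ := Real.exp) (φ' := Real.exp)
      (fun y _ => Real.hasDerivAt_exp y) Real.continuous_exp.continuousOn (fun _ _ => mem_univ _)
  have hρ : C1 Ω (fun x => ε * (R ^ 2 + x 0 ^ 2 + x 1 ^ 2)) (fun x => ε * (2 * x 0))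
      (fun x => ε * (2 * x 1)) :=
    (((((C1.const (R ^ 2)).add (C1.x0.mul C1.x0)).add (C1.x1.mul C1.x1)).const_mul ε).congr_on ho
      (fun x _ => by ring) (fun x _ => by ring) (fun x _ => by ring))
  have hη := hE.sub hρ
  have t1 := (h.wdD e0).smul ho (hη.mul h.dV1)
  have t2 := (h.wdD e1).smul ho (hη.mul h.dV2)
  have hN := C1.Nf h.dp1 h.dp2
  have t3 := h.wdV.smul ho ((hE.mul hN).const_mul (-C))
  have t4 := WD.of_C1 ho ((C1.x0 (Ω := Ω)).const_mul (-2 * ε)) (C1.x1.const_mul (-2 * ε))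
  have t5 := h.wdV.smul ho (((h.dV1.mul C1.x0).add (h.dV2.mul C1.x1)).const_mul (2 * ε))
  refine ((((t1.add ho t2).add ho t3).add ho t4).add ho t5).congr (fun x _ => ?_) (fun x _ => ?_)
    (fun x _ => ?_)
  · simp only [e0_0, e0_1, e1_0, e1_1]; ring
  · simp only [e0_0, e0_1, e1_0, e1_1]; ring
  · simp only [e0_0, e0_1, e1_0, e1_1]
    unfold A1 A2; ring

set_option maxHeartbeats 1600000 in
lemma z_le (h : Cap Ω η u p1 p2 r s t H cst b S) (hH : 0 ≤ H) {m : ℝ} (hm : ∀ x ∈ closure Ω, m ≤ u x)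
    {C R ε k : ℝ} (hC : 0 < C) (hR1 : 1 ≤ R) (hR : (4 + H) < C ^ 2 * (b ^ 2 / (1 + b ^ 2)) * R)
    (hε : 0 < ε) (hk : √(1 + b ^ 2) * Real.exp (-C * m) < k) : ∀ x ∈ Ω,
    (Nf p1 p2 x)⁻¹ * (Real.exp (-C * u x) - ε * (R ^ 2 + x 0 ^ 2 + x 1 ^ 2)) ≤ k := by
  have ho := h.op
  have hb2 : 0 < b ^ 2 := by have := h.hb; positivity
  have hk0 : 0 < k := lt_trans (by positivity) hk
  set ζ : Pl → ℝ := fun x => Real.exp (-C * u x) - ε * (R ^ 2 + x 0 ^ 2 + x 1 ^ 2) with hζ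
  set z : Pl → ℝ := fun x => (Nf p1 p2 x)⁻¹ * ζ x with hz
  have hEm : ∀ x ∈ closure Ω, Real.exp (-C * u x) ≤ Real.exp (-C * m) := fun x hx =>
    Real.exp_le_exp.mpr (by nlinarith [hm x hx])
  have hρ0 : ∀ x : Pl, 0 < ε * (R ^ 2 + x 0 ^ 2 + x 1 ^ 2) := fun x => by positivity
  have hζm : ∀ x ∈ closure Ω, ζ x ≤ Real.exp (-C * m) := fun x hx => by
    have h1 := hEm x hx
    have h2 := hρ0 x
    simp only [hζ]; linarith
  have c0 : ContinuousOn (fun x : Pl => x 0) (closure Ω) := (continuous_coord 0).continuousOn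
  have c1 : ContinuousOn (fun x : Pl => x 1) (closure Ω) := (continuous_coord 1).continuousOn
  have hζc : ContinuousOn ζ (closure Ω) := by
    have := h.cu
    simp only [hζ]
    fun_prop
  have hzc : ContinuousOn z (closure Ω) :=
    ((Nf_cont h.cp1 h.cp2).inv₀ fun x _ => (Nf_pos x).ne').mul hζc
  -- the gradient is large where z is large
  have hlarge : ∀ x ∈ closure Ω, k ≤ z x → 0 < ζ x ∧ Nf p1 p2 x ^ 2 * (1 + b ^ 2) < 1 := by
    intro x hx hkz
    have hN0 := Nf_pos (p1 := p1) (p2 := p2) x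
    have e : z x * Nf p1 p2 x = ζ x := by
      simp only [hz]; field_simp
    have hζ0 : 0 < ζ x := by rw [← e]; exact mul_pos (hk0.trans_le hkz) hN0
    refine ⟨hζ0, ?_⟩
    have h1 : k * Nf p1 p2 x ≤ Real.exp (-C * m) :=
      (mul_le_mul_of_nonneg_right hkz hN0.le).trans (e.le.trans (hζm x hx))
    have h2 : √(1 + b ^ 2) * Real.exp (-C * m) * Nf p1 p2 x < 1 * Real.exp (-C * m) := by
      rw [one_mul]; exact (mul_lt_mul_of_pos_right hk hN0).trans_le h1
    have h3 : √(1 + b ^ 2) * Nf p1 p2 x < 1 := by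
      have := Real.exp_pos (-C * m)
      refine lt_of_mul_lt_mul_right (a := Real.exp (-C * m)) ?_ this.le
      linarith
    have h4 : (√(1 + b ^ 2) * Nf p1 p2 x) ^ 2 < 1 := by
      have : 0 ≤ √(1 + b ^ 2) * Nf p1 p2 x := by positivity
      nlinarith
    rw [mul_pow, Real.sq_sqrt (by positivity)] at h4
    linarith
  set K : Set Pl := closure Ω ∩ z ⁻¹' Ici k with hK
  have hKcl : IsClosed K := hzc.preimage_isClosed_of_isClosed isClosed_closure isClosed_Ici
  have hKb : IsCompact K := by
    refine (isCompact_closedBall (0:Pl) (Real.exp (-C * m) / ε + 1)).of_isClosed_subset hKcl ?_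
    rintro x ⟨hx, hkz⟩
    have h1 := (hlarge x hx hkz).1
    have h2 := hEm x hx
    rw [mem_closedBall, dist_zero_right]
    have h3 := normsq_eq x
    have h4 : ε * ‖x‖ ^ 2 ≤ Real.exp (-C * m) := by
      rw [h3]; simp only [hζ] at h1; nlinarith [sq_nonneg R]
    have h5 : ‖x‖ ^ 2 ≤ Real.exp (-C * m) / ε := by rw [le_div_iff₀ hε]; linarith
    nlinarith [sq_nonneg (‖x‖ - 1)]
  have hKΩ : K ⊆ Ω := by
    rintro x ⟨hx, hkz⟩
    by_contra hxΩ
    have hxf : x ∈ frontier Ω := ⟨hx, fun hi => hxΩ (interior_subset hi)⟩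
    have h1 := (hlarge x hx hkz).2
    have hN := Nf_sq (p1 := p1) (p2 := p2) x
    by_cases hxS : x ∈ S
    · obtain ⟨-, a1, a2⟩ := h.star x hxS
      have h2 := h.hη x hxf
      have h3 : 1 + p1 x ^ 2 + p2 x ^ 2 = 1 + b ^ 2 := by
        rw [a1, a2]; linear_combination b ^ 2 * h2
      rw [h3] at hN; linarith
    · obtain ⟨a1, a2⟩ := h.nstar x hxf hxS
      rw [a1, a2] at hN
      nlinarith [sq_nonneg (Nf p1 p2 x)]
  -- derivatives
  have hE : C1 Ω (fun x => Real.exp (-C * u x)) (fun x => Real.exp (-C * u x) * (-C * p1 x))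
      (fun x => Real.exp (-C * u x) * (-C * p2 x)) :=
    (h.du.const_mul (-C)).comp (s := univ) (φ := Real.exp) (φ' := Real.exp)
      (fun y _ => Real.hasDerivAt_exp y) Real.continuous_exp.continuousOn (fun _ _ => mem_univ _)
  have hρC : C1 Ω (fun x => ε * (R ^ 2 + x 0 ^ 2 + x 1 ^ 2)) (fun x => ε * (2 * x 0))
      (fun x => ε * (2 * x 1)) :=
    (((((C1.const (R ^ 2)).add (C1.x0.mul C1.x0)).add (C1.x1.mul C1.x1)).const_mul ε).congr_on ho
      (fun x _ => by ring) (fun x _ => by ring) (fun x _ => by ring))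
  set ζ1 : Pl → ℝ := fun x => Real.exp (-C * u x) * (-C * p1 x) - ε * (2 * x 0) with hζ1
  set ζ2 : Pl → ℝ := fun x => Real.exp (-C * u x) * (-C * p2 x) - ε * (2 * x 1) with hζ2
  have hζC : C1 Ω ζ ζ1 ζ2 := hE.sub hρC
  set z1 : Pl → ℝ := fun x => Nf p1 p2 x * (p1 x * r x + p2 x * s x) * ζ x +
    (Nf p1 p2 x)⁻¹ * ζ1 x with hz1
  set z2 : Pl → ℝ := fun x => Nf p1 p2 x * (p1 x * s x + p2 x * t x) * ζ x +
    (Nf p1 p2 x)⁻¹ * ζ2 x with hz2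
  have hzC : C1 Ω z z1 z2 := by
    refine (((C1.Nf h.dp1 h.dp2).inv fun x _ => (Nf_pos x).ne').mul hζC).congr_der
      (fun x _ => ?_) (fun x _ => ?_)
    · have hN0 := (Nf_pos (p1 := p1) (p2 := p2) x).ne'
      simp only [hz1]; field_simp
    · have hN0 := (Nf_pos (p1 := p1) (p2 := p2) x).ne'
      simp only [hz2]; field_simp
  have hψC := (hzC.sub (C1.const k)).comp (s := univ) (φ := psq) (φ' := fun y => 2 * max y 0)
    (fun y _ => psq_deriv y) psq_cont'.continuousOn (fun _ _ => mem_univ _)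
  set ψ : Pl → ℝ := Ω.indicator fun x => psq (z x - k) with hψ
  set ψ1 : Pl → ℝ := Ω.indicator fun x => 2 * max (z x - k) 0 * z1 x with hψ1
  set ψ2 : Pl → ℝ := Ω.indicator fun x => 2 * max (z x - k) 0 * z2 x with hψ2
  have hψC' : C1 Ω ψ ψ1 ψ2 := hψC.congr_on ho (fun x hx => by rw [hψ, indicator_of_mem hx])
    (fun x hx => by rw [hψ1, indicator_of_mem hx, sub_zero])
    (fun x hx => by rw [hψ2, indicator_of_mem hx, sub_zero])
  have hoff : ∀ x ∈ Ω, x ∉ K → max (z x - k) 0 = 0 := by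
    intro x hx hxK
    refine max_eq_right ?_
    by_contra hlt
    exact hxK ⟨subset_closure hx, by simp only [mem_preimage, mem_Ici]; linarith⟩
  have hT : Tst Ω ψ ψ1 ψ2 := by
    refine Tst.of_C1 ho hKb hKΩ hψC' ?_ ?_ ?_
    · intro x hxK
      by_cases hx : x ∈ Ω
      · rw [hψ, indicator_of_mem hx, psq, hoff x hx hxK]; norm_num
      · rw [hψ, indicator_of_notMem hx]
    · intro x hxK
      by_cases hx : x ∈ Ω
      · rw [hψ1, indicator_of_mem hx, hoff x hx hxK]; ring
      · rw [hψ1, indicator_of_notMem hx]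
    · intro x hxK
      by_cases hx : x ∈ Ω
      · rw [hψ2, indicator_of_mem hx, hoff x hx hxK]; ring
      · rw [hψ2, indicator_of_notMem hx]
  have hwd := h.wdG C R ε
  have hintg := hwd.integrable ho hT
  have hzero := hwd.eq _ _ _ hT
  -- lower bound of the integrand
  have hlow : ∀ x ∈ Ω, ∃ A B c : ℝ, 0 ≤ A ∧ 0 ≤ c ∧ (0 < ψ x → 0 < c) ∧ c ≤ B ∧
      A + B = ((Real.exp (-C * u x) - ε * (R ^ 2 + x 0 ^ 2 + x 1 ^ 2)) *
        (Nf p1 p2 x * (p1 x * A1 p1 p2 r s x + p2 x * A1 p1 p2 s t x)) +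
        (-(C * Real.exp (-C * u x) * p1 x * Nf p1 p2 x ^ 2) - 2 * ε * x 0 +
          2 * ε * Nf p1 p2 x ^ 2 * (p1 x * x 0 + p2 x * x 1) * p1 x)) * ψ1 x +
      ((Real.exp (-C * u x) - ε * (R ^ 2 + x 0 ^ 2 + x 1 ^ 2)) *
        (Nf p1 p2 x * (p1 x * A2 p1 p2 r s x + p2 x * A2 p1 p2 s t x)) +
        (-(C * Real.exp (-C * u x) * p2 x * Nf p1 p2 x ^ 2) - 2 * ε * x 1 +
          2 * ε * Nf p1 p2 x ^ 2 * (p1 x * x 0 + p2 x * x 1) * p2 x)) * ψ2 x +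
      ((Real.exp (-C * u x) - ε * (R ^ 2 + x 0 ^ 2 + x 1 ^ 2)) *
        (A1 p1 p2 r s x ^ 2 + 2 * (A1 p1 p2 s t x * A2 p1 p2 r s x) + A2 p1 p2 s t x ^ 2) +
        Real.exp (-C * u x) * (C ^ 2 * (Nf p1 p2 x ^ 2 * (p1 x ^ 2 + p2 x ^ 2)) + C * H * Nf p1 p2 x)
        - ε * (4 - 2 * (Nf p1 p2 x ^ 2 * (p1 x ^ 2 + p2 x ^ 2)) +
          2 * H * (Nf p1 p2 x * (p1 x * x 0 + p2 x * x 1)))) * ψ x := by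
    intro x hx
    have hN := Nf_sq (p1 := p1) (p2 := p2) x
    have hN0 := Nf_pos (p1 := p1) (p2 := p2) x
    have hWN : (Nf p1 p2 x)⁻¹ * Nf p1 p2 x = 1 := inv_mul_cancel₀ hN0.ne'
    set E := Real.exp (-C * u x) with hE'
    have hE0 : 0 < E := Real.exp_pos _
    have hψx : ψ x = psq (z x - k) := by rw [hψ, indicator_of_mem hx]
    have hψ1x : ψ1 x = 2 * max (z x - k) 0 * z1 x := by rw [hψ1, indicator_of_mem hx]
    have hψ2x : ψ2 x = 2 * max (z x - k) 0 * z2 x := by rw [hψ2, indicator_of_mem hx]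
    have hψ0 : 0 ≤ ψ x := by rw [hψx]; unfold psq; positivity
    set q := (E - ε * (R ^ 2 + x 0 ^ 2 + x 1 ^ 2)) *
        (A1 p1 p2 r s x ^ 2 + 2 * (A1 p1 p2 s t x * A2 p1 p2 r s x) + A2 p1 p2 s t x ^ 2) +
        E * (C ^ 2 * (Nf p1 p2 x ^ 2 * (p1 x ^ 2 + p2 x ^ 2)) + C * H * Nf p1 p2 x)
        - ε * (4 - 2 * (Nf p1 p2 x ^ 2 * (p1 x ^ 2 + p2 x ^ 2)) +
          2 * H * (Nf p1 p2 x * (p1 x * x 0 + p2 x * x 1))) with hq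
    have hqpos : 0 < ψ x → 0 < q := by
      intro hpos
      have hzk : k ≤ z x := by
        by_contra hlt
        rw [hψx, psq, max_eq_right (by linarith)] at hpos
        norm_num at hpos
      obtain ⟨hζ0, hNb⟩ := hlarge x (subset_closure hx) hzk
      have hζ0' : 0 < E - ε * (R ^ 2 + x 0 ^ 2 + x 1 ^ 2) := hζ0
      have htr : 0 ≤ A1 p1 p2 r s x ^ 2 + 2 * (A1 p1 p2 s t x * A2 p1 p2 r s x) +
          A2 p1 p2 s t x ^ 2 := by
        have e : A1 p1 p2 r s x ^ 2 + 2 * (A1 p1 p2 s t x * A2 p1 p2 r s x) +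
          A2 p1 p2 s t x ^ 2 = Nf p1 p2 x ^ 6 * ((r x * (1 + p2 x ^ 2) - p1 x * p2 x * s x) ^ 2 +
          2 * ((s x * (1 + p2 x ^ 2) - p1 x * p2 x * t x) * (s x * (1 + p1 x ^ 2) - p1 x * p2 x * r x)) +
          (t x * (1 + p1 x ^ 2) - p1 x * p2 x * s x) ^ 2) := by unfold A1 A2; ring
        rw [e]; exact mul_nonneg (by positivity) trace_nonneg
      rw [hq]
      exact qpos_real hN hN0 htr hζ0' hNb hE0 hC hR1 hR hε hH
    refine ⟨2 * max (z x - k) 0 * (Nf p1 p2 x ^ 3 * ((z1 x * (1 + p2 x ^ 2) - p1 x * p2 x * z2 x) * z1 x +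
      (z2 x * (1 + p1 x ^ 2) - p1 x * p2 x * z1 x) * z2 x)), q * ψ x, q * ψ x, ?_, ?_, ?_, le_rfl, ?_⟩
    · exact mul_nonneg (by positivity) (A_form x _ _)
    · rcases hψ0.eq_or_lt with h0 | h0
      · rw [← h0, mul_zero]
      · exact (mul_pos (hqpos h0) h0).le
    · intro h0; exact mul_pos (hqpos h0) h0
    · have f1 : (E - ε * (R ^ 2 + x 0 ^ 2 + x 1 ^ 2)) *
          (Nf p1 p2 x * (p1 x * A1 p1 p2 r s x + p2 x * A1 p1 p2 s t x)) +
          (-(C * E * p1 x * Nf p1 p2 x ^ 2) - 2 * ε * x 0 +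
          2 * ε * Nf p1 p2 x ^ 2 * (p1 x * x 0 + p2 x * x 1) * p1 x) =
          Nf p1 p2 x ^ 3 * (z1 x * (1 + p2 x ^ 2) - p1 x * p2 x * z2 x) := by
        simp only [hz1, hz2, hζ, hζ1, hζ2, A1, ← hE']
        field_simp
        linear_combination (2 * ε * x 0) * hN
      have f2 : (E - ε * (R ^ 2 + x 0 ^ 2 + x 1 ^ 2)) *
          (Nf p1 p2 x * (p1 x * A2 p1 p2 r s x + p2 x * A2 p1 p2 s t x)) +
          (-(C * E * p2 x * Nf p1 p2 x ^ 2) - 2 * ε * x 1 +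
          2 * ε * Nf p1 p2 x ^ 2 * (p1 x * x 0 + p2 x * x 1) * p2 x) =
          Nf p1 p2 x ^ 3 * (z2 x * (1 + p1 x ^ 2) - p1 x * p2 x * z1 x) := by
        simp only [hz1, hz2, hζ, hζ1, hζ2, A2, ← hE']
        field_simp
        linear_combination (2 * ε * x 1) * hN
      rw [f1, f2, hψ1x, hψ2x]; ring
  have hcont : ContinuousOn (fun x => ((Real.exp (-C * u x) - ε * (R ^ 2 + x 0 ^ 2 + x 1 ^ 2)) *
        (Nf p1 p2 x * (p1 x * A1 p1 p2 r s x + p2 x * A1 p1 p2 s t x)) +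
        (-(C * Real.exp (-C * u x) * p1 x * Nf p1 p2 x ^ 2) - 2 * ε * x 0 +
          2 * ε * Nf p1 p2 x ^ 2 * (p1 x * x 0 + p2 x * x 1) * p1 x)) * ψ1 x +
      ((Real.exp (-C * u x) - ε * (R ^ 2 + x 0 ^ 2 + x 1 ^ 2)) *
        (Nf p1 p2 x * (p1 x * A2 p1 p2 r s x + p2 x * A2 p1 p2 s t x)) +
        (-(C * Real.exp (-C * u x) * p2 x * Nf p1 p2 x ^ 2) - 2 * ε * x 1 +
          2 * ε * Nf p1 p2 x ^ 2 * (p1 x * x 0 + p2 x * x 1) * p2 x)) * ψ2 x +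
      ((Real.exp (-C * u x) - ε * (R ^ 2 + x 0 ^ 2 + x 1 ^ 2)) *
        (A1 p1 p2 r s x ^ 2 + 2 * (A1 p1 p2 s t x * A2 p1 p2 r s x) + A2 p1 p2 s t x ^ 2) +
        Real.exp (-C * u x) * (C ^ 2 * (Nf p1 p2 x ^ 2 * (p1 x ^ 2 + p2 x ^ 2)) + C * H * Nf p1 p2 x)
        - ε * (4 - 2 * (Nf p1 p2 x ^ 2 * (p1 x ^ 2 + p2 x ^ 2)) +
          2 * H * (Nf p1 p2 x * (p1 x * x 0 + p2 x * x 1)))) * ψ x) Ω :=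
    ((hwd.c1.mul hT.cψ1.continuousOn).add (hwd.c2.mul hT.cψ2.continuousOn)).add
      (hwd.cf.mul hT.cψ.continuousOn)
  have hall' := fun hn => zero_of_small ho hcont hn (fun R' ε' hε' =>
    ⟨_, hintg.integrableOn, hn, fun x _ _ => le_rfl, by
      refine le_trans (setIntegral_le_integral hintg ?_) (hzero.le.trans hε'.le)
      refine ae_of_all _ fun x => ?_
      by_cases hx : x ∈ Ω
      · exact hn x hx
      · simp [hψ, hψ1, hψ2, hx]⟩)
  have hall := hall' (fun x hx => by
    obtain ⟨A, B, c, hA, hc, -, hcB, e⟩ := hlow x hx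
    exact (show 0 ≤ A + B by linarith).trans e.le)
  intro x hx
  by_contra hlt
  obtain ⟨A, B, c, hA, hc, hpos, hcB, e⟩ := hlow x hx
  have h0 := hall x hx
  simp only at h0
  rw [← e] at h0
  have hψp : 0 < ψ x := by
    rw [hψ, indicator_of_mem hx, psq]
    have : 0 < z x - k := by
      have : k < z x := not_le.mp hlt
      linarith
    rw [max_eq_left this.le]; positivity
  linarith [hpos hψp]

lemma grad_bound (h : Cap Ω η u p1 p2 r s t H cst b S) (hH : 0 ≤ H) {m : ℝ}
    (hm : ∀ x ∈ Ω, m ≤ u x) : ∀ x ∈ Ω, p1 x ^ 2 + p2 x ^ 2 ≤ b ^ 2 := by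
  have hm' : ∀ x ∈ closure Ω, m ≤ u x := by
    intro x hx
    exact ge_on_closure_of_cont h.cu hm x hx
  intro x hx
  have hb2 : 0 < b ^ 2 := by have := h.hb; positivity
  have hN0 := Nf_pos (p1 := p1) (p2 := p2) x
  -- first limit
  have h1 : ∀ C : ℝ, 0 < C → (Nf p1 p2 x)⁻¹ * Real.exp (-C * u x) ≤
      √(1 + b ^ 2) * Real.exp (-C * m) := by
    intro C hC
    obtain ⟨R, hR1, hR⟩ : ∃ R : ℝ, 1 ≤ R ∧ (4 + H) < C ^ 2 * (b ^ 2 / (1 + b ^ 2)) * R := by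
      have hβ : 0 < C ^ 2 * (b ^ 2 / (1 + b ^ 2)) := by positivity
      refine ⟨(4 + H) / (C ^ 2 * (b ^ 2 / (1 + b ^ 2))) + 1, ?_, ?_⟩
      · have : 0 ≤ (4 + H) / (C ^ 2 * (b ^ 2 / (1 + b ^ 2))) := by positivity
        linarith
      · rw [mul_add, mul_div_cancel₀ _ hβ.ne']; linarith
    refine le_of_forall_pos_le_add fun δ hδ => ?_
    have hρ : 0 < R ^ 2 + x 0 ^ 2 + x 1 ^ 2 := by positivity
    have := h.z_le hH hm' hC hR1 hR (ε := δ / 2 * Nf p1 p2 x / (R ^ 2 + x 0 ^ 2 + x 1 ^ 2))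
      (by positivity) (k := √(1 + b ^ 2) * Real.exp (-C * m) + δ / 2) (by linarith) x hx
    rw [div_mul_cancel₀ _ hρ.ne', mul_sub] at this
    have e : (Nf p1 p2 x)⁻¹ * (δ / 2 * Nf p1 p2 x) = δ / 2 := by field_simp
    rw [e] at this
    linarith
  have h2 : (Nf p1 p2 x)⁻¹ ≤ √(1 + b ^ 2) := by
    have t1 : Tendsto (fun C : ℝ => (Nf p1 p2 x)⁻¹ * Real.exp (-C * u x)) (𝓝[>] 0)
        (𝓝 ((Nf p1 p2 x)⁻¹ * Real.exp (-0 * u x))) :=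
      (Continuous.tendsto (by fun_prop) 0).mono_left nhdsWithin_le_nhds
    have t2 : Tendsto (fun C : ℝ => √(1 + b ^ 2) * Real.exp (-C * m)) (𝓝[>] 0)
        (𝓝 (√(1 + b ^ 2) * Real.exp (-0 * m))) :=
      (Continuous.tendsto (by fun_prop) 0).mono_left nhdsWithin_le_nhds
    have := le_of_tendsto_of_tendsto t1 t2 (by
      filter_upwards [self_mem_nhdsWithin] with C hC using h1 C hC)
    simpa using this
  have h3 : √(1 + p1 x ^ 2 + p2 x ^ 2) ≤ √(1 + b ^ 2) := by
    unfold Nf at h2; rwa [inv_inv] at h2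
  rw [Real.sqrt_le_sqrt_iff (by positivity)] at h3
  linarith

end Cap


/-! ### Sign of the directional derivative -/

lemma const_of_zero {Ω : Set Pl} {f f1 f2 : Pl → ℝ} (ho : IsOpen Ω) (hc : IsPreconnected Ω)
    (hf : C1 Ω f f1 f2) (h1 : ∀ x ∈ Ω, f1 x = 0) (h2 : ∀ x ∈ Ω, f2 x = 0) :
    ∀ x ∈ Ω, ∀ y ∈ Ω, f x = f y := by
  intro x hx y hy
  refine ho.is_const_of_fderiv_eq_zero hc (𝕜 := ℝ) (f := f)
    (fun x hx => (hf.der x hx).differentiableAt.differentiableWithinAt) (fun x hx => ?_) hx hy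
  rw [(hf.der x hx).fderiv, h1 x hx, h2 x hx]
  simp [lf]

lemma const_closure {Ω : Set Pl} {f : Pl → ℝ} (hf : ContinuousOn f (closure Ω)) {c : ℝ}
    (h : ∀ x ∈ Ω, f x = c) : ∀ x ∈ closure Ω, f x = c := by
  intro x hx
  refine le_antisymm ?_ (ge_on_closure_of_cont hf (fun x hx => (h x hx).ge) x hx)
  have := ge_on_closure_of_cont hf.neg (m := -c) (fun x hx => by rw [Pi.neg_apply, h x hx]) x hx
  rw [Pi.neg_apply] at this
  linarith

namespace Cap
variable {Ω : Set Pl} {η : Pl → Pl} {u p1 p2 r s t : Pl → ℝ} {H cst b : ℝ} {S : Set Pl}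

lemma w_nonneg (h : Cap Ω η u p1 p2 r s t H cst b S) (hK : ∀ x ∈ Ω, p1 x ^ 2 + p2 x ^ 2 ≤ b ^ 2)
    {c d : ℝ} (hcd : c ^ 2 + d ^ 2 = 1) (hw : ∀ x ∈ frontier Ω, 0 ≤ c * p1 x + d * p2 x) :
    ∀ x ∈ Ω, 0 ≤ c * p1 x + d * p2 x := by
  have ho := h.op
  set w : Pl → ℝ := fun x => c * p1 x + d * p2 x with hwd
  set w1 : Pl → ℝ := fun x => c * r x + d * s x with hw1
  set w2 : Pl → ℝ := fun x => c * s x + d * t x with hw2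
  have hwC : C1 Ω w w1 w2 := (h.dp1.const_mul c).add (h.dp2.const_mul d)
  have hcp1 := h.cp1
  have hcp2 := h.cp2
  have hcr := h.cr
  have hcs := h.cs
  have hct := h.ct
  have hwc : ContinuousOn w (closure Ω) := by simp only [hwd]; fun_prop
  have hw1c : ContinuousOn w1 (closure Ω) := by simp only [hw1]; fun_prop
  have hw2c : ContinuousOn w2 (closure Ω) := by simp only [hw2]; fun_prop
  have hμc : ContinuousOn (fun x => max (-w x) 0) (closure Ω) :=
    (by fun_prop : Continuous fun y : ℝ => max (-y) 0).comp_continuousOn hwc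
  have hNc := Nf_cont h.cp1 h.cp2
  have hTC : C1 Ω (fun x => -psq (-w x)) (fun x => 2 * max (-w x) 0 * w1 x)
      (fun x => 2 * max (-w x) 0 * w2 x) :=
    (hwC.neg.comp (s := univ) (φ := psq) (φ' := fun y => 2 * max y 0)
      (fun y _ => psq_deriv y) psq_cont'.continuousOn (fun _ _ => mem_univ _)).neg.congr_der
      (fun x _ => by ring) (fun x _ => by ring)
  have hTc : ContinuousOn (fun x => -psq (-w x)) (closure Ω) := (hμc.pow 2).neg
  have hwD : WD Ω (A1 p1 p2 w1 w2) (A2 p1 p2 w1 w2) (fun _ => 0) := by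
    let v : Pl := c • e0 + d • e1
    have v0 : v 0 = c := by simp [v]
    have v1 : v 1 = d := by simp [v]
    refine (h.wdD v).congr (fun x _ => ?_) (fun x _ => ?_) (fun _ _ => rfl)
    · rw [v0, v1]; unfold A1; simp only [hw1, hw2]; ring
    · rw [v0, v1]; unfold A2; simp only [hw1, hw2]; ring
  have key := gg_cut h.dom (m := 2) (by norm_num)
    (F := fun x => max (-w x) 0 * (Nf p1 p2 x ^ 3 * ((w1 x * (1 + p2 x ^ 2) - p1 x * p2 x * w2 x) * w1 x +
      (w2 x * (1 + p1 x ^ 2) - p1 x * p2 x * w1 x) * w2 x)))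
    (by fun_prop) (fun x _ => mul_nonneg (le_max_right _ _) (A_form x _ _))
    (C := |b| ^ 3) (by positivity) (by
      intro φ φ1 φ2 ρ hφ
      have hcφ := hφ.cc.continuousOn (s := closure Ω)
      refine ⟨_, _, _, hwD.smul ho (((hφ.c.mono (subset_univ Ω)).mul
        (hφ.c.mono (subset_univ Ω))).mul hTC), ?_, ?_, ?_, ?_, ?_⟩
      · exact ((hcφ.mul hcφ).mul hTc).mul (A1_cont hcp1 hcp2 hw1c hw2c)
      · exact ((hcφ.mul hcφ).mul hTc).mul (A2_cont hcp1 hcp2 hw1c hw2c)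
      · intro x hx
        simp [hx]
      · intro x hx
        have : psq (-w x) = 0 := by
          have := hw x hx
          unfold psq
          rw [max_eq_right (by simp only [hwd]; linarith)]; norm_num
        simp [this]
      · intro x hx
        have hμ0 : 0 ≤ max (-w x) 0 := le_max_right _ _
        have hμb : max (-w x) 0 ≤ |b| := by
          refine max_le ?_ (abs_nonneg b)
          refine (neg_le_abs _).trans (sq_le_sq.mp ?_)
          have := hK x hx
          have e : (p1 x ^ 2 + p2 x ^ 2) * (c ^ 2 + d ^ 2) = w x ^ 2 + (c * p2 x - d * p1 x) ^ 2 := by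
            simp only [hwd]; ring
          rw [hcd] at e
          linarith [sq_nonneg (c * p2 x - d * p1 x)]
        have hT : psq (-w x) = max (-w x) 0 ^ 2 := rfl
        beta_reduce
        rw [hT]
        unfold A1 A2
        generalize max (-w x) 0 = μ at *
        have a1 := mul_nonneg hμ0 (A_form (p1 := p1) (p2 := p2) x (φ x * w1 x - μ * φ1 x)
          (φ x * w2 x - μ * φ2 x))
        have a2 := mul_le_mul_of_nonneg_left (A_form_le (p1 := p1) (p2 := p2) x (φ1 x) (φ2 x))
          (pow_nonneg hμ0 3)
        have a3 : μ ^ 3 * (φ1 x ^ 2 + φ2 x ^ 2) ≤ |b| ^ 3 * (φ1 x ^ 2 + φ2 x ^ 2) := by gcongr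
        linarith)
  have hz : ∀ x ∈ Ω, max (-w x) 0 * w1 x = 0 ∧ max (-w x) 0 * w2 x = 0 := by
    intro x hx
    rcases mul_eq_zero.mp (key x hx) with h1 | h1
    · rw [h1, zero_mul, zero_mul]; exact ⟨rfl, rfl⟩
    · obtain ⟨a1, a2⟩ := A_form_zero x _ _ h1
      rw [a1, a2, mul_zero]; exact ⟨rfl, rfl⟩
  intro x hx
  have hc := const_of_zero ho h.dom.2.2.1.isPreconnected hTC
    (fun x hx => by linarith [(hz x hx).1]) (fun x hx => by linarith [(hz x hx).2])
  obtain ⟨y, hy, -⟩ := h.nS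
  have h1 := const_closure hTc (c := -psq (-w x)) (fun y hy => hc y hy x hx) y
    (frontier_subset_closure hy)
  have h2 : psq (-w y) = 0 := by
    have := hw y hy
    unfold psq
    rw [max_eq_right (by simp only [hwd]; linarith)]; norm_num
  rw [h2] at h1
  have h3 : max (-w x) 0 = 0 := pow_eq_zero_iff two_ne_zero |>.mp (show psq (-w x) = 0 by linarith)
  have := le_max_left (-w x) 0
  linarith

end Cap


/-! ### The angle argument -/

lemma arctan_real {W z z1 w1 : ℝ} (hW : 0 < W) : 1 / (1 + (z * W⁻¹) ^ 2) *
    (z1 * W⁻¹ + z * (-(W ^ 2)⁻¹ * w1)) = (W * z1 - z * w1) * (W ^ 2 + z ^ 2)⁻¹ := by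
  have h1 : 0 < W ^ 2 + z ^ 2 := by positivity
  have h2 : 1 + (z * W⁻¹) ^ 2 = (W ^ 2 + z ^ 2) * (W ^ 2)⁻¹ := by field_simp
  have h3 : z1 * W⁻¹ + z * (-(W ^ 2)⁻¹ * w1) = (W * z1 - z * w1) * (W ^ 2)⁻¹ := by
    field_simp
    ring
  rw [h2, h3]
  field_simp

lemma angle_real {N p q y1 y2 φ f1 f2 a D D1 B XZ δ : ℝ}
    (hform : ∀ a b : ℝ, 0 ≤ N ^ 3 * ((a * (1 + q ^ 2) - p * q * b) * a +
      (b * (1 + p ^ 2) - p * q * a) * b))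
    (hle : ∀ a b : ℝ, N ^ 3 * ((a * (1 + q ^ 2) - p * q * b) * a +
      (b * (1 + p ^ 2) - p * q * a) * b) ≤ a ^ 2 + b ^ 2)
    (ha : a ^ 2 ≤ 4) (hD : 0 < D) (hD1 : D ≤ D1) (hB : D1 ≤ B) (hδ : 0 < δ) :
    φ ^ 2 * (N ^ 3 * ((y1 * (1 + q ^ 2) - p * q * y2) * y1 +
      (y2 * (1 + p ^ 2) - p * q * y1) * y2) / (2 * D1) - δ * |XZ| / D) - 8 * B * (f1 ^ 2 + f2 ^ 2) ≤
    φ ^ 2 * ((N ^ 3 * ((y1 * (1 + q ^ 2) - p * q * y2) * y1 +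
      (y2 * (1 + p ^ 2) - p * q * y1) * y2) + δ * XZ) * D⁻¹) +
    2 * φ * a * (N ^ 3 * ((y1 * (1 + q ^ 2) - p * q * y2) * f1 +
      (y2 * (1 + p ^ 2) - p * q * y1) * f2)) := by
  have k1 := mul_nonneg (show 0 ≤ D⁻¹ / 2 by positivity) (hform (φ * y1 + 2 * a * D * f1) (φ * y2 + 2 * a * D * f2))
  have k2 := hform y1 y2
  have k3 := hle f1 f2
  have k3' := hform f1 f2
  have hiD : D⁻¹ * D = 1 := inv_mul_cancel₀ hD.ne'
  set Q := N ^ 3 * ((y1 * (1 + q ^ 2) - p * q * y2) * y1 + (y2 * (1 + p ^ 2) - p * q * y1) * y2) with hQ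
  set P := N ^ 3 * ((f1 * (1 + q ^ 2) - p * q * f2) * f1 + (f2 * (1 + p ^ 2) - p * q * f1) * f2) with hP
  set M := N ^ 3 * ((y1 * (1 + q ^ 2) - p * q * y2) * f1 + (y2 * (1 + p ^ 2) - p * q * y1) * f2) with hM
  have e1 : N ^ 3 * (((φ * y1 + 2 * a * D * f1) * (1 + q ^ 2) - p * q * (φ * y2 + 2 * a * D * f2)) *
      (φ * y1 + 2 * a * D * f1) + ((φ * y2 + 2 * a * D * f2) * (1 + p ^ 2) -
      p * q * (φ * y1 + 2 * a * D * f1)) * (φ * y2 + 2 * a * D * f2)) =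
      φ ^ 2 * Q + 4 * φ * a * D * M + 4 * a ^ 2 * D ^ 2 * P := by
    rw [hQ, hP, hM]; ring
  rw [e1] at k1
  have e2 : D⁻¹ / 2 * (φ ^ 2 * Q + 4 * φ * a * D * M + 4 * a ^ 2 * D ^ 2 * P) =
      φ ^ 2 * (Q * D⁻¹) / 2 + 2 * φ * a * M + 2 * a ^ 2 * D * P := by
    linear_combination (2 * φ * a * M + 2 * a ^ 2 * D * P) * hiD
  rw [e2] at k1
  have k4 : 2 * a ^ 2 * D * P ≤ 8 * B * (f1 ^ 2 + f2 ^ 2) := by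
    calc 2 * a ^ 2 * D * P ≤ 2 * 4 * B * (f1 ^ 2 + f2 ^ 2) := by
          have hDB : D ≤ B := hD1.trans hB
          have hB0 : 0 ≤ B := hD.le.trans hDB
          refine mul_le_mul (mul_le_mul (by linarith) hDB hD.le (by norm_num)) k3 k3' (by positivity)
      _ = _ := by ring
  have k5 : φ ^ 2 * (Q / (2 * D1)) ≤ φ ^ 2 * (Q * D⁻¹) / 2 := by
    have : Q / (2 * D1) ≤ Q / (2 * D) := by gcongr
    have e : Q * D⁻¹ / 2 = Q / (2 * D) := by field_simp
    rw [mul_div_assoc (φ ^ 2), e]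
    exact mul_le_mul_of_nonneg_left this (sq_nonneg φ)
  have k6 : φ ^ 2 * (-(δ * |XZ| / D)) ≤ φ ^ 2 * (δ * XZ * D⁻¹) := by
    refine mul_le_mul_of_nonneg_left ?_ (sq_nonneg φ)
    rw [div_eq_mul_inv, ← neg_mul, ← mul_neg]
    refine mul_le_mul_of_nonneg_right (mul_le_mul_of_nonneg_left (neg_abs_le XZ) hδ.le) (by positivity)
  linarith

namespace Cap
variable {Ω : Set Pl} {η : Pl → Pl} {u p1 p2 r s t : Pl → ℝ} {H cst b : ℝ} {S : Set Pl}

lemma wdX (h : Cap Ω η u p1 p2 r s t H cst b S) :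
    WD Ω (A1 p1 p2 (fun x => p1 x * s x - p2 x * r x) (fun x => p1 x * t x - p2 x * s x))
      (A2 p1 p2 (fun x => p1 x * s x - p2 x * r x) (fun x => p1 x * t x - p2 x * s x))
      (fun _ => 0) := by
  refine (((h.wdD e1).smul h.op h.dp1).add h.op ((h.wdD e0).smul h.op h.dp2.neg)).congr
    (fun x _ => ?_) (fun x _ => ?_) (fun x _ => ?_)
  · simp only [e0_0, e0_1, e1_0, e1_1]; unfold A1; ring
  · simp only [e0_0, e0_1, e1_0, e1_1]; unfold A2; ring
  · simp only [e0_0, e0_1, e1_0, e1_1]; unfold A1 A2; ring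

lemma X_tan (h : Cap Ω η u p1 p2 r s t H cst b S) (x : Pl) (hx : x ∈ frontier Ω) :
    A1 p1 p2 (fun x => p1 x * s x - p2 x * r x) (fun x => p1 x * t x - p2 x * s x) x * η x 0 +
      A2 p1 p2 (fun x => p1 x * s x - p2 x * r x) (fun x => p1 x * t x - p2 x * s x) x * η x 1 = 0 := by
  by_cases hxS : x ∈ S
  · obtain ⟨-, a1, a2⟩ := h.star x hxS
    have ht := h.tan x hx
    unfold A1 A2
    beta_reduce
    generalize Nf p1 p2 x = N
    rw [a1, a2] at ht ⊢
    linear_combination (-N ^ 3) * ht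
  · obtain ⟨a1, a2⟩ := h.nstar x hx hxS
    unfold A1 A2
    beta_reduce
    rw [a1, a2]; ring

lemma y_zero (h : Cap Ω η u p1 p2 r s t H cst b S) (hK : ∀ x ∈ Ω, p1 x ^ 2 + p2 x ^ 2 ≤ b ^ 2)
    {c d : ℝ} (hcd : c ^ 2 + d ^ 2 = 1) (hw0 : ∀ x ∈ Ω, 0 ≤ c * p1 x + d * p2 x) :
    ∀ x ∈ Ω, p1 x * s x - p2 x * r x = 0 ∧ p1 x * t x - p2 x * s x = 0 := by
  have ho := h.op
  have hcp1 := h.cp1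
  have hcp2 := h.cp2
  have hcr := h.cr
  have hcs := h.cs
  have hct := h.ct
  have hNc := Nf_cont h.cp1 h.cp2
  set w : Pl → ℝ := fun x => c * p1 x + d * p2 x with hw
  set w1 : Pl → ℝ := fun x => c * r x + d * s x with hw1
  set w2 : Pl → ℝ := fun x => c * s x + d * t x with hw2
  set z : Pl → ℝ := fun x => -d * p1 x + c * p2 x with hz
  set z1 : Pl → ℝ := fun x => -d * r x + c * s x with hz1
  set z2 : Pl → ℝ := fun x => -d * s x + c * t x with hz2
  set y1 : Pl → ℝ := fun x => p1 x * s x - p2 x * r x with hy1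
  set y2 : Pl → ℝ := fun x => p1 x * t x - p2 x * s x with hy2
  have hwC : C1 Ω w w1 w2 := (h.dp1.const_mul c).add (h.dp2.const_mul d)
  have hzC : C1 Ω z z1 z2 := (h.dp1.const_mul (-d)).add (h.dp2.const_mul c)
  have ey1 : ∀ x, w x * z1 x - z x * w1 x = y1 x := fun x => by
    simp only [hw, hz, hz1, hw1, hy1]; linear_combination (p1 x * s x - p2 x * r x) * hcd
  have ey2 : ∀ x, w x * z2 x - z x * w2 x = y2 x := fun x => by
    simp only [hw, hz, hz2, hw2, hy2]; linear_combination (p1 x * t x - p2 x * s x) * hcd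
  have hwc : ContinuousOn w (closure Ω) := by simp only [hw]; fun_prop
  have hw1c : ContinuousOn w1 (closure Ω) := by simp only [hw1]; fun_prop
  have hw2c : ContinuousOn w2 (closure Ω) := by simp only [hw2]; fun_prop
  have hzc : ContinuousOn z (closure Ω) := by simp only [hz]; fun_prop
  have hz1c : ContinuousOn z1 (closure Ω) := by simp only [hz1]; fun_prop
  have hz2c : ContinuousOn z2 (closure Ω) := by simp only [hz2]; fun_prop
  have hy1c : ContinuousOn y1 (closure Ω) := by simp only [hy1]; fun_prop
  have hy2c : ContinuousOn y2 (closure Ω) := by simp only [hy2]; fun_prop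
  have hwcl := ge_on_closure_of_cont hwc hw0
  have hX1c := A1_cont hcp1 hcp2 hy1c hy2c
  have hX2c := A2_cont hcp1 hcp2 hy1c hy2c
  have hpos : ∀ δ > 0, ∀ x ∈ closure Ω, 0 < w x + δ := fun δ hδ x hx => by
    have := hwcl x hx; linarith
  have hDpos : ∀ δ > 0, ∀ x ∈ closure Ω, 0 < (w x + δ) ^ 2 + z x ^ 2 := fun δ hδ x hx => by
    have := hpos δ hδ x hx; positivity
  set XZ : Pl → ℝ := fun x => A1 p1 p2 y1 y2 x * z1 x + A2 p1 p2 y1 y2 x * z2 x with hXZ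
  have hXZc : ContinuousOn XZ (closure Ω) := by simp only [hXZ]; fun_prop
  set Q : Pl → ℝ := fun x => Nf p1 p2 x ^ 3 * ((y1 x * (1 + p2 x ^ 2) - p1 x * p2 x * y2 x) * y1 x +
      (y2 x * (1 + p1 x ^ 2) - p1 x * p2 x * y1 x) * y2 x) with hQ
  have hQc : ContinuousOn Q (closure Ω) := by simp only [hQ]; fun_prop
  have hQ0 : ∀ x, 0 ≤ Q x := fun x => A_form x _ _
  -- error functions
  set G : Pl → ℝ := fun x => |A1 p1 p2 z1 z2 x * z1 x + A2 p1 p2 z1 z2 x * z2 x| +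
    |A1 p1 p2 w1 w2 x * z1 x + A2 p1 p2 w1 w2 x * z2 x| with hG
  have hGc : ContinuousOn G (closure Ω) := by
    have := A1_cont hcp1 hcp2 hz1c hz2c
    have := A2_cont hcp1 hcp2 hz1c hz2c
    have := A1_cont hcp1 hcp2 hw1c hw2c
    have := A2_cont hcp1 hcp2 hw1c hw2c
    simp only [hG]; fun_prop
  have hXZe : ∀ x, XZ x = w x * (A1 p1 p2 z1 z2 x * z1 x + A2 p1 p2 z1 z2 x * z2 x) -
      z x * (A1 p1 p2 w1 w2 x * z1 x + A2 p1 p2 w1 w2 x * z2 x) := fun x => by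
    simp only [hXZ]; unfold A1 A2; rw [← ey1 x, ← ey2 x]; ring
  have hEb : ∀ δ > 0, ∀ x ∈ Ω, δ * |XZ x| / ((w x + δ) ^ 2 + z x ^ 2) ≤ G x := by
    intro δ hδ x hx
    have hD := hDpos δ hδ x (subset_closure hx)
    have hw' := hw0 x hx
    change 0 ≤ w x at hw'
    rw [div_le_iff₀ hD]
    have a1 : |XZ x| ≤ w x * |A1 p1 p2 z1 z2 x * z1 x + A2 p1 p2 z1 z2 x * z2 x| +
        |z x| * |A1 p1 p2 w1 w2 x * z1 x + A2 p1 p2 w1 w2 x * z2 x| := by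
      rw [hXZe x]
      refine (abs_sub _ _).trans ?_
      rw [abs_mul, abs_mul, abs_of_nonneg hw']
    have a2 : δ * w x ≤ (w x + δ) ^ 2 + z x ^ 2 := by nlinarith [sq_nonneg (z x)]
    have a3 : δ * |z x| ≤ (w x + δ) ^ 2 + z x ^ 2 := by
      have e := sq_abs (z x)
      have := abs_nonneg (z x)
      nlinarith [sq_nonneg (δ - |z x|)]
    have a4 := mul_le_mul_of_nonneg_left a1 hδ.le
    have a5 := mul_le_mul_of_nonneg_right a2 (abs_nonneg (A1 p1 p2 z1 z2 x * z1 x + A2 p1 p2 z1 z2 x * z2 x))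
    have a6 := mul_le_mul_of_nonneg_right a3 (abs_nonneg (A1 p1 p2 w1 w2 x * z1 x + A2 p1 p2 w1 w2 x * z2 x))
    simp only [hG]
    linarith
  have hElim : ∀ x ∈ Ω, Tendsto (fun δ : ℝ => δ * |XZ x| / ((w x + δ) ^ 2 + z x ^ 2)) (𝓝[>] 0) (𝓝 0) := by
    intro x hx
    have hw' := hw0 x hx
    change 0 ≤ w x at hw'
    rcases hw'.eq_or_lt with h0 | h0
    · have hmin : IsLocalMin w x := by
        filter_upwards [ho.mem_nhds hx] with y hy
        rw [← h0]; exact hw0 y hy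
      have hf := hmin.fderiv_eq_zero
      have b1 := hwC.fderiv_e0 hx
      have b2 := hwC.fderiv_e1 hx
      rw [hf] at b1 b2
      have b1' : w1 x = 0 := by rw [← b1]; simp
      have b2' : w2 x = 0 := by rw [← b2]; simp
      have : XZ x = 0 := by
        rw [hXZe x, ← h0]; unfold A1 A2; rw [b1', b2']; ring
      simp [this]
    · have hc : ContinuousAt (fun δ : ℝ => δ * |XZ x| / ((w x + δ) ^ 2 + z x ^ 2)) 0 := by
        refine ContinuousAt.div (by fun_prop) (by fun_prop) ?_
        have : 0 < (w x + 0) ^ 2 + z x ^ 2 := by rw [add_zero]; positivity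
        exact this.ne'
      have := hc.tendsto
      simp only [zero_mul, zero_div] at this
      exact this.mono_left nhdsWithin_le_nhds
  have hwz : ∀ x ∈ Ω, w x ^ 2 + z x ^ 2 ≤ b ^ 2 := fun x hx => by
    have := hK x hx
    have e : w x ^ 2 + z x ^ 2 = (p1 x ^ 2 + p2 x ^ 2) * (c ^ 2 + d ^ 2) := by
      simp only [hw, hz]; ring
    rw [e, hcd]; linarith
  have hD1b : ∀ x ∈ Ω, (w x + 1) ^ 2 + z x ^ 2 ≤ 2 * b ^ 2 + 2 := fun x hx => by
    have := hwz x hx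
    nlinarith [sq_nonneg (w x - 1), sq_nonneg (z x)]
  have hF : ContinuousOn (fun x => Q x / (2 * ((w x + 1) ^ 2 + z x ^ 2))) (closure Ω) :=
    hQc.div (by fun_prop) (fun x hx => by have := hDpos 1 one_pos x hx; positivity)
  have key := cut_zero ho (m := 2) (by norm_num) hF
    (fun x hx => div_nonneg (hQ0 x) (by positivity))
    (C := 8 * (2 * b ^ 2 + 2)) (by positivity) (by
      intro φ φ1 φ2 ρ hφ ε hε
      have hcφ := hφ.cc.continuousOn (s := closure Ω)
      have hEc : ∀ δ > 0, ContinuousOn (fun x => δ * |XZ x| / ((w x + δ) ^ 2 + z x ^ 2)) (closure Ω) :=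
        fun δ hδ => ContinuousOn.div (by fun_prop) (by fun_prop) (fun x hx => (hDpos δ hδ x hx).ne')
      have step : ∀ δ > 0, δ ≤ 1 → ∫ x in Ω, φ x ^ 2 * (Q x / (2 * ((w x + 1) ^ 2 + z x ^ 2))) ≤
          8 * (2 * b ^ 2 + 2) * (∫ x in Ω, (φ1 x ^ 2 + φ2 x ^ 2)) +
          ∫ x in Ω, φ x ^ 2 * (δ * |XZ x| / ((w x + δ) ^ 2 + z x ^ 2)) := by
        intro δ hδ hδ1
        have hFE : ContinuousOn (fun x => Q x / (2 * ((w x + 1) ^ 2 + z x ^ 2)) -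
            δ * |XZ x| / ((w x + δ) ^ 2 + z x ^ 2)) (closure Ω) := hF.sub (hEc δ hδ)
        have hfC : C1 Ω (fun x => Real.arctan (z x * (w x + δ)⁻¹))
            (fun x => (y1 x + δ * z1 x) * ((w x + δ) ^ 2 + z x ^ 2)⁻¹)
            (fun x => (y2 x + δ * z2 x) * ((w x + δ) ^ 2 + z x ^ 2)⁻¹) := by
          have hwd : C1 Ω (fun x => w x + δ) w1 w2 :=
            (hwC.add (C1.const δ)).congr_der (fun x _ => by ring) (fun x _ => by ring)
          refine ((hzC.mul (hwd.inv fun x hx => (hpos δ hδ x (subset_closure hx)).ne')).comp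
            (s := univ) (φ := Real.arctan) (φ' := fun y => 1 / (1 + y ^ 2))
            (fun y _ => Real.hasDerivAt_arctan y)
            (Continuous.continuousOn (by
              refine Continuous.div continuous_const (by fun_prop) fun y => by positivity))
            (fun _ _ => mem_univ _)).congr_der (fun x hx => ?_) (fun x hx => ?_)
          · rw [arctan_real (hpos δ hδ x (subset_closure hx)), ← ey1 x]; ring
          · rw [arctan_real (hpos δ hδ x (subset_closure hx)), ← ey2 x]; ring
        have hac : ContinuousOn (fun x => Real.arctan (z x * (w x + δ)⁻¹)) (closure Ω) :=
          Real.continuous_arctan.comp_continuousOn (hzc.mul ((hwc.add continuousOn_const).inv₀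
            fun x hx => (hpos δ hδ x hx).ne'))
        have hφC := hφ.c.mono (subset_univ Ω)
        have hqc : ContinuousOn (fun x => φ x ^ 2 * (Q x / (2 * ((w x + 1) ^ 2 + z x ^ 2)) -
            δ * |XZ x| / ((w x + δ) ^ 2 + z x ^ 2)) - 8 * (2 * b ^ 2 + 2) * (φ1 x ^ 2 + φ2 x ^ 2))
            (closure Ω) :=
          ((hcφ.pow 2).mul hFE).sub (continuous_const.mul
            ((hφ.cc1.pow 2).add (hφ.cc2.pow 2))).continuousOn
        have hqz : ∀ x ∈ Ω, x ∉ closedBall (0:Pl) ρ →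
            φ x ^ 2 * (Q x / (2 * ((w x + 1) ^ 2 + z x ^ 2)) -
            δ * |XZ x| / ((w x + δ) ^ 2 + z x ^ 2)) - 8 * (2 * b ^ 2 + 2) * (φ1 x ^ 2 + φ2 x ^ 2) = 0 :=
          fun x _ hx => by
            rw [(hφ.z x hx).1, (hφ.z x hx).2.1, (hφ.z x hx).2.2]; ring
        have hgg := gauss_green h.dom (isCompact_closedBall (0:Pl) ρ)
          { wd := h.wdX.smul ho ((hφC.mul hφC).mul hfC)
            y1 := ((hcφ.mul hcφ).mul hac).mul hX1c
            y2 := ((hcφ.mul hcφ).mul hac).mul hX2c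
            z1 := fun x _ hx => by simp [(hφ.z x hx).1]
            z2 := fun x _ hx => by simp [(hφ.z x hx).1]
            yn := fun x hx => by
              have := h.X_tan x hx
              beta_reduce
              linear_combination (φ x * φ x * Real.arctan (z x * (w x + δ)⁻¹)) * this
            qc := hqc.mono subset_closure
            qb := bdd_of_cont hqc hqz
            qz := hqz
            qf := fun x hx => by
              have ha : Real.arctan (z x * (w x + δ)⁻¹) ^ 2 ≤ 4 := by
                have b1 := Real.arctan_lt_pi_div_two (z x * (w x + δ)⁻¹)
                have b2 := Real.neg_pi_div_two_lt_arctan (z x * (w x + δ)⁻¹)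
                have b3 := Real.pi_lt_four
                nlinarith
              have hw' := hw0 x hx
              change 0 ≤ w x at hw'
              have hDD : (w x + δ) ^ 2 + z x ^ 2 ≤ (w x + 1) ^ 2 + z x ^ 2 := by
                have : (w x + δ) ^ 2 ≤ (w x + 1) ^ 2 := by gcongr
                linarith
              refine (angle_real (N := Nf p1 p2 x) (p := p1 x) (q := p2 x) (y1 := y1 x) (y2 := y2 x)
                (φ := φ x) (f1 := φ1 x) (f2 := φ2 x) (XZ := XZ x)
                (A_form x) (A_form_le x) ha (hDpos δ hδ x (subset_closure hx)) hDD
                (hD1b x hx) hδ).trans (le_of_eq ?_)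
              simp only [hXZ]
              unfold A1 A2
              ring }
        rw [integral_sub (hφ.intF ho two_ne_zero hFE) ((hφ.int.integrableOn).const_mul _),
          integral_const_mul] at hgg
        have e : ∫ x in Ω, φ x ^ 2 * (Q x / (2 * ((w x + 1) ^ 2 + z x ^ 2)) -
            δ * |XZ x| / ((w x + δ) ^ 2 + z x ^ 2)) =
            (∫ x in Ω, φ x ^ 2 * (Q x / (2 * ((w x + 1) ^ 2 + z x ^ 2)))) -
            ∫ x in Ω, φ x ^ 2 * (δ * |XZ x| / ((w x + δ) ^ 2 + z x ^ 2)) := by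
          rw [← integral_sub (hφ.intF ho two_ne_zero hF) (hφ.intF ho two_ne_zero (hEc δ hδ))]
          simp only [mul_sub]
        rw [e] at hgg
        linarith
      have hlim : Tendsto (fun δ : ℝ => ∫ x in Ω, φ x ^ 2 * (δ * |XZ x| / ((w x + δ) ^ 2 + z x ^ 2)))
          (𝓝[>] 0) (𝓝 (∫ x in Ω, (0:ℝ))) := by
        refine tendsto_integral_filter_of_dominated_convergence (fun x => φ x ^ 2 * G x) ?_ ?_
          (hφ.intF ho two_ne_zero hGc) ?_
        · filter_upwards [self_mem_nhdsWithin] with δ hδ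
          exact (hφ.intF ho two_ne_zero (hEc δ hδ)).aestronglyMeasurable
        · filter_upwards [self_mem_nhdsWithin] with δ hδ
          refine (ae_restrict_iff' ho.measurableSet).mpr (ae_of_all _ fun x hx => ?_)
          have hδ' : 0 < δ := hδ
          rw [Real.norm_eq_abs, abs_of_nonneg (by positivity)]
          exact mul_le_mul_of_nonneg_left (hEb δ hδ x hx) (sq_nonneg _)
        · refine (ae_restrict_iff' ho.measurableSet).mpr (ae_of_all _ fun x hx => ?_)
          have := (hElim x hx).const_mul (φ x ^ 2)
          rwa [mul_zero] at this
      rw [integral_zero] at hlim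
      have hev : ∀ᶠ δ in 𝓝[>] (0:ℝ), δ ≤ 1 :=
        mem_nhdsWithin_of_mem_nhds (Iic_mem_nhds one_pos)
      obtain ⟨δ, hδε, hδ1, hδ0⟩ :=
        ((hlim.eventually (Iio_mem_nhds hε)).and (hev.and self_mem_nhdsWithin)).exists
      have := step δ hδ0 hδ1
      have hδε' : ∫ x in Ω, φ x ^ 2 * (δ * |XZ x| / ((w x + δ) ^ 2 + z x ^ 2)) < ε := hδε
      linarith)
  intro x hx
  have h0 := key x hx
  have hD := hDpos 1 one_pos x (subset_closure hx)
  have hq : Q x = 0 := by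
    rcases div_eq_zero_iff.mp h0 with h1 | h1
    · exact h1
    · linarith
  exact A_form_zero x _ _ hq

end Cap


/-! ### Rigidity -/

namespace Cap
variable {Ω : Set Pl} {η : Pl → Pl} {u p1 p2 r s t : Pl → ℝ} {H cst b : ℝ} {S : Set Pl}

lemma tr_eq (h : Cap Ω η u p1 p2 r s t H cst b S)
    (hy : ∀ x ∈ Ω, p1 x * s x - p2 x * r x = 0 ∧ p1 x * t x - p2 x * s x = 0) :
    ∀ x ∈ Ω, Nf p1 p2 x ^ 3 * (r x + t x) = -H := by
  intro x hx
  obtain ⟨a1, a2⟩ := hy x hx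
  rw [← h.eq x hx]
  unfold A1 A2
  linear_combination (Nf p1 p2 x ^ 3 * p2 x) * a1 - (Nf p1 p2 x ^ 3 * p1 x) * a2

lemma H_ne (h : Cap Ω η u p1 p2 r s t H cst b S)
    (hy : ∀ x ∈ Ω, p1 x * s x - p2 x * r x = 0 ∧ p1 x * t x - p2 x * s x = 0)
    (hnc : ¬ ∃ c : ℝ, ∀ x ∈ Ω, u x = c) : H ≠ 0 := by
  intro hH
  apply hnc
  have hT := h.tr_eq hy
  have htr : ∀ x ∈ Ω, r x + t x = 0 := fun x hx => by
    have := hT x hx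
    rw [hH, neg_zero] at this
    exact (mul_eq_zero.mp this).resolve_left (pow_ne_zero 3 (Nf_pos x).ne')
  have hc := const_of_zero h.op h.dom.2.2.1.isPreconnected ((h.dp1.mul h.dp1).add (h.dp2.mul h.dp2))
    (fun x hx => by
      have a := htr x hx
      obtain ⟨a1, a2⟩ := hy x hx
      linear_combination (2 * p1 x) * a - 2 * a2)
    (fun x hx => by
      have a := htr x hx
      obtain ⟨a1, a2⟩ := hy x hx
      linear_combination (2 * p2 x) * a + 2 * a1)
  obtain ⟨y, hy1, hy2⟩ := h.nS
  have h0 : ∀ x ∈ Ω, p1 x = 0 ∧ p2 x = 0 := by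
    intro x hx
    have := const_closure ((h.cp1.mul h.cp1).add (h.cp2.mul h.cp2)) (c := p1 x * p1 x + p2 x * p2 x)
      (fun z hz => hc z hz x hx) y (frontier_subset_closure hy1)
    obtain ⟨b1, b2⟩ := h.nstar y hy1 hy2
    simp only [Pi.add_apply, Pi.mul_apply] at this
    rw [b1, b2] at this
    constructor
    · nlinarith [mul_self_nonneg (p1 x), mul_self_nonneg (p2 x)]
    · nlinarith [mul_self_nonneg (p1 x), mul_self_nonneg (p2 x)]
  obtain ⟨x0, hx0⟩ := h.dom.1
  exact ⟨u x0, fun x hx => const_of_zero h.op h.dom.2.2.1.isPreconnected h.du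
    (fun x hx => (h0 x hx).1) (fun x hx => (h0 x hx).2) x hx x0 hx0⟩

lemma dir (h : Cap Ω η u p1 p2 r s t H cst b S) (hH : H ≠ 0)
    (hy : ∀ x ∈ Ω, p1 x * s x - p2 x * r x = 0 ∧ p1 x * t x - p2 x * s x = 0)
    {c d : ℝ} (hcd : c ^ 2 + d ^ 2 = 1) (hw0 : ∀ x ∈ Ω, 0 ≤ c * p1 x + d * p2 x) :
    ∃ a a' : ℝ, a ^ 2 + a' ^ 2 = 1 ∧ ∀ x ∈ Ω, -a' * p1 x + a * p2 x = 0 := by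
  have ho := h.op
  have hpc := h.dom.2.2.1.isPreconnected
  have hT := h.tr_eq hy
  by_cases hall : ∀ x ∈ Ω, c * p1 x + d * p2 x = 0
  · refine ⟨d, -c, by linarith, fun x hx => ?_⟩
    rw [← hall x hx]; ring
  push Not at hall
  obtain ⟨xs, hxs, hws⟩ := hall
  have hwC : C1 Ω (fun x => c * p1 x + d * p2 x) (fun x => c * r x + d * s x) (fun x => c * s x + d * t x) :=
    (h.dp1.const_mul c).add (h.dp2.const_mul d)
  have hzC : C1 Ω (fun x => -d * p1 x + c * p2 x) (fun x => -d * r x + c * s x)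
    (fun x => -d * s x + c * t x) :=
    (h.dp1.const_mul (-d)).add (h.dp2.const_mul c)
  set w : Pl → ℝ := fun x => c * p1 x + d * p2 x with hw
  set z : Pl → ℝ := fun x => -d * p1 x + c * p2 x with hz
  set w1 : Pl → ℝ := fun x => c * r x + d * s x with hw1
  set w2 : Pl → ℝ := fun x => c * s x + d * t x with hw2
  set B : Pl → ℝ := fun x => c * A1 p1 p2 w1 w2 x + d * A2 p1 p2 w1 w2 x with hB
  have hBc : ContinuousOn B Ω := by
    have k1 := A1_cont h.dp1.cont h.dp2.cont hwC.c1 hwC.c2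
    have k2 := A2_cont h.dp1.cont h.dp2.cont hwC.c1 hwC.c2
    exact (continuousOn_const.mul k1).add (continuousOn_const.mul k2)
  have hB0 : ∀ x ∈ Ω, w x = 0 → B x = 0 := by
    intro x hx h0
    have hmin : IsLocalMin w x := by
      filter_upwards [ho.mem_nhds hx] with y hy
      rw [h0]; exact hw0 y hy
    have hf := hmin.fderiv_eq_zero
    have b1 := hwC.fderiv_e0 hx
    have b2 := hwC.fderiv_e1 hx
    rw [hf] at b1 b2
    have b1' : w1 x = 0 := by rw [← b1]; simp
    have b2' : w2 x = 0 := by rw [← b2]; simp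
    simp only [hB]; unfold A1 A2; rw [b1', b2']; ring
  have hBf : ∀ x ∈ Ω, B x * (w x ^ 2 + z x ^ 2) = -H * w x ^ 2 := by
    intro x hx
    obtain ⟨a1, a2⟩ := hy x hx
    have e : w x ^ 2 + z x ^ 2 = p1 x ^ 2 + p2 x ^ 2 := by
      simp only [hw, hz]; linear_combination (p1 x ^ 2 + p2 x ^ 2) * hcd
    rw [e, ← hT x hx]
    have f1 : w1 x * (p1 x ^ 2 + p2 x ^ 2) = (r x + t x) * p1 x * w x := by
      simp only [hw, hw1]
      linear_combination (-c * p2 x + d * p1 x) * a1 + (-c * p1 x - d * p2 x) * a2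
    have f2 : w2 x * (p1 x ^ 2 + p2 x ^ 2) = (r x + t x) * p2 x * w x := by
      simp only [hw, hw2]
      linear_combination (c * p1 x + d * p2 x) * a1 + (-c * p2 x + d * p1 x) * a2
    have e2 : w x = c * p1 x + d * p2 x := rfl
    simp only [hB]; unfold A1 A2
    calc _ = Nf p1 p2 x ^ 3 * (c * ((w1 x * (p1 x ^ 2 + p2 x ^ 2)) * (1 + p2 x ^ 2) -
          p1 x * p2 x * (w2 x * (p1 x ^ 2 + p2 x ^ 2))) +
          d * ((w2 x * (p1 x ^ 2 + p2 x ^ 2)) * (1 + p1 x ^ 2) -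
          p1 x * p2 x * (w1 x * (p1 x ^ 2 + p2 x ^ 2)))) := by ring
      _ = _ := by rw [f1, f2, e2]; ring
  -- the quotient
  have hquot : ∀ U ⊆ Ω, IsOpen U → IsPreconnected U → (∀ x ∈ U, w x ≠ 0) →
      ∀ x ∈ U, ∀ y ∈ U, z x * (w x)⁻¹ = z y * (w y)⁻¹ := by
    intro U hU hUo hUc hne
    refine const_of_zero hUo hUc ((hzC.mono hU).mul ((hwC.mono hU).inv hne)) (fun x hx => ?_)
      (fun x hx => ?_)
    · have := hne x hx
      have a1 := (hy x (hU hx)).1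
      field_simp
      simp only [hw, hz, hw1]
      linear_combination (c ^ 2 + d ^ 2) * a1
    · have := hne x hx
      have a2 := (hy x (hU hx)).2
      field_simp
      simp only [hw, hz, hw2]
      linear_combination (c ^ 2 + d ^ 2) * a2
  have hBq : ∀ x ∈ Ω, w x ≠ 0 → B x = -H / (1 + (z x * (w x)⁻¹) ^ 2) := by
    intro x hx hne
    have e := hBf x hx
    have : 0 < w x ^ 2 := by positivity
    rw [eq_div_iff (by positivity)]
    field_simp
    linarith
  have hβ : B xs ≠ 0 := by
    rw [hBq xs hxs hws]
    exact div_ne_zero (neg_ne_zero.mpr hH) (by positivity)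
  have hopen : IsOpen (Ω ∩ {x | B x = B xs}) := by
    rw [Metric.isOpen_iff]
    rintro x ⟨hx, hxB⟩
    have hwx : w x ≠ 0 := fun h0 => hβ (by rw [← hxB]; exact hB0 x hx h0)
    have hO : IsOpen (Ω ∩ w ⁻¹' {0}ᶜ) := hwC.cont.isOpen_inter_preimage ho isOpen_compl_singleton
    obtain ⟨ε, hε, hball⟩ := Metric.isOpen_iff.mp hO x ⟨hx, hwx⟩
    refine ⟨ε, hε, fun y hyb => ⟨(hball hyb).1, ?_⟩⟩
    have e := hquot (ball x ε) (fun y hy => (hball hy).1) isOpen_ball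
      (convex_ball x ε).isPreconnected (fun y hy => (hball hy).2) y hyb x (mem_ball_self hε)
    change B y = B xs
    rw [← show B x = B xs from hxB, hBq y (hball hyb).1 (hball hyb).2, hBq x hx hwx, e]
  have hopen2 : IsOpen (Ω ∩ B ⁻¹' {B xs}ᶜ) := hBc.isOpen_inter_preimage ho isOpen_compl_singleton
  have hsub : Ω ⊆ Ω ∩ {x | B x = B xs} := by
    refine hpc.subset_left_of_subset_union hopen hopen2 ?_ ?_ ⟨xs, hxs, hxs, rfl⟩
    · rw [Set.disjoint_left]
      rintro x ⟨-, h1⟩ ⟨-, h2⟩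
      exact h2 h1
    · intro x hx
      by_cases hb : B x = B xs
      · exact Or.inl ⟨hx, hb⟩
      · exact Or.inr ⟨hx, hb⟩
  have hwne : ∀ x ∈ Ω, w x ≠ 0 := fun x hx h0 => hβ (by
    rw [← show B x = B xs from (hsub hx).2]; exact hB0 x hx h0)
  set σ := z xs * (w xs)⁻¹ with hσ
  have hσ' : ∀ x ∈ Ω, z x = σ * w x := fun x hx => by
    rw [hσ, ← hquot Ω subset_rfl ho hpc hwne x hx xs hxs]
    have := hwne x hx
    field_simp
  have hn : 0 < √(1 + σ ^ 2) := by positivity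
  have hn2 : √(1 + σ ^ 2) ^ 2 = 1 + σ ^ 2 := Real.sq_sqrt (by positivity)
  refine ⟨(c - σ * d) / √(1 + σ ^ 2), (d + σ * c) / √(1 + σ ^ 2), ?_, fun x hx => ?_⟩
  · rw [div_pow, div_pow, ← add_div, hn2, div_eq_one_iff_eq (by positivity)]
    linear_combination (1 + σ ^ 2) * hcd
  · have e := hσ' x hx
    simp only [hw, hz] at e
    have : -((d + σ * c) / √(1 + σ ^ 2)) * p1 x + (c - σ * d) / √(1 + σ ^ 2) * p2 x =
      ((-d * p1 x + c * p2 x) - σ * (c * p1 x + d * p2 x)) / √(1 + σ ^ 2) := by ring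
    rw [this, e]; simp

/-- Explicit form of the solution. -/
lemma explicit (h : Cap Ω η u p1 p2 r s t H cst b S) (hH : H ≠ 0)
    (hy : ∀ x ∈ Ω, p1 x * s x - p2 x * r x = 0 ∧ p1 x * t x - p2 x * s x = 0)
    {a a' : ℝ} (ha : a ^ 2 + a' ^ 2 = 1) (hd : ∀ x ∈ Ω, -a' * p1 x + a * p2 x = 0) :
    ∃ t₀ z₀ : ℝ, (∀ x ∈ closure Ω, Nf p1 p2 x * (a * p1 x + a' * p2 x) = H * (t₀ - (a * x 0 + a' * x 1))) ∧
      (∀ x ∈ closure Ω, -a' * p1 x + a * p2 x = 0) ∧ ∀ x ∈ Ω, u x = z₀ + Nf p1 p2 x / H := by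
  have ho := h.op
  have hpc := h.dom.2.2.1.isPreconnected
  have hT := h.tr_eq hy
  obtain ⟨x0, hx0⟩ := h.dom.1
  have hdC : C1 Ω (fun x => -a' * p1 x + a * p2 x) (fun x => -a' * r x + a * s x)
    (fun x => -a' * s x + a * t x) := (h.dp1.const_mul (-a')).add (h.dp2.const_mul a)
  have hd1 : ∀ x ∈ Ω, -a' * r x + a * s x = 0 ∧ -a' * s x + a * t x = 0 := by
    intro x hx
    have e0 := (hdC.congr_on (g := fun _ => 0) (g1 := fun x => -a' * r x + a * s x)
      (g2 := fun x => -a' * s x + a * t x) ho hd (fun _ _ => rfl) (fun _ _ => rfl))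
    have k1 := e0.fderiv_e0 hx
    have k2 := e0.fderiv_e1 hx
    simp only [fderiv_fun_const, Pi.zero_apply, ContinuousLinearMap.zero_apply] at k1 k2
    exact ⟨k1.symm, k2.symm⟩
  have hc1 := const_of_zero ho hpc
    (((h.dV1.const_mul a).add (h.dV2.const_mul a')).add
      (((C1.x0.const_mul a).add (C1.x1.const_mul a')).const_mul H))
    (fun x hx => by
      obtain ⟨k1, k2⟩ := hd1 x hx
      have k3 := hd x hx
      have k4 := hT x hx
      unfold A1 A2
      have : a * (r x * (1 + p2 x ^ 2) - p1 x * p2 x * s x) + a' * (s x * (1 + p1 x ^ 2) - p1 x * p2 x * r x)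
         = a * (r x + t x) := by
        obtain ⟨y1, y2⟩ := hy x hx
        linear_combination (-k2 ) - (a * p2 x) * y1 + (a' * p1 x) * y1
      linear_combination a * k4 + Nf p1 p2 x ^ 3 * this)
    (fun x hx => by
      obtain ⟨k1, k2⟩ := hd1 x hx
      have k3 := hd x hx
      have k4 := hT x hx
      unfold A1 A2
      have : a * (s x * (1 + p2 x ^ 2) - p1 x * p2 x * t x) + a' * (t x * (1 + p1 x ^ 2) - p1 x * p2 x * s x)
         = a' * (r x + t x) := by
        obtain ⟨y1, y2⟩ := hy x hx
        linear_combination k1 - (a * p2 x) * y2 + (a' * p1 x) * y2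
      linear_combination a' * k4 + Nf p1 p2 x ^ 3 * this)
  have hc2 := const_of_zero ho hpc (h.du.sub ((C1.Nf h.dp1 h.dp2).const_mul H⁻¹))
    (fun x hx => by
      obtain ⟨y1, y2⟩ := hy x hx
      have k4 := hT x hx
      have k5 : Nf p1 p2 x ^ 3 * (p1 x * r x + p2 x * s x) = -H * p1 x := by
        linear_combination p1 x * k4 - Nf p1 p2 x ^ 3 * y2
      rw [k5]; field_simp; ring)
    (fun x hx => by
      obtain ⟨y1, y2⟩ := hy x hx
      have k4 := hT x hx
      have k5 : Nf p1 p2 x ^ 3 * (p1 x * s x + p2 x * t x) = -H * p2 x := by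
        linear_combination p2 x * k4 + Nf p1 p2 x ^ 3 * y1
      rw [k5]; field_simp; ring)
  have hN := Nf_cont h.cp1 h.cp2
  have hcp1 := h.cp1
  have hcp2 := h.cp2
  have cc0 : ContinuousOn (fun x : Pl => x 0) (closure Ω) := (continuous_coord 0).continuousOn
  have cc1 : ContinuousOn (fun x : Pl => x 1) (closure Ω) := (continuous_coord 1).continuousOn
  set k := a * (Nf p1 p2 x0 * p1 x0) + a' * (Nf p1 p2 x0 * p2 x0) + H * (a * x0 0 + a' * x0 1) with hk
  have hcl := const_closure (Ω := Ω) (f := fun x => a * (Nf p1 p2 x * p1 x) + a' * (Nf p1 p2 x * p2 x) +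
    H * (a * x 0 + a' * x 1)) (by fun_prop) (c := k) (fun x hx => hc1 x hx x0 hx0)
  refine ⟨k / H, u x0 - H⁻¹ * Nf p1 p2 x0, fun x hx => ?_, ?_, fun x hx => ?_⟩
  · have := hcl x hx
    rw [mul_sub, mul_div_cancel₀ _ hH]
    linear_combination this
  · exact const_closure (by fun_prop) hd
  · have := hc2 x hx x0 hx0
    rw [div_eq_mul_inv]
    linear_combination this

end Cap


/-! ### The slab -/

lemma frontier_inter_aux {R Ω : Set Pl} (hR : IsPreconnected R) {x y : Pl} (hx : x ∈ R)
    (hx' : x ∈ Ω) (hy : y ∈ R) (hy' : y ∉ Ω) : ∃ z, z ∈ R ∧ z ∈ frontier Ω := by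
  by_contra hno
  push Not at hno
  have hcov : R ⊆ interior Ω ∪ (closure Ω)ᶜ := by
    intro z hz
    by_cases hzi : z ∈ interior Ω
    · exact Or.inl hzi
    · exact Or.inr fun hzc => hno z hz ⟨hzc, hzi⟩
  have h1 : x ∈ interior Ω := by
    rcases hcov hx with h | h
    · exact h
    · exact absurd (subset_closure hx') h
  have h2 : y ∈ (closure Ω)ᶜ := by
    rcases hcov hy with h | h
    · exact absurd (interior_subset h) hy'
    · exact h
  obtain ⟨z, -, hz1, hz2⟩ := hR _ _ isOpen_interior isClosed_closure.isOpen_compl hcov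
    ⟨x, hx, h1⟩ ⟨y, hy, h2⟩
  exact hz2 (subset_closure (interior_subset hz1))

lemma half_aux {Ω : Set Pl} (ho : IsOpen Ω) {a a' s C : ℝ} (ha : a ^ 2 + a' ^ 2 = 1)
    (hf : ∀ x ∈ frontier Ω, s ≤ lf a a' x) (hb : ∀ x ∈ Ω, C ≤ lf a a' x) :
    ∀ x ∈ Ω, s < lf a a' x := by
  have hE : lf a a' (a • e0 + a' • e1) = 1 := by
    rw [lf_apply]; simp; linarith
  have key : ∀ x ∈ Ω, s ≤ lf a a' x := by
    intro x hx
    by_contra hlt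
    push Not at hlt
    have hconv : Convex ℝ {y : Pl | lf a a' y < s} :=
      convex_halfSpace_lt (lf a a').toLinearMap.isLinear s
    have hsub : {y : Pl | lf a a' y < s} ⊆ Ω := by
      intro y hy
      by_contra hyn
      obtain ⟨z, hz1, hz2⟩ := frontier_inter_aux hconv.isPreconnected
        hlt hx hy hyn
      have h1 : lf a a' z < s := hz1
      exact absurd (hf z hz2) (not_le.mpr h1)
    have hz : lf a a' (x - (|lf a a' x| + |C| + 1) • (a • e0 + a' • e1)) =
        lf a a' x - (|lf a a' x| + |C| + 1) := by
      rw [map_sub, map_smul, hE]; simp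
    have h0 := le_abs_self (lf a a' x)
    have h1 := neg_abs_le C
    have h2 := abs_nonneg (lf a a' x)
    have h3 := abs_nonneg C
    have hm : x - (|lf a a' x| + |C| + 1) • (a • e0 + a' • e1) ∈ Ω := by
      apply hsub
      change lf a a' _ < s
      rw [hz]; linarith
    have := hb _ hm
    rw [hz] at this
    linarith
  intro x hx
  have hc : ContinuousAt (fun ε : ℝ => x - ε • (a • e0 + a' • e1)) 0 := by fun_prop
  have hev : ∀ᶠ ε in 𝓝 (0:ℝ), x - ε • (a • e0 + a' • e1) ∈ Ω := by
    apply hc.eventually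
    simpa using ho.mem_nhds hx
  obtain ⟨δ, hδ, hB⟩ := Metric.eventually_nhds_iff.mp hev
  have hd := key _ (hB (y := δ / 2) (by
    rw [Real.dist_eq, sub_zero, abs_of_pos (by positivity)]; linarith))
  rw [map_sub, map_smul, hE] at hd
  simp at hd
  linarith

lemma slab_set {Ω : Set Pl} (ho : IsOpen Ω) (hne : Ω.Nonempty) {a a' s₁ s₂ C D : ℝ}
    (ha : a ^ 2 + a' ^ 2 = 1) (h12 : s₁ < s₂)
    (hf : ∀ x ∈ frontier Ω, lf a a' x = s₁ ∨ lf a a' x = s₂)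
    (hC : ∀ x ∈ Ω, C ≤ lf a a' x) (hD : ∀ x ∈ Ω, lf a a' x ≤ D) :
    Ω = {x | lf a a' x ∈ Ioo s₁ s₂} := by
  have h1 := half_aux (s := s₁) ho ha (fun x hx => by
    rcases hf x hx with h | h <;> linarith) hC
  have hneg : ∀ x : Pl, lf (-a) (-a') x = - lf a a' x := fun x => by
    rw [lf_apply, lf_apply]; ring
  have h2 := half_aux (a := -a) (a' := -a') (s := -s₂) (C := -D) ho (by linarith) (fun x hx => by
    rw [hneg]
    rcases hf x hx with h | h <;> linarith) (fun x hx => by rw [hneg]; linarith [hD x hx])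
  have hin : ∀ x ∈ Ω, lf a a' x ∈ Ioo s₁ s₂ := fun x hx => ⟨h1 x hx, by
    have := h2 x hx
    rw [hneg] at this; linarith⟩
  refine Subset.antisymm hin ?_
  have hconv : Convex ℝ {x : Pl | lf a a' x ∈ Ioo s₁ s₂} :=
    (convex_Ioo s₁ s₂).linear_preimage (lf a a').toLinearMap
  intro y hy
  by_contra hyn
  obtain ⟨x, hx⟩ := hne
  obtain ⟨z, hz1, hz2⟩ := frontier_inter_aux hconv.isPreconnected
    (hin x hx) hx hy hyn
  have hz3 : lf a a' z ∈ Ioo s₁ s₂ := hz1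
  rcases hf z hz2 with h | h
  · linarith [hz3.1]
  · linarith [hz3.2]

namespace Cap
variable {Ω : Set Pl} {η : Pl → Pl} {u p1 p2 r s t : Pl → ℝ} {H cst b : ℝ} {S : Set Pl}

lemma slab (h : Cap Ω η u p1 p2 r s t H cst b S) (hH : H ≠ 0) (hS : IsPreconnected S)
    {a a' t₀ z₀ : ℝ} (ha : a ^ 2 + a' ^ 2 = 1)
    (h1 : ∀ x ∈ closure Ω, Nf p1 p2 x * (a * p1 x + a' * p2 x) = H * (t₀ - (a * x 0 + a' * x 1)))
    (h2 : ∀ x ∈ closure Ω, -a' * p1 x + a * p2 x = 0)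
    (h3 : ∀ x ∈ Ω, u x = z₀ + Nf p1 p2 x / H) :
    ∃ e : Pl, ‖e‖ = 1 ∧
      ∃ s₁ s₂ t₀ z₀ : ℝ, s₁ < s₂ ∧ ∃ u₀ : ℝ → ℝ,
        (StrictMonoOn u₀ (Ioo s₁ s₂) ∨ StrictAntiOn u₀ (Ioo s₁ s₂)) ∧
        Ω = {x | ⟪x, e⟫ ∈ Ioo s₁ s₂} ∧
        (∀ x ∈ Ω, u x = u₀ ⟪x, e⟫) ∧
        ∀ t ∈ Ioo s₁ s₂, (t - t₀) ^ 2 + (u₀ t - z₀) ^ 2 = 1 / H ^ 2 := by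
  have ho : IsOpen Ω := h.op
  have hne : Ω.Nonempty := h.dom.1
  have hH2 : 0 < H ^ 2 := by positivity
  have hfr : ∀ x ∈ frontier Ω, x ∈ closure Ω := fun x hx => hx.1
  -- squared identity
  have hpp : ∀ x ∈ closure Ω, (a * p1 x + a' * p2 x) ^ 2 = p1 x ^ 2 + p2 x ^ 2 := by
    intro x hx
    linear_combination (p1 x ^ 2 + p2 x ^ 2) * ha - (-a' * p1 x + a * p2 x) * h2 x hx
  have hsq : ∀ x ∈ closure Ω, H ^ 2 * (lf a a' x - t₀) ^ 2 = 1 - Nf p1 p2 x ^ 2 := by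
    intro x hx
    rw [lf_apply]
    have e1 := congrArg (· ^ 2) (h1 x hx)
    simp only [mul_pow, hpp x hx] at e1
    have e2 := Nf_sq (p1 := p1) (p2 := p2) x
    linear_combination -e1 + e2
  have hlt : ∀ x ∈ closure Ω, H ^ 2 * (lf a a' x - t₀) ^ 2 < 1 := by
    intro x hx
    rw [hsq x hx]
    have := Nf_pos (p1 := p1) (p2 := p2) x
    have : 0 < Nf p1 p2 x ^ 2 := by positivity
    linarith
  -- boundary
  have hns : ∀ x ∈ frontier Ω, x ∉ S → lf a a' x = t₀ := by
    intro x hx hxS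
    obtain ⟨q1, q2⟩ := h.nstar x hx hxS
    have := h1 x (hfr x hx)
    rw [q1, q2] at this
    rw [lf_apply]
    have h0 : H * (t₀ - (a * x 0 + a' * x 1)) = 0 := by rw [← this]; ring
    rcases mul_eq_zero.mp h0 with h0 | h0
    · exact absurd h0 hH
    · linarith
  set D : ℝ := |b| / (√(1 + b ^ 2) * |H|) with hD
  have hDpos : 0 < D := by
    have := abs_pos.mpr h.hb
    have := abs_pos.mpr hH
    positivity
  have hD2 : D ^ 2 = b ^ 2 / ((1 + b ^ 2) * H ^ 2) := by
    rw [hD, div_pow, mul_pow, sq_abs, sq_abs, Real.sq_sqrt (by positivity)]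
  have hst : ∀ x ∈ S, (lf a a' x - t₀) ^ 2 = D ^ 2 := by
    intro x hx
    have hxf := h.Ssub hx
    obtain ⟨-, q1, q2⟩ := h.star x hx
    have hb2 : p1 x ^ 2 + p2 x ^ 2 = b ^ 2 := by
      rw [q1, q2]; linear_combination b ^ 2 * h.hη x hxf
    have e1 := hsq x (hfr x hxf)
    have e2 := Nf_sq (p1 := p1) (p2 := p2) x
    rw [add_assoc, hb2] at e2
    rw [hD2, eq_div_iff (by positivity)]
    linear_combination (1 + b ^ 2) * e1 - e2
  have hline : ∃ τ, τ ≠ t₀ ∧ ∀ x ∈ S, lf a a' x = τ := by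
    have := hS.eq_or_eq_neg_of_sq_eq (f := fun x => lf a a' x - t₀) (g := fun _ => D)
      (by fun_prop) continuousOn_const (fun x hx => hst x hx) (fun _ => hDpos.ne')
    rcases this with hh | hh
    · exact ⟨t₀ + D, by intro h; linarith, fun x hx => by
        have := hh hx
        simp only at this; linarith⟩
    · exact ⟨t₀ - D, by intro h; linarith, fun x hx => by
        have := hh hx
        simp only [Pi.neg_apply] at this; linarith⟩
  obtain ⟨τ, hτ, hSτ⟩ := hline
  have hbd : ∀ x ∈ Ω, |lf a a' x - t₀| ≤ 1 / |H| := by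
    intro x hx
    apply abs_le_of_sq_le_sq _ (by positivity)
    rw [div_pow, sq_abs, le_div_iff₀ hH2]
    linarith [hlt x (subset_closure hx)]
  have hmm : ∃ s₁ s₂, s₁ < s₂ ∧ (s₁ = t₀ ∧ s₂ = τ ∨ s₁ = τ ∧ s₂ = t₀) := by
    rcases lt_or_gt_of_ne hτ with h' | h'
    · exact ⟨τ, t₀, h', Or.inr ⟨rfl, rfl⟩⟩
    · exact ⟨t₀, τ, h', Or.inl ⟨rfl, rfl⟩⟩
  obtain ⟨s₁, s₂, h12, hs⟩ := hmm
  have hset : Ω = {x | lf a a' x ∈ Ioo s₁ s₂} := by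
    refine slab_set (C := t₀ - 1 / |H|) (D := t₀ + 1 / |H|) ho hne ha h12 (fun x hx => ?_)
      (fun x hx => ?_) (fun x hx => ?_)
    · have : lf a a' x = t₀ ∨ lf a a' x = τ := by
        by_cases hxS : x ∈ S
        · exact Or.inr (hSτ x hxS)
        · exact Or.inl (hns x hx hxS)
      rcases hs with ⟨rfl, rfl⟩ | ⟨rfl, rfl⟩
      · exact this
      · exact this.symm
    · linarith [(abs_le.mp (hbd x hx)).1]
    · linarith [(abs_le.mp (hbd x hx)).2]
  have hin : ∀ x : Pl, ⟪x, a • e0 + a' • e1⟫ = lf a a' x := by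
    intro x
    rw [inner_eq, lf_apply]; simp; ring
  have hE : lf a a' (a • e0 + a' • e1) = 1 := by
    rw [lf_apply]; simp; linarith
  have hI : ∀ y ∈ Ioo s₁ s₂, 0 < 1 - H ^ 2 * (y - t₀) ^ 2 := by
    intro y hy
    have ey : lf a a' (y • (a • e0 + a' • e1)) = y := by rw [map_smul, hE]; simp
    have hm : y • (a • e0 + a' • e1) ∈ Ω := by
      rw [hset]; change lf a a' _ ∈ Ioo s₁ s₂; rw [ey]; exact hy
    have := hlt _ (subset_closure hm)
    rw [ey] at this; linarith
  refine ⟨a • e0 + a' • e1, ?_, s₁, s₂, t₀, z₀, h12,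
    fun y => z₀ + √(1 - H ^ 2 * (y - t₀) ^ 2) / H, ?_, ?_, ?_, ?_⟩
  · have : ‖a • e0 + a' • e1‖ ^ 2 = 1 := by rw [normsq_eq]; simp; linarith
    have h0 := norm_nonneg (a • e0 + a' • e1)
    nlinarith
  · -- monotonicity
    have hdec : (∀ y ∈ Ioo s₁ s₂, ∀ w ∈ Ioo s₁ s₂, y < w →
          √(1 - H ^ 2 * (w - t₀) ^ 2) < √(1 - H ^ 2 * (y - t₀) ^ 2)) ∨
        (∀ y ∈ Ioo s₁ s₂, ∀ w ∈ Ioo s₁ s₂, y < w →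
          √(1 - H ^ 2 * (y - t₀) ^ 2) < √(1 - H ^ 2 * (w - t₀) ^ 2)) := by
      rcases hs with ⟨h', -⟩ | ⟨-, h'⟩
      · left
        intro y hy w hw hyw
        apply Real.sqrt_lt_sqrt (hI w hw).le
        have h0 : (y - t₀) ^ 2 < (w - t₀) ^ 2 := by
          apply pow_lt_pow_left₀ (by linarith) (by linarith [hy.1]) (by norm_num)
        have := mul_lt_mul_of_pos_left h0 hH2
        linarith
      · right
        intro y hy w hw hyw
        apply Real.sqrt_lt_sqrt (hI y hy).le
        have h0 : (t₀ - w) ^ 2 < (t₀ - y) ^ 2 := by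
          apply pow_lt_pow_left₀ (by linarith) (by linarith [hw.2]) (by norm_num)
        have := mul_lt_mul_of_pos_left h0 hH2
        have e1 : (t₀ - w) ^ 2 = (w - t₀) ^ 2 := by ring
        have e2 : (t₀ - y) ^ 2 = (y - t₀) ^ 2 := by ring
        rw [e1, e2] at this
        linarith
    rcases lt_or_gt_of_ne hH with hn | hp
    · rcases hdec with hd | hd
      · left
        intro y hy w hw hyw
        have := (div_lt_div_right_of_neg hn).mpr (hd y hy w hw hyw)
        simp only; linarith
      · right
        intro y hy w hw hyw
        have := (div_lt_div_right_of_neg hn).mpr (hd y hy w hw hyw)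
        simp only; linarith
    · rcases hdec with hd | hd
      · right
        intro y hy w hw hyw
        have := (div_lt_div_iff_of_pos_right hp).mpr (hd y hy w hw hyw)
        simp only; linarith
      · left
        intro y hy w hw hyw
        have := (div_lt_div_iff_of_pos_right hp).mpr (hd y hy w hw hyw)
        simp only; linarith
  · simp only [hin]; exact hset
  · intro x hx
    simp only [hin]
    rw [h3 x hx]
    have := hsq x (subset_closure hx)
    have e1 : 1 - H ^ 2 * (lf a a' x - t₀) ^ 2 = Nf p1 p2 x ^ 2 := by linarith
    rw [e1, Real.sqrt_sq (Nf_pos x).le]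
  · intro y hy
    have := Real.sq_sqrt (hI y hy).le
    simp only [add_sub_cancel_left]
    rw [div_pow, this]
    field_simp
    ring

end Cap


/-! ### Passing from the hypotheses of the theorem to the structure `Cap` -/

lemma coord_fderiv {W : Pl → Pl} {x : Pl} (hW : DifferentiableAt ℝ W x) (i : Fin 2) (v : Pl) :
    (fderiv ℝ W x v) i = fderiv ℝ (fun y => W y i) x v := by
  have h1 : HasFDerivAt (fun y => W y i)
      ((EuclideanSpace.proj i : Pl →L[ℝ] ℝ).comp (fderiv ℝ W x)) x :=
    (EuclideanSpace.proj i : Pl →L[ℝ] ℝ).hasFDerivAt.comp x hW.hasFDerivAt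
  rw [h1.fderiv]; rfl

lemma diff_of_coord {W : Pl → Pl} {x : Pl} (h0 : DifferentiableAt ℝ (fun y => W y 0) x)
    (h1 : DifferentiableAt ℝ (fun y => W y 1) x) : DifferentiableAt ℝ W x := by
  rw [differentiableAt_euclidean]
  intro i; fin_cases i
  · exact h0
  · exact h1

lemma normal_unit {Ω : Set Pl} {η : Pl → Pl} (h : IsCkDomainWithNormal 2 Ω η) {p : Pl}
    (hp : p ∈ frontier Ω) : η p 0 ^ 2 + η p 1 ^ 2 = 1 := by
  obtain ⟨V, g, g1, g2, g11, g12, g21, g22, hpV, hch, hη0, hη1⟩ := exists_chart h hp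
  have hpos := hch.nz p hpV
  rw [hη0, hη1]
  have hs := Real.sq_sqrt hpos.le
  have hs0 := Real.sqrt_pos.mpr hpos
  field_simp
  linarith

lemma meanCurv_eq {Ω : Set Pl} (ho : IsOpen Ω) {u p1 p2 r s s' t : Pl → ℝ}
    (h1 : ∀ x ∈ Ω, gradient u x 0 = p1 x) (h2 : ∀ x ∈ Ω, gradient u x 1 = p2 x)
    (d1 : C1 Ω p1 r s) (d2 : C1 Ω p2 s t) {x : Pl} (hx : x ∈ Ω) :
    meanCurv u x = A1 p1 p2 r s x + A2 p1 p2 s t x := by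
  have hV1 : C1 Ω (fun x => Nf p1 p2 x * p1 x) (A1 p1 p2 r s) (A1 p1 p2 s t) := by
    refine ((C1.Nf d1 d2).mul d1).congr_der (fun x _ => ?_) (fun x _ => ?_)
    · unfold A1
      linear_combination (-(Nf p1 p2 x) * r x) * Nf_sq (p1 := p1) (p2 := p2) x
    · unfold A1
      linear_combination (-(Nf p1 p2 x) * s x) * Nf_sq (p1 := p1) (p2 := p2) x
  have hV2 : C1 Ω (fun x => Nf p1 p2 x * p2 x) (A2 p1 p2 r s) (A2 p1 p2 s t) := by
    refine ((C1.Nf d1 d2).mul d2).congr_der (fun x _ => ?_) (fun x _ => ?_)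
    · unfold A2
      linear_combination (-(Nf p1 p2 x) * s x) * Nf_sq (p1 := p1) (p2 := p2) x
    · unfold A2
      linear_combination (-(Nf p1 p2 x) * t x) * Nf_sq (p1 := p1) (p2 := p2) x
  set W : Pl → Pl := fun y => (Real.sqrt (1 + ‖gradient u y‖ ^ 2))⁻¹ • gradient u y with hW
  have hN : ∀ y ∈ Ω, (Real.sqrt (1 + ‖gradient u y‖ ^ 2))⁻¹ = Nf p1 p2 y := by
    intro y hy
    rw [normsq_eq, h1 y hy, h2 y hy, ← add_assoc]; rfl
  have hW1 : C1 Ω (fun y => W y 0) (A1 p1 p2 r s) (A1 p1 p2 s t) :=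
    hV1.congr_on ho (fun y hy => by
      rw [hW]; simp only [PiLp.smul_apply, smul_eq_mul]; rw [hN y hy, h1 y hy])
      (fun _ _ => rfl) (fun _ _ => rfl)
  have hW2 : C1 Ω (fun y => W y 1) (A2 p1 p2 r s) (A2 p1 p2 s t) :=
    hV2.congr_on ho (fun y hy => by
      rw [hW]; simp only [PiLp.smul_apply, smul_eq_mul]; rw [hN y hy, h2 y hy])
      (fun _ _ => rfl) (fun _ _ => rfl)
  have hWd : DifferentiableAt ℝ W x :=
    diff_of_coord (hW1.der x hx).differentiableAt (hW2.der x hx).differentiableAt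
  have e1 : (fderiv ℝ W x e0) 0 = A1 p1 p2 r s x := by
    rw [coord_fderiv hWd, hW1.fderiv_e0 hx]
  have e2 : (fderiv ℝ W x _root_.e1) 1 = A2 p1 p2 s t x := by
    rw [coord_fderiv hWd, hW2.fderiv_e1 hx]
  unfold meanCurv
  rw [Fin.sum_univ_two, ← e1, ← e2, inner_eq, inner_eq]
  simp [e0, _root_.e1, hW]

lemma build_cap
    (Ω : Set Pl) (η : Pl → Pl)
    (hΩ : IsCkDomainWithNormal 2 Ω η)
    (u : Pl → ℝ)
    (hu2 : ContDiffOn ℝ 2 u Ω) (hucl : ContinuousOn u (closure Ω))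
    (Du : Pl → Pl)
    (hDu : ∀ x ∈ Ω, Du x = gradient u x) (hDuc : ContinuousOn Du (closure Ω))
    (hD2u : ∃ H : Pl → Pl →L[ℝ] Pl,
      ContinuousOn H (closure Ω) ∧ ∀ x ∈ Ω, H x = fderiv ℝ (gradient u) x)
    (H₀ : ℝ) (heq : ∀ x ∈ Ω, meanCurv u x + H₀ = 0)
    (hbc : ∀ p ∈ frontier Ω, ∀ q ∈ connectedComponentIn (frontier Ω) p,
      u q = u p ∧ ⟪Du q, η q⟫ = ⟪Du p, η p⟫)
    (hdisc : ¬ IsPreconnected (frontier Ω))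
    (hstar_conn : IsConnected {p ∈ frontier Ω | ⟪Du p, η p⟫ ≠ 0}) :
    ∃ r s t : Pl → ℝ, ∃ cst b : ℝ, Cap Ω η u (fun x => Du x 0) (fun x => Du x 1) r s t H₀ cst b
      {p ∈ frontier Ω | ⟪Du p, η p⟫ ≠ 0} := by
  have ho : IsOpen Ω := hΩ.2.1
  obtain ⟨H, hHc, hH⟩ := hD2u
  have hd : ContDiffOn ℝ 1 (fderiv ℝ u) Ω := hu2.fderiv_of_isOpen ho (by norm_num)
  have hd0 : ContDiffOn ℝ 1 (fun x => fderiv ℝ u x e0) Ω := hd.clm_apply contDiffOn_const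
  have hd1 : ContDiffOn ℝ 1 (fun x => fderiv ℝ u x e1) Ω := hd.clm_apply contDiffOn_const
  have hC0 : C1 Ω (fun x => gradient u x 0) _ _ :=
    (C1.of_contDiffOn ho hd0).congr_on ho (fun x _ => (grad0 u x).symm)
      (fun _ _ => rfl) (fun _ _ => rfl)
  have hC1 : C1 Ω (fun x => gradient u x 1) _ _ :=
    (C1.of_contDiffOn ho hd1).congr_on ho (fun x _ => (grad1 u x).symm)
      (fun _ _ => rfl) (fun _ _ => rfl)
  have hgd : ∀ x ∈ Ω, DifferentiableAt ℝ (gradient u) x := fun x hx =>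
    diff_of_coord (hC0.der x hx).differentiableAt (hC1.der x hx).differentiableAt
  have hH0 : ∀ x ∈ Ω, ∀ w, H x w 0 = fderiv ℝ (fun y => fderiv ℝ u y e0) x w := by
    intro x hx w
    rw [hH x hx, coord_fderiv (hgd x hx)]
    simp only [grad0]
  have hH1 : ∀ x ∈ Ω, ∀ w, H x w 1 = fderiv ℝ (fun y => fderiv ℝ u y e1) x w := by
    intro x hx w
    rw [hH x hx, coord_fderiv (hgd x hx)]
    simp only [grad1]
  have happ : ∀ x ∈ Ω, ∀ w z : Pl, fderiv ℝ (fun y => fderiv ℝ u y z) x w =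
      fderiv ℝ (fderiv ℝ u) x w z := by
    intro x hx w z
    have hdx : DifferentiableAt ℝ (fderiv ℝ u) x :=
      (hd.differentiableOn one_ne_zero).differentiableAt (ho.mem_nhds hx)
    rw [(hdx.hasFDerivAt.clm_apply (hasFDerivAt_const z x)).fderiv]
    simp
  have hsym : ∀ x ∈ Ω, fderiv ℝ (fun y => fderiv ℝ u y e1) x e0 =
      fderiv ℝ (fun y => fderiv ℝ u y e0) x e1 := by
    intro x hx
    rw [happ x hx, happ x hx]
    exact ((hu2.contDiffAt (ho.mem_nhds hx)).isSymmSndFDerivAt (by simp)) e0 e1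
  have cp1 : ContinuousOn (fun x => Du x 0) (closure Ω) := (continuous_coord 0).comp_continuousOn hDuc
  have cp2 : ContinuousOn (fun x => Du x 1) (closure Ω) := (continuous_coord 1).comp_continuousOn hDuc
  have cr : ContinuousOn (fun x => H x e0 0) (closure Ω) :=
    (continuous_coord 0).comp_continuousOn (hHc.clm_apply continuousOn_const)
  have cs : ContinuousOn (fun x => H x e1 0) (closure Ω) :=
    (continuous_coord 0).comp_continuousOn (hHc.clm_apply continuousOn_const)
  have ct : ContinuousOn (fun x => H x e1 1) (closure Ω) :=
    (continuous_coord 1).comp_continuousOn (hHc.clm_apply continuousOn_const)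
  have du : C1 Ω u (fun x => Du x 0) (fun x => Du x 1) :=
    (C1.of_contDiffOn ho (hu2.of_le (by norm_num))).congr_der
      (fun x hx => by rw [hDu x hx, grad0]) (fun x hx => by rw [hDu x hx, grad1])
  have dp1 : C1 Ω (fun x => Du x 0) (fun x => H x e0 0) (fun x => H x e1 0) :=
    hC0.congr_on ho (fun x hx => by rw [hDu x hx]) (fun x hx => (hH0 x hx e0).symm)
      (fun x hx => (hH0 x hx e1).symm)
  have dp2 : C1 Ω (fun x => Du x 1) (fun x => H x e1 0) (fun x => H x e1 1) :=
    hC1.congr_on ho (fun x hx => by rw [hDu x hx])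
      (fun x hx => by rw [hH0 x hx e1]; exact hsym x hx)
      (fun x hx => (hH1 x hx e1).symm)
  -- boundary
  have hnu : ∀ x ∈ frontier Ω, η x 0 ^ 2 + η x 1 ^ 2 = 1 := fun x hx => normal_unit hΩ hx
  have htu : ∀ x ∈ frontier Ω, Du x 0 * η x 1 = Du x 1 * η x 0 := fun x hx =>
    tangential hΩ hucl du.der cp1 cp2 (fun p hp q hq => (hbc p hp q hq).1) hx
  have hD0 : ∀ x ∈ frontier Ω, Du x 0 = ⟪Du x, η x⟫ * η x 0 := by
    intro x hx
    rw [inner_eq]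
    linear_combination (-(Du x 0)) * hnu x hx + η x 1 * htu x hx
  have hD1 : ∀ x ∈ frontier Ω, Du x 1 = ⟪Du x, η x⟫ * η x 1 := by
    intro x hx
    rw [inner_eq]
    linear_combination (-(Du x 1)) * hnu x hx - η x 0 * htu x hx
  have hsqn : ∀ x ∈ frontier Ω, Du x 0 * Du x 0 + Du x 1 * Du x 1 = ⟪Du x, η x⟫ ^ 2 := by
    intro x hx
    have e1 := hD0 x hx
    have e2 := hD1 x hx
    have e3 := hnu x hx
    set k := ⟪Du x, η x⟫
    rw [e1, e2]
    linear_combination k ^ 2 * e3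
  have hcF : ContinuousOn (fun x => Du x 0 * Du x 0 + Du x 1 * Du x 1) (closure Ω) :=
    (cp1.mul cp1).add (cp2.mul cp2)
  have htan := fun (x : Pl) (hx : x ∈ frontier Ω) =>
    tangential hΩ hcF ((dp1.mul dp1).add (dp2.mul dp2)).der (by fun_prop) (by fun_prop)
      (fun p hp q hq => by
        have hq' : q ∈ frontier Ω := connectedComponentIn_subset _ _ hq
        rw [hsqn p hp, hsqn q hq', (hbc p hp q hq).2]) hx
  obtain ⟨x0, hx0f, hx0⟩ := hstar_conn.nonempty
  have hsub : {p ∈ frontier Ω | ⟪Du p, η p⟫ ≠ 0} ⊆ connectedComponentIn (frontier Ω) x0 :=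
    hstar_conn.isPreconnected.subset_connectedComponentIn ⟨hx0f, hx0⟩ (fun x hx => hx.1)
  refine ⟨fun x => H x e0 0, fun x => H x e1 0, fun x => H x e1 1, u x0, ⟪Du x0, η x0⟫, ?_⟩
  refine
    { dom := hΩ, cu := hucl, cp1 := cp1, cp2 := cp2, cr := cr, cs := cs, ct := ct, du := du,
      dp1 := dp1, dp2 := dp2, eq := ?_, star := ?_, nstar := ?_, tan := ?_, hη := hnu, hb := hx0,
      Ssub := fun x hx => hx.1, nS := ?_ }
  · intro x hx
    have h1 := meanCurv_eq (u := u) (s' := fun x => H x e1 0) ho (fun x hx => by rw [hDu x hx])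
      (fun x hx => by rw [hDu x hx]) dp1 dp2 hx
    rw [← h1]; linarith [heq x hx]
  · intro x hx
    obtain ⟨h1, h2⟩ := hbc x0 hx0f x (hsub hx)
    refine ⟨h1, ?_, ?_⟩
    · rw [← h2]; exact hD0 x hx.1
    · rw [← h2]; exact hD1 x hx.1
  · intro x hx hxS
    have h0 : ⟪Du x, η x⟫ = 0 := by
      by_contra h0
      exact hxS ⟨hx, h0⟩
    have e1 := hD0 x hx
    have e2 := hD1 x hx
    rw [h0, zero_mul] at e1 e2
    exact ⟨e1, e2⟩
  · intro x hx
    have := htan x hx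
    beta_reduce at this
    linear_combination this / 2
  · by_contra hno
    push Not at hno
    apply hdisc
    have : frontier Ω = {p ∈ frontier Ω | ⟪Du p, η p⟫ ≠ 0} :=
      Subset.antisymm hno (fun x hx => hx.1)
    rw [this]; exact hstar_conn.isPreconnected

lemma Cap.hK {Ω : Set Pl} {η : Pl → Pl} {u p1 p2 r s t : Pl → ℝ} {H cst b : ℝ} {S : Set Pl}
    (h : Cap Ω η u p1 p2 r s t H cst b S) (hbdd : BddBelow (u '' Ω)) :
    ∀ x ∈ Ω, p1 x ^ 2 + p2 x ^ 2 ≤ b ^ 2 := by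
  obtain ⟨m, hm⟩ := hbdd
  rcases le_or_gt 0 H with hH | hH
  · exact h.grad_bound hH (m := m) fun x hx => hm ⟨x, hx, rfl⟩
  · have h1 := h.le_of_neg hH
    have h2 := h.neg.grad_bound (by linarith) (m := -cst) (fun x hx => by linarith [h1 x hx])
    intro x hx
    have := h2 x hx
    simpa using this

lemma Cap.choose_dir {Ω : Set Pl} {η : Pl → Pl} {u p1 p2 r s t : Pl → ℝ} {H cst b : ℝ} {S : Set Pl}
    (h : Cap Ω η u p1 p2 r s t H cst b S) {v : Pl} (hv : ‖v‖ = 1)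
    (hsign : (∀ p ∈ S, 0 ≤ ⟪η p, v⟫) ∨ (∀ p ∈ S, ⟪η p, v⟫ ≤ 0)) :
    ∃ c d : ℝ, c ^ 2 + d ^ 2 = 1 ∧ ∀ x ∈ frontier Ω, 0 ≤ c * p1 x + d * p2 x := by
  have hv2 : v 0 ^ 2 + v 1 ^ 2 = 1 := by rw [← normsq_eq, hv]; norm_num
  have hS : (∀ p ∈ S, 0 ≤ b * ⟪η p, v⟫) ∨ (∀ p ∈ S, b * ⟪η p, v⟫ ≤ 0) := by
    rcases le_total 0 b with hb | hb
    · rcases hsign with hs | hs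
      · exact Or.inl fun p hp => mul_nonneg hb (hs p hp)
      · exact Or.inr fun p hp => mul_nonpos_of_nonneg_of_nonpos hb (hs p hp)
    · rcases hsign with hs | hs
      · exact Or.inr fun p hp => mul_nonpos_of_nonpos_of_nonneg hb (hs p hp)
      · exact Or.inl fun p hp => mul_nonneg_of_nonpos_of_nonpos hb (hs p hp)
  rcases hS with hS | hS
  · refine ⟨v 0, v 1, hv2, fun x hx => ?_⟩
    by_cases hxS : x ∈ S
    · obtain ⟨-, q1, q2⟩ := h.star x hxS
      have := hS x hxS
      rw [inner_eq] at this
      rw [q1, q2]; linarith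
    · obtain ⟨q1, q2⟩ := h.nstar x hx hxS
      rw [q1, q2]; simp
  · refine ⟨-v 0, -v 1, by linarith, fun x hx => ?_⟩
    by_cases hxS : x ∈ S
    · obtain ⟨-, q1, q2⟩ := h.star x hxS
      have := hS x hxS
      rw [inner_eq] at this
      rw [q1, q2]; linarith
    · obtain ⟨q1, q2⟩ := h.nstar x hx hxS
      rw [q1, q2]; simp

/-- Theorem 1.2(ii) of the paper: a capillary CMC graph over a planar `C²` domain with
disconnected boundary and connected, mildly `v`-transverse `∂⋆Ω` is a monotone piece of a
circular cylinder over a slab. -/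
theorem capillary_cmc_cylinder
    (Ω : Set (EuclideanSpace ℝ (Fin 2)))
    (η : EuclideanSpace ℝ (Fin 2) → EuclideanSpace ℝ (Fin 2))
    (hΩ : IsCkDomainWithNormal 2 Ω η)
    (u : EuclideanSpace ℝ (Fin 2) → ℝ)
    (hu2 : ContDiffOn ℝ 2 u Ω) (hucl : ContinuousOn u (closure Ω))
    (Du : EuclideanSpace ℝ (Fin 2) → EuclideanSpace ℝ (Fin 2))
    (hDu : ∀ x ∈ Ω, Du x = gradient u x) (hDuc : ContinuousOn Du (closure Ω))
    (hD2u : ∃ H : EuclideanSpace ℝ (Fin 2) →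
        EuclideanSpace ℝ (Fin 2) →L[ℝ] EuclideanSpace ℝ (Fin 2),
      ContinuousOn H (closure Ω) ∧ ∀ x ∈ Ω, H x = fderiv ℝ (gradient u) x)
    (hnc : ¬ ∃ c : ℝ, ∀ x ∈ Ω, u x = c)
    (H₀ : ℝ) (heq : ∀ x ∈ Ω, meanCurv u x + H₀ = 0)
    (hbc : ∀ p ∈ frontier Ω, ∀ q ∈ connectedComponentIn (frontier Ω) p,
      u q = u p ∧ ⟪Du q, η q⟫ = ⟪Du p, η p⟫)
    (hbdd : BddBelow (u '' Ω))
    (hdisc : ¬ IsPreconnected (frontier Ω))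
    (hstar_ne : {p ∈ frontier Ω | ⟪Du p, η p⟫ ≠ 0}.Nonempty)
    (hstar_conn : IsConnected {p ∈ frontier Ω | ⟪Du p, η p⟫ ≠ 0})
    (v : EuclideanSpace ℝ (Fin 2)) (hv : ‖v‖ = 1)
    (hsign : (∀ p ∈ {p ∈ frontier Ω | ⟪Du p, η p⟫ ≠ 0}, 0 ≤ ⟪η p, v⟫) ∨
      (∀ p ∈ {p ∈ frontier Ω | ⟪Du p, η p⟫ ≠ 0}, ⟪η p, v⟫ ≤ 0)) :
    H₀ ≠ 0 ∧ ∃ e : EuclideanSpace ℝ (Fin 2), ‖e‖ = 1 ∧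
      ∃ s₁ s₂ t₀ z₀ : ℝ, s₁ < s₂ ∧ ∃ u₀ : ℝ → ℝ,
        (StrictMonoOn u₀ (Ioo s₁ s₂) ∨ StrictAntiOn u₀ (Ioo s₁ s₂)) ∧
        Ω = {x | ⟪x, e⟫ ∈ Ioo s₁ s₂} ∧
        (∀ x ∈ Ω, u x = u₀ ⟪x, e⟫) ∧
        ∀ t ∈ Ioo s₁ s₂, (t - t₀) ^ 2 + (u₀ t - z₀) ^ 2 = 1 / H₀ ^ 2 := by
  obtain ⟨r, s, t, cst, b, h⟩ := build_cap Ω η hΩ u hu2 hucl Du hDu hDuc hD2u H₀ heq hbc hdisc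
    hstar_conn
  have hK := h.hK hbdd
  obtain ⟨c, d, hcd, hw⟩ := h.choose_dir hv hsign
  have hw0 := h.w_nonneg hK hcd hw
  have hy := h.y_zero hK hcd hw0
  have hH := h.H_ne hy hnc
  obtain ⟨a, a', ha, hd⟩ := h.dir hH hy hcd hw0
  obtain ⟨t₀, z₀, h1, h2, h3⟩ := h.explicit hH hy ha hd
  exact ⟨hH, h.slab hH hstar_conn.isPreconnected ha h1 h2 h3⟩
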